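/- For any instance with exactly 3 agents whose true valuations are additive, and any bid profile b = (b_1, b_2, b_3) in which agent i's bid b_i is a best response to the other agents' bids, the allocation produced by Preferred-Item-E-C-E on b is (1/2)-EF1 from agent i's perspective with respect to agent i's true valuation. -/

import Mathlib

/-!
Formalization of the strategic Envy-Cycle-Elimination (E-C-E) setting.

There are `n` agents and `m` goods (`Fin m`), with the predefined ordering of agents
and goods given by the orders on `Fin n` and `Fin m`.  A bid consists of a reported
additive valuation (a nonnegative value for every good) together with a preference
list (a permutation of the goods).  E-C-E starts from empty bundles and, while
unallocated goods remain, selects a source of the envy graph (according to the rule of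
the respective variant), adds one unallocated good to that agent's bundle (again
according to the rule of the respective variant), and then repeatedly eliminates envy
cycles, in a fixed order, until the envy graph has a source.
-/

open scoped Classical
open Finset

/-- A bid of an agent: a reported additive valuation (a nonnegative value for every
good) together with a preference list, a permutation of the goods. -/
structure Bid (m : ℕ) where
  val : Fin m → ℝ
  nonneg : ∀ g, 0 ≤ val g
  pref : Equiv.Perm (Fin m)

namespace ECE

variable {n m : ℕ}

/-- Reported (additive) value of a bundle. -/
noncomputable def bval (b : Bid m) (S : Finset (Fin m)) : ℝ := ∑ g ∈ S, b.val g

/-- (True, additive) value of a bundle under the valuation `v`. -/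
noncomputable def value (v : Fin m → ℝ) (S : Finset (Fin m)) : ℝ := ∑ g ∈ S, v g

/-- Envy-graph edge: agent `i` envies agent `j` (w.r.t. the reported valuations) under
the partial allocation `P`. -/
def envies (b : Fin n → Bid m) (P : Fin n → Finset (Fin m)) (i j : Fin n) : Prop :=
  bval (b i) (P i) < bval (b i) (P j)

/-- The sources (vertices of in-degree 0) of the envy graph. -/
noncomputable def sources (b : Fin n → Bid m) (P : Fin n → Finset (Fin m)) :
    Finset (Fin n) :=
  univ.filter fun i => ∀ j, ¬ envies b P j i

/-- The envy cycles of the current envy graph, represented as cyclic permutations `σ`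
of the agents such that every agent moved by `σ` envies her image under `σ`. -/
noncomputable def cycleSet (b : Fin n → Bid m) (P : Fin n → Finset (Fin m)) :
    Finset (Equiv.Perm (Fin n)) :=
  univ.filter fun σ => σ.IsCycle ∧ ∀ i, σ i ≠ i → envies b P i (σ i)

/-- A fixed enumeration of the permutations of the agents, providing the fixed
(lexicographic) order in which envy cycles are eliminated. -/
noncomputable def permIdx (n : ℕ) :
    Equiv.Perm (Fin n) ≃ Fin (Fintype.card (Equiv.Perm (Fin n))) :=
  Fintype.equivFin _

/-- Eliminate one envy cycle (the first one in the fixed order): every agent on the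
cycle receives the bundle of the agent she envies. -/
noncomputable def elimOnce (b : Fin n → Bid m) (P : Fin n → Finset (Fin m)) :
    Fin n → Finset (Fin m) :=
  if h : (cycleSet b P).Nonempty then
    let σ := (permIdx n).symm (((cycleSet b P).image (permIdx n)).min' (h.image _))
    fun i => P (σ i)
  else P

/-- Repeatedly eliminate envy cycles until the envy graph has a source. -/
noncomputable def resolve (b : Fin n → Bid m) :
    ℕ → (Fin n → Finset (Fin m)) → Fin n → Finset (Fin m)
  | 0, P => P
  | fuel + 1, P => if (sources b P).Nonempty then P else resolve b fuel (elimOnce b P)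

/-- The state (current partial allocation, remaining unallocated goods) of an E-C-E
run after a given number of steps.  In each step, if unallocated goods remain, the
agent chosen by `pickAgent` (a source of the envy graph) receives the good chosen by
`pickItem`, and afterwards envy cycles are eliminated until the graph has a source. -/
noncomputable def stateECE (b : Fin n → Bid m)
    (pickAgent : (Fin n → Finset (Fin m)) → Option (Fin n))
    (pickItem : Fin n → (R : Finset (Fin m)) → R.Nonempty → Fin m) :
    ℕ → (Fin n → Finset (Fin m)) × Finset (Fin m)
  | 0 => (fun _ => ∅, univ)
  | k + 1 =>
    let s := stateECE b pickAgent pickItem k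
    if hR : s.2.Nonempty then
      match pickAgent s.1 with
      | none => s
      | some i =>
        let g := pickItem i s.2 hR
        (resolve b (n * n + 1) (fun j => if j = i then insert g (s.1 j) else s.1 j),
          s.2.erase g)
    else s

/-- Source selection of Standard-E-C-E: among multiple sources, the agent earliest in
the predefined ordering of the agents. -/
noncomputable def stdAgent (b : Fin n → Bid m) (P : Fin n → Finset (Fin m)) :
    Option (Fin n) :=
  if h : (sources b P).Nonempty then some ((sources b P).min' h) else none

/-- Source selection of the Priority variants: among multiple sources, those having at
least one outgoing envy edge have priority, ties broken by the predefined ordering of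
the agents. -/
noncomputable def priAgent (b : Fin n → Bid m) (P : Fin n → Finset (Fin m)) :
    Option (Fin n) :=
  if h' : ((sources b P).filter fun i => ∃ j, envies b P i j).Nonempty then
    some (((sources b P).filter fun i => ∃ j, envies b P i j).min' h')
  else if h : (sources b P).Nonempty then some ((sources b P).min' h) else none

/-- The unallocated good of highest reported value, ties broken by the predefined
ordering of the goods. -/
noncomputable def bestItem (v : Fin m → ℝ) (R : Finset (Fin m)) (hR : R.Nonempty) :
    Fin m :=
  (R.filter fun g => ∀ g' ∈ R, v g' ≤ v g).min' (by
    obtain ⟨g, hg, hmax⟩ := R.exists_max_image v hR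
    exact ⟨g, mem_filter.2 ⟨hg, hmax⟩⟩)

/-- The earliest unallocated good in the preference list `pref`. -/
noncomputable def preferredItem (pref : Equiv.Perm (Fin m)) (R : Finset (Fin m))
    (hR : R.Nonempty) : Fin m :=
  pref.symm ((R.image pref).min' (hR.image _))

/-- Standard-E-C-E: sources chosen by the predefined agent ordering, goods assigned in
the predefined ordering of the goods. -/
noncomputable def Standard (b : Fin n → Bid m) : Fin n → Finset (Fin m) :=
  (stateECE b (stdAgent b) (fun _ R hR => R.min' hR) m).1

/-- Priority-E-C-E: envious sources have priority (ties broken by the agent ordering),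
goods assigned in the predefined ordering of the goods. -/
noncomputable def Priority (b : Fin n → Bid m) : Fin n → Finset (Fin m) :=
  (stateECE b (priAgent b) (fun _ R hR => R.min' hR) m).1

/-- Best-Item-E-C-E: envious sources have priority, and the chosen agent receives her
unallocated good of highest reported value (ties broken by the good ordering). -/
noncomputable def BestItemECE (b : Fin n → Bid m) : Fin n → Finset (Fin m) :=
  (stateECE b (priAgent b) (fun i R hR => bestItem (b i).val R hR) m).1

/-- Preferred-Item-E-C-E: envious sources have priority, and the chosen agent receives
the earliest unallocated good in her preference list. -/
noncomputable def PreferredItemECE (b : Fin n → Bid m) : Fin n → Finset (Fin m) :=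
  (stateECE b (priAgent b) (fun i R hR => preferredItem (b i).pref R hR) m).1

/-- The allocation `A` is `α`-EF1 from agent `i`'s perspective w.r.t. the valuation
`v`: for every agent `j` with nonempty bundle there is a good `g ∈ A j` with
`v (A i) ≥ α · v (A j \ {g})`. -/
def EF1From (α : ℝ) (v : Fin m → ℝ) (A : Fin n → Finset (Fin m)) (i : Fin n) : Prop :=
  ∀ j : Fin n, (A j).Nonempty → ∃ g ∈ A j, α * value v ((A j).erase g) ≤ value v (A i)

/-- The allocation `A` is EF1 w.r.t. the valuations `v`. -/
def IsEF1 (v : Fin n → Fin m → ℝ) (A : Fin n → Finset (Fin m)) : Prop :=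
  ∀ i : Fin n, EF1From 1 (v i) A i

/-- Agent `i`'s bid in the profile `b` is a best response to the others' bids, w.r.t.
her true (additive) valuation `v`: no alternative bid gives her a bundle of strictly
larger true value. -/
def BestResponse (Mech : (Fin n → Bid m) → Fin n → Finset (Fin m))
    (v : Fin m → ℝ) (b : Fin n → Bid m) (i : Fin n) : Prop :=
  ∀ b' : Bid m, value v (Mech (Function.update b i b') i) ≤ value v (Mech b i)

/-- The bid profile `b` is a pure Nash equilibrium of the mechanism `Mech` w.r.t. the
true (additive) valuations `v`. -/
def IsPNE (Mech : (Fin n → Bid m) → Fin n → Finset (Fin m))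
    (v : Fin n → Fin m → ℝ) (b : Fin n → Bid m) : Prop :=
  ∀ i : Fin n, BestResponse Mech (v i) b i

end ECE

open ECE

namespace ECE

open scoped Classical
open Finset

variable {n m : ℕ}

/-- A vertex without incoming edges. -/
def IsSrc (E : Fin n → Fin n → Prop) (y : Fin n) : Prop := ∀ z, ¬ E z y

/-- A vertex with an outgoing edge. -/
def HasOut (E : Fin n → Fin n → Prop) (y : Fin n) : Prop := ∃ z, E y z

/-- The source selected by the priority rule. -/
def IsPick (E : Fin n → Fin n → Prop) (y : Fin n) : Prop :=
  IsSrc E y ∧ ∀ z, IsSrc E z → (HasOut E z → HasOut E y) ∧ ((HasOut E y → HasOut E z) → y ≤ z)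

/-- A cyclic permutation along the edges of `E`. -/
def IsCyc (E : Fin n → Fin n → Prop) (σ : Equiv.Perm (Fin n)) : Prop :=
  σ.IsCycle ∧ ∀ y, σ y ≠ y → E y (σ y)

/-- The first cycle of `E` in the fixed order. -/
def IsMinCyc (E : Fin n → Fin n → Prop) (σ : Equiv.Perm (Fin n)) : Prop :=
  IsCyc E σ ∧ ∀ ρ, IsCyc E ρ → permIdx n σ ≤ permIdx n ρ

lemma IsMinCyc.unique {E : Fin n → Fin n → Prop} {σ ρ : Equiv.Perm (Fin n)}
    (h : IsMinCyc E σ) (h' : IsMinCyc E ρ) : σ = ρ :=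
  (permIdx n).injective (le_antisymm (h.2 _ h'.1) (h'.2 _ h.1))

lemma IsMinCyc.mono {E E' : Fin n → Fin n → Prop} {σ : Equiv.Perm (Fin n)}
    (h : IsMinCyc E σ) (hE : ∀ y z, E' y z → E y z) (hσ : ∀ y, σ y ≠ y → E' y (σ y)) :
    IsMinCyc E' σ :=
  ⟨⟨h.1.1, hσ⟩, fun ρ hρ => h.2 ρ ⟨hρ.1, fun y hy => hE _ _ (hρ.2 y hy)⟩⟩

lemma IsPick.unique {E : Fin n → Fin n → Prop} {y z : Fin n}
    (h : IsPick E y) (h' : IsPick E z) : y = z :=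
  le_antisymm ((h.2 z h'.1).2 (h'.2 y h.1).1) ((h'.2 y h.1).2 (h.2 z h'.1).1)

lemma exists_isMinCyc {E : Fin n → Fin n → Prop} (h : ∃ σ, IsCyc E σ) : ∃ σ, IsMinCyc E σ := by
  obtain ⟨σ, hσ, hmin⟩ := (univ.filter fun σ => IsCyc E σ).exists_min_image (permIdx n)
    (by obtain ⟨σ, hσ⟩ := h; exact ⟨σ, by simpa using hσ⟩)
  exact ⟨σ, (mem_filter.1 hσ).2, fun ρ hρ => hmin ρ (mem_filter.2 ⟨mem_univ _, hρ⟩)⟩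

lemma exists_isPick {E : Fin n → Fin n → Prop} (h : ∃ y, IsSrc E y) : ∃ y, IsPick E y := by
  by_cases h' : ∃ y, IsSrc E y ∧ HasOut E y
  · obtain ⟨y, hy, hmin⟩ := (univ.filter fun y => IsSrc E y ∧ HasOut E y).exists_min_image id
      (by obtain ⟨y, hy⟩ := h'; exact ⟨y, by simpa using hy⟩)
    have hy' := (mem_filter.1 hy).2
    exact ⟨y, hy'.1, fun z hz => ⟨fun _ => hy'.2, fun hh =>
      hmin z (mem_filter.2 ⟨mem_univ _, hz, hh hy'.2⟩)⟩⟩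
  · obtain ⟨y, hy, hmin⟩ := (univ.filter fun y => IsSrc E y).exists_min_image id
      (by obtain ⟨y, hy⟩ := h; exact ⟨y, by simpa using hy⟩)
    exact ⟨y, (mem_filter.1 hy).2, fun z hz => ⟨fun ho => (h' ⟨z, hz, ho⟩).elim, fun _ =>
      hmin z (mem_filter.2 ⟨mem_univ _, hz⟩)⟩⟩

lemma mem_sources {b : Fin n → Bid m} {P : Fin n → Finset (Fin m)} {y : Fin n} :
    y ∈ sources b P ↔ IsSrc (envies b P) y := by
  unfold sources
  rw [mem_filter]
  exact ⟨fun h => h.2, fun h => ⟨mem_univ _, h⟩⟩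

lemma isPick_priAgent {b : Fin n → Bid m} {P : Fin n → Finset (Fin m)} {y : Fin n}
    (h : IsPick (envies b P) y) : priAgent b P = some y := by
  have key : ∀ z, priAgent b P = some z → z = y := by
    intro z hz
    unfold priAgent at hz
    split_ifs at hz with h1 h2
    · have hz' := Option.some.inj hz
      have hm := Finset.min'_mem _ h1
      rw [hz', mem_filter] at hm
      have hs : IsSrc (envies b P) z := (mem_filter.1 hm.1).2
      refine IsPick.unique (E := envies b P) ⟨hs, fun u hu => ⟨fun _ => hm.2, fun ho => ?_⟩⟩ h
      rw [← hz']
      refine Finset.min'_le _ _ ?_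
      rw [mem_filter]
      exact ⟨mem_sources.2 hu, ho hm.2⟩
    · have hz' := Option.some.inj hz
      have hm := Finset.min'_mem _ h2
      rw [hz'] at hm
      have hs : IsSrc (envies b P) z := (mem_filter.1 hm).2
      refine IsPick.unique (E := envies b P) ⟨hs, fun u hu => ⟨fun ho => ?_, fun _ => ?_⟩⟩ h
      · refine (h1 ⟨u, ?_⟩).elim
        rw [mem_filter]
        exact ⟨mem_sources.2 hu, ho⟩
      · rw [← hz']
        exact Finset.min'_le _ _ (mem_sources.2 hu)
  have hs : (sources b P).Nonempty := ⟨y, mem_filter.2 ⟨mem_univ _, h.1⟩⟩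
  cases hp : priAgent b P with
  | some z => rw [key z hp]
  | none =>
    unfold priAgent at hp
    split_ifs at hp

lemma sources_nonempty_iff {b : Fin n → Bid m} {P : Fin n → Finset (Fin m)} :
    (sources b P).Nonempty ↔ ∃ y, IsSrc (envies b P) y := by
  constructor
  · rintro ⟨y, hy⟩; exact ⟨y, (mem_filter.1 hy).2⟩
  · rintro ⟨y, hy⟩; exact ⟨y, mem_filter.2 ⟨mem_univ _, hy⟩⟩

lemma IsMinCyc.elimOnce_eq {b : Fin n → Bid m} {P : Fin n → Finset (Fin m)}
    {σ : Equiv.Perm (Fin n)} (h : IsMinCyc (envies b P) σ) :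
    elimOnce b P = fun y => P (σ y) := by
  have hσ : σ ∈ cycleSet b P := mem_filter.2 ⟨mem_univ _, h.1⟩
  have hne : (cycleSet b P).Nonempty := ⟨σ, hσ⟩
  unfold elimOnce
  rw [dif_pos hne]
  have : ((cycleSet b P).image (permIdx n)).min' (hne.image _) = permIdx n σ := by
    apply le_antisymm
    · exact Finset.min'_le _ _ (mem_image_of_mem _ hσ)
    · apply Finset.le_min'
      intro z hz
      obtain ⟨ρ, hρ, rfl⟩ := mem_image.1 hz
      exact h.2 ρ (mem_filter.1 hρ).2
  simp only [this, Equiv.symm_apply_apply]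

/-- The number of edges of the envy graph. -/
noncomputable def edgeCount (E : Fin n → Fin n → Prop) : ℕ :=
  ∑ y, (univ.filter fun z => E y z).card

lemma edgeCount_le (E : Fin n → Fin n → Prop) : edgeCount E ≤ n * n := by
  unfold edgeCount
  calc _ ≤ ∑ y : Fin n, n := Finset.sum_le_sum fun y _ => by
        simpa using Finset.card_le_univ (univ.filter fun z => E y z)
    _ = n * n := by simp

lemma edgeCount_lt {E E' : Fin n → Fin n → Prop} {f : Fin n → Fin n → ℝ}
    {σ : Equiv.Perm (Fin n)} (h : IsCyc E σ) (hE : ∀ y z, E y z ↔ f y y < f y z)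
    (hE' : ∀ y z, E' y z ↔ f y (σ y) < f y (σ z)) : edgeCount E' < edgeCount E := by
  have hcard : ∀ y, (univ.filter fun z => E' y z).card
      = (univ.filter fun z => f y (σ y) < f y z).card := by
    intro y
    apply Finset.card_bij (fun z _ => σ z)
    · intro z hz; simpa [hE'] using hz
    · intro z _ z' _ hzz; exact σ.injective hzz
    · intro z hz; exact ⟨σ.symm z, by simpa [hE'] using hz, by simp⟩
  unfold edgeCount
  simp only [hcard]
  have hle : ∀ y, f y y ≤ f y (σ y) := by
    intro y
    by_cases hy : σ y = y
    · rw [hy]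
    · exact ((hE _ _).1 (h.2 y hy)).le
  obtain ⟨y, hy, -⟩ := h.1
  refine Finset.sum_lt_sum (fun y _ => Finset.card_le_card fun z => ?_) ⟨y, mem_univ _,
    Finset.card_lt_card ⟨fun z => ?_, fun hss => ?_⟩⟩
  · simp only [mem_filter, mem_univ, true_and, hE]; exact (hle y).trans_lt
  · simp only [mem_filter, mem_univ, true_and, hE]; exact (hle y).trans_lt
  · have : σ y ∈ univ.filter fun z => f y (σ y) < f y z :=
      hss (mem_filter.2 ⟨mem_univ _, h.2 y hy⟩)
    simp at this

lemma isCycle_of_ne_one {σ : Equiv.Perm (Fin 3)} (h : σ ≠ 1) : σ.IsCycle := by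
  have h1 : σ.support.card ≤ 3 := by simpa using Finset.card_le_univ σ.support
  have h2 := Equiv.Perm.two_le_card_support_of_ne_one h
  interval_cases hc : σ.support.card
  · exact (Equiv.Perm.card_support_eq_two.1 hc).isCycle
  · exact (card_support_eq_three_iff.1 hc).isCycle

lemma exists_isCyc {E : Fin 3 → Fin 3 → Prop} (hirr : ∀ y, ¬ E y y)
    (h : ¬ ∃ y, IsSrc E y) : ∃ σ, IsCyc E σ := by
  have h' : ∀ y, ∃ z, E z y := by simpa [IsSrc] using h
  choose f hf using h'
  have hne : ∀ y, f y ≠ y := fun y hy => hirr y (by simpa [hy] using hf y)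
  have key : ∃ σ : Equiv.Perm (Fin 3), σ ≠ 1 ∧ ∀ y, σ y ≠ y → f (σ y) = y := by
    clear hf h hirr
    revert f
    decide
  obtain ⟨σ, h1, h2⟩ := key
  refine ⟨σ, isCycle_of_ne_one h1, fun y hy => ?_⟩
  have := hf (σ y)
  rwa [h2 y hy] at this

lemma bval_insert {b : Bid m} {S : Finset (Fin m)} {g : Fin m} (h : g ∉ S) :
    bval b (insert g S) = bval b S + b.val g := by
  unfold bval; rw [Finset.sum_insert h, add_comm]

lemma value_insert {v : Fin m → ℝ} {S : Finset (Fin m)} {g : Fin m} (h : g ∉ S) :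
    value v (insert g S) = value v S + v g := by
  unfold value; rw [Finset.sum_insert h, add_comm]

lemma value_erase {v : Fin m → ℝ} {S : Finset (Fin m)} {g : Fin m} (h : g ∈ S) :
    value v (S.erase g) = value v S - v g := by
  unfold value; rw [← Finset.add_sum_erase _ _ h]; ring

lemma bval_erase {b : Bid m} {S : Finset (Fin m)} {g : Fin m} (h : g ∈ S) :
    bval b (S.erase g) = bval b S - b.val g := by
  unfold bval; rw [← Finset.add_sum_erase _ _ h]; ring

lemma preferredItem_mem {f : Equiv.Perm (Fin m)} {R : Finset (Fin m)} (hR : R.Nonempty) :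
    preferredItem f R hR ∈ R := by
  have h := Finset.min'_mem (R.image f) (hR.image _)
  obtain ⟨g, hg, h⟩ := mem_image.1 h
  unfold preferredItem
  rw [← h]; simpa using hg

lemma preferredItem_le {f : Equiv.Perm (Fin m)} {R : Finset (Fin m)} (hR : R.Nonempty)
    {g : Fin m} (hg : g ∈ R) : f (preferredItem f R hR) ≤ f g := by
  unfold preferredItem
  rw [Equiv.apply_symm_apply]
  exact Finset.min'_le _ _ (mem_image_of_mem _ hg)

lemma preferredItem_eq {f : Equiv.Perm (Fin m)} {R : Finset (Fin m)} (hR : R.Nonempty)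
    {g : Fin m} (hg : g ∈ R) (h : ∀ k ∈ R, f g ≤ f k) : preferredItem f R hR = g :=
  f.injective (le_antisymm (preferredItem_le hR hg) (h _ (preferredItem_mem hR)))

/-- One step of Preferred-Item-E-C-E. -/
noncomputable def prefStep (b : Fin n → Bid m)
    (s : (Fin n → Finset (Fin m)) × Finset (Fin m)) :
    (Fin n → Finset (Fin m)) × Finset (Fin m) :=
  if hR : s.2.Nonempty then
    match priAgent b s.1 with
    | none => s
    | some i =>
      let g := preferredItem (b i).pref s.2 hR
      (resolve b (n * n + 1) (fun j => if j = i then insert g (s.1 j) else s.1 j), s.2.erase g)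
  else s

lemma preferredItemECE_eq (b : Fin n → Bid m) :
    PreferredItemECE b = ((prefStep b)^[m] (fun _ => ∅, univ)).1 := by
  unfold PreferredItemECE
  congr 1
  have : ∀ k, stateECE b (priAgent b) (fun i R hR => preferredItem (b i).pref R hR) k
      = (prefStep b)^[k] (fun _ => ∅, univ) := by
    intro k
    induction k with
    | zero => rfl
    | succ k ih =>
      rw [Function.iterate_succ_apply', ← ih]
      rfl
  exact this m

lemma prefStep_eq {b : Fin n → Bid m} {P : Fin n → Finset (Fin m)} {R : Finset (Fin m)}
    {y : Fin n} (hy : IsPick (envies b P) y) (hR : R.Nonempty) :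
    prefStep b (P, R) = (resolve b (n * n + 1)
      (Function.update P y (insert (preferredItem (b y).pref R hR) (P y))),
      R.erase (preferredItem (b y).pref R hR)) := by
  unfold prefStep
  rw [dif_pos hR]
  simp only [isPick_priAgent hy]
  congr 2
  ext1 j
  by_cases h : j = y
  · subst h; simp
  · simp [h]

lemma resolve_of_isSrc {b : Fin n → Bid m} {P : Fin n → Finset (Fin m)} {k : ℕ}
    (h : ∃ y, IsSrc (envies b P) y) : resolve b k P = P := by
  cases k with
  | zero => rfl
  | succ k => simp [resolve, sources_nonempty_iff.2 h]

lemma resolve_of_not_isSrc {b : Fin n → Bid m} {P : Fin n → Finset (Fin m)} {k : ℕ}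
    {σ : Equiv.Perm (Fin n)}
    (h : ¬ ∃ y, IsSrc (envies b P) y) (hσ : IsMinCyc (envies b P) σ) :
    resolve b (k + 1) P = resolve b k (fun y => P (σ y)) := by
  have : ¬ (sources b P).Nonempty := fun h' => h (sources_nonempty_iff.1 h')
  rw [resolve, if_neg this, hσ.elimOnce_eq]

/-- Edges of the envy graph in which agent `i` values the current bundles by `ω`. -/
def Env (b : Fin n → Bid m) (i : Fin n) (P : Fin n → Finset (Fin m)) (ω : Fin n → ℝ)
    (y z : Fin n) : Prop :=
  if y = i then ω y < ω z else bval (b y) (P y) < bval (b y) (P z)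

lemma env_lt_iff {b : Fin n → Bid m} {i : Fin n} {P : Fin n → Finset (Fin m)} {ω : Fin n → ℝ}
    (y z : Fin n) : Env b i P ω y z ↔
      (fun y z => if y = i then ω z else bval (b y) (P z)) y y <
      (fun y z => if y = i then ω z else bval (b y) (P z)) y z := by
  unfold Env; by_cases h : y = i <;> simp [h]

lemma env_edgeCount_lt {b : Fin n → Bid m} {i : Fin n} {P : Fin n → Finset (Fin m)}
    {ω : Fin n → ℝ} {σ : Equiv.Perm (Fin n)} (h : IsCyc (Env b i P ω) σ) :
    edgeCount (Env b i (fun y => P (σ y)) (fun y => ω (σ y))) < edgeCount (Env b i P ω) :=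
  edgeCount_lt (f := fun y z => if y = i then ω z else bval (b y) (P z)) h env_lt_iff
    (fun y z => env_lt_iff (P := fun y => P (σ y)) (ω := fun y => ω (σ y)) y z)

lemma env_self {b : Fin n → Bid m} {i : Fin n} {P : Fin n → Finset (Fin m)} :
    Env b i P (fun y => bval (b i) (P y)) = envies b P := by
  ext y z
  unfold Env envies
  split_ifs with h
  · rw [h]
  · rfl

/-- From the given state, agent `i` can obtain a bundle of value more than `x` by fixing
the values of goods and her picks along the way. -/
inductive Win (b : Fin n → Bid m) (i : Fin n) (v : Fin m → ℝ) (x : ℝ) :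
    (Fin n → Finset (Fin m)) → Finset (Fin m) → (Fin n → ℝ) → Prop
  | fin {P R ω} : R = ∅ → (∃ y, IsSrc (Env b i P ω) y) → x < value v (P i) → Win b i v x P R ω
  | elim {P R ω} (σ : Equiv.Perm (Fin n)) : (¬ ∃ y, IsSrc (Env b i P ω) y) →
      IsMinCyc (Env b i P ω) σ → Win b i v x (fun y => P (σ y)) R (fun y => ω (σ y)) →
      Win b i v x P R ω
  | pick {P R ω} (y : Fin n) (g : Fin m) (c : ℝ) : IsPick (Env b i P ω) y → g ∈ R →
      (y ≠ i → ∀ k ∈ R, (b y).pref g ≤ (b y).pref k) → ω y ≤ c →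
      Win b i v x (Function.update P y (insert g (P y))) (R.erase g) (Function.update ω y c) →
      Win b i v x P R ω

lemma exists_perm_of_list (l : List (Fin m)) (hl : l.Nodup) (hu : l.toFinset = univ) :
    ∃ f : Equiv.Perm (Fin m), l.Pairwise fun a c => f a < f c := by
  have hmem : ∀ g, g ∈ l := fun g => by
    have := mem_univ g; rw [← hu] at this; simpa using this
  have hlen : l.length = m := by
    rw [← List.toFinset_card_of_nodup hl, hu]; simp
  refine ⟨(hl.getEquivOfForallMemList l hmem).symm.trans (finCongr hlen), ?_⟩
  rw [List.pairwise_iff_getElem]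
  intro j k hj hk hjk
  have key : ∀ j (hj : j < l.length), ((hl.getEquivOfForallMemList l hmem).symm l[j]) = ⟨j, hj⟩ := by
    intro j hj
    rw [Equiv.symm_apply_eq]; rfl
  simp [key, Fin.lt_def, hjk]

end ECE

namespace ECE

open scoped Classical
open Finset

variable {n m : ℕ}

lemma env_update {b : Fin n → Bid m} {i : Fin n} {b' : Bid m} {P : Fin n → Finset (Fin m)}
    {ω : Fin n → ℝ} (h : ∀ y, bval b' (P y) = ω y) :
    envies (Function.update b i b') P = Env b i P ω := by
  ext y z
  unfold Env envies
  by_cases hy : y = i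
  · subst hy; simp [h]
  · simp [hy]

lemma Win.realize {b : Fin n → Bid m} {i : Fin n} {v : Fin m → ℝ} {x : ℝ}
    {P : Fin n → Finset (Fin m)} {R : Finset (Fin m)} {ω : Fin n → ℝ} (h : Win b i v x P R ω) :
    (∀ y, Disjoint (P y) R) → ∃ w : Fin m → ℝ, (∀ g ∈ R, 0 ≤ w g) ∧ ∃ l : List (Fin m),
      l.Nodup ∧ l.toFinset = R ∧ ∀ b' : Bid m, (∀ g ∈ R, b'.val g = w g) →
      (∀ y, bval b' (P y) = ω y) → (l.Pairwise fun a c => b'.pref a < b'.pref c) →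
      ∀ k, edgeCount (Env b i P ω) < k → x < value v (((prefStep (Function.update b i b'))^[R.card]
        (resolve (Function.update b i b') k P, R)).1 i) := by
  induction h with
  | @fin P R ω hR hs hx =>
    intro _
    subst hR
    refine ⟨fun _ => 0, by simp, [], by simp, by simp, ?_⟩
    intro b' _ hω _ k _
    rw [← env_update hω] at hs
    simpa [resolve_of_isSrc hs] using hx
  | @elim P R ω σ hs hσ _ ih =>
    intro hd
    obtain ⟨w, hw, l, hl, hlR, H⟩ := ih fun y => hd _
    refine ⟨w, hw, l, hl, hlR, fun b' hb' hω hp k hk => ?_⟩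
    have hlt := env_edgeCount_lt hσ.1
    have := H b' hb' (fun y => hω _) hp (k - 1) (by omega)
    obtain ⟨k, rfl⟩ : ∃ k', k = k' + 1 := ⟨k - 1, by omega⟩
    rw [← env_update hω] at hs hσ
    rwa [resolve_of_not_isSrc hs hσ]
  | @pick P R ω y g c hy hg hpref hc _ ih =>
    intro hd
    have hgP : ∀ z, g ∉ P z := fun z hz => Finset.disjoint_left.1 (hd z) hz hg
    obtain ⟨w, hw, l, hl, hlR, H⟩ := ih (by
      intro z
      by_cases hz : z = y
      · subst hz
        rw [Function.update_self, Finset.disjoint_insert_left]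
        exact ⟨by simp, (hd z).mono_right (Finset.erase_subset _ _)⟩
      · rw [Function.update_of_ne hz]
        exact (hd z).mono_right (Finset.erase_subset _ _))
    have hgl : g ∉ l := by
      intro h
      have : g ∈ R.erase g := by rw [← hlR]; simpa using h
      simp at this
    refine ⟨Function.update w g (c - ω y), ?_, g :: l, ?_, ?_, ?_⟩
    · intro k hk
      by_cases hkg : k = g
      · subst hkg; simpa using hc
      · rw [Function.update_of_ne hkg]; exact hw k (mem_erase.2 ⟨hkg, hk⟩)
    · simp [hgl, hl]
    · simp [hlR, Finset.insert_erase hg]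
    · intro b' hb' hω hp k _
      rw [List.pairwise_cons] at hp
      have hb'' : ∀ k ∈ R.erase g, b'.val k = w k := by
        intro k hk
        rw [hb' k (mem_erase.1 hk).2, Function.update_of_ne (mem_erase.1 hk).1]
      have hω' : ∀ z, bval b' (Function.update P y (insert g (P y)) z)
          = Function.update ω y c z := by
        intro z
        by_cases hz : z = y
        · subst hz
          simp only [Function.update_self]
          rw [bval_insert (hgP z), hω, hb' g hg, Function.update_self]; ring
        · simp only [Function.update_of_ne hz, hω]
      have hRne : R.Nonempty := ⟨g, hg⟩
      have hy' := hy
      rw [← env_update hω] at hy'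
      have hpi : preferredItem (Function.update b i b' y).pref R hRne = g := by
        apply preferredItem_eq hRne hg
        intro k hk
        by_cases hyi : y = i
        · subst hyi
          rw [Function.update_self]
          by_cases hkg : k = g
          · rw [hkg]
          · exact (hp.1 k (by rw [← List.mem_toFinset, hlR]; exact mem_erase.2 ⟨hkg, hk⟩)).le
        · rw [Function.update_of_ne hyi]; exact hpref hyi k hk
      have := H b' hb'' hω' hp.2 (n * n + 1) (Nat.lt_succ_of_le (edgeCount_le _))
      rw [resolve_of_isSrc ⟨y, hy'.1⟩, ← Finset.card_erase_add_one hg,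
        Function.iterate_succ_apply, prefStep_eq hy' hRne, hpi]
      exact this

/-- A best response leaves no winning strategy at the start. -/
lemma not_win_init {b : Fin n → Bid m} {i : Fin n} {v : Fin m → ℝ}
    (hbr : BestResponse PreferredItemECE v b i) :
    ¬ Win b i v (value v (PreferredItemECE b i)) (fun _ => ∅) univ (fun _ => 0) := by
  intro h
  obtain ⟨w, hw, l, hl, hlR, H⟩ := h.realize (by simp)
  obtain ⟨f, hf⟩ := exists_perm_of_list l hl hlR
  have := H ⟨w, fun g => hw g (mem_univ g), f⟩ (by simp) (by simp [bval]) hf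
    (n * n + 1) (Nat.lt_succ_of_le (edgeCount_le _))
  have hres : ∀ b'' : Fin n → Bid m, ∀ k, resolve b'' k (fun _ => (∅ : Finset (Fin m))) = fun _ => ∅ :=
    fun b'' k => resolve_of_isSrc ⟨i, fun z => by simp [envies]⟩
  rw [hres, Finset.card_univ, Fintype.card_fin, ← preferredItemECE_eq] at this
  exact absurd (hbr _) (not_le.2 this)

/-- The mechanism run from the state `(P, R)` ends in the allocation `A`, where the bundle
held by `y` in `P` grows into the final bundle of `τ y`. -/
inductive Reach (b : Fin n → Bid m) (A : Fin n → Finset (Fin m)) :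
    (Fin n → Finset (Fin m)) → Finset (Fin m) → Equiv.Perm (Fin n) → Prop
  | done : (∃ y, IsSrc (envies b A) y) → Reach b A A ∅ 1
  | elim {P R τ} (σ : Equiv.Perm (Fin n)) : (¬ ∃ y, IsSrc (envies b P) y) →
      IsMinCyc (envies b P) σ → Reach b A (fun y => P (σ y)) R τ → Reach b A P R (τ * σ⁻¹)
  | pick {P R τ} (y : Fin n) (g : Fin m) : IsPick (envies b P) y → g ∈ R →
      (∀ k ∈ R, (b y).pref g ≤ (b y).pref k) →
      Reach b A (Function.update P y (insert g (P y))) (R.erase g) τ → Reach b A P R τ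

lemma exists_reach (b : Fin 3 → Bid m) : ∀ N : ℕ, ∀ P R k, 10 * R.card + edgeCount (envies b P) ≤ N →
    edgeCount (envies b P) < k →
    ∃ τ, Reach b ((prefStep b)^[R.card] (resolve b k P, R)).1 P R τ := by
  intro N
  induction N with
  | zero =>
    intro P R k hN _
    have hR : R = ∅ := by rw [← Finset.card_eq_zero]; omega
    have he : edgeCount (envies b P) = 0 := by omega
    have hs : ∃ y, IsSrc (envies b P) y := by
      refine ⟨0, fun z hz => ?_⟩
      simp only [edgeCount, Finset.sum_eq_zero_iff, Finset.card_eq_zero] at he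
      have := he z (mem_univ _)
      rw [Finset.filter_eq_empty_iff] at this
      exact this (mem_univ _) hz
    subst hR
    exact ⟨1, by simpa [resolve_of_isSrc hs] using Reach.done hs⟩
  | succ N ih =>
    intro P R k hN hk
    by_cases hs : ∃ y, IsSrc (envies b P) y
    · rw [resolve_of_isSrc hs]
      by_cases hR : R.Nonempty
      · obtain ⟨y, hy⟩ := exists_isPick hs
        have hg := preferredItem_mem (f := (b y).pref) hR
        rw [← Finset.card_erase_add_one hg, Function.iterate_succ_apply, prefStep_eq hy hR]
        have hc := Finset.card_erase_add_one hg
        have hle := edgeCount_le (envies b (Function.update P y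
          (insert (preferredItem (b y).pref R hR) (P y))))
        obtain ⟨τ, h⟩ := ih (Function.update P y (insert (preferredItem (b y).pref R hR) (P y)))
          (R.erase (preferredItem (b y).pref R hR)) (3 * 3 + 1) (by omega) (by omega)
        exact ⟨τ, Reach.pick y _ hy hg (fun k hk => preferredItem_le hR hk) h⟩
      · have hR : R = ∅ := by simpa using hR
        subst hR
        exact ⟨1, by simpa using Reach.done hs⟩
    · obtain ⟨σ, hσ⟩ := exists_isMinCyc (exists_isCyc (fun y => by simp [envies]) hs)
      have hlt := edgeCount_lt (f := fun y z => bval (b y) (P z)) (E := envies b P)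
        (E' := envies b fun y => P (σ y)) hσ.1 (fun _ _ => Iff.rfl) (fun _ _ => Iff.rfl)
      obtain ⟨k, rfl⟩ : ∃ k', k = k' + 1 := ⟨k - 1, by omega⟩
      rw [resolve_of_not_isSrc hs hσ]
      obtain ⟨τ, h⟩ := ih (fun y => P (σ y)) R k (by omega) (by omega)
      exact ⟨_, Reach.elim σ hs hσ h⟩

lemma exists_reach_init (b : Fin 3 → Bid m) :
    ∃ τ, Reach b (PreferredItemECE b) (fun _ => ∅) univ τ := by
  have h := exists_reach b _ (fun _ => ∅) univ (3 * 3 + 1) le_rfl (Nat.lt_succ_of_le (edgeCount_le _))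
  rwa [resolve_of_isSrc ⟨0, fun z => by simp [envies]⟩, Finset.card_univ, Fintype.card_fin,
    ← preferredItemECE_eq] at h

end ECE

namespace ECE

open scoped Classical
open Finset

variable {m : ℕ}

/-- The data of the deviation game of agent `i`, who tries to obtain more than `x`. -/
structure Game (m : ℕ) where
  b : Fin 3 → Bid m
  i : Fin 3
  v : Fin m → ℝ
  x : ℝ
  nonneg : ∀ g, 0 ≤ v g

namespace Game

variable (G : Game m)

/-- True value of a bundle. -/
noncomputable def V (S : Finset (Fin m)) : ℝ := value G.v S

/-- Reported value of a bundle. -/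
noncomputable def f (y : Fin 3) (S : Finset (Fin m)) : ℝ := bval (G.b y) S

/-- The good `g` comes first in the list of `y` among `R`. -/
def Top (y : Fin 3) (R : Finset (Fin m)) (g : Fin m) : Prop :=
  g ∈ R ∧ ∀ k ∈ R, (G.b y).pref g ≤ (G.b y).pref k

/-- Agent `i` has no winning strategy from the state. -/
def NW (P : Fin 3 → Finset (Fin m)) (R : Finset (Fin m)) (ω : Fin 3 → ℝ) : Prop :=
  (∀ y, Disjoint (P y) R) ∧ ¬ Win G.b G.i G.v G.x P R ω

/-- Edges of the envy graph of a state of the game. -/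
abbrev Ed (P : Fin 3 → Finset (Fin m)) (ω : Fin 3 → ℝ) := Env G.b G.i P ω

lemma V_nonneg (S : Finset (Fin m)) : 0 ≤ G.V S := Finset.sum_nonneg fun g _ => G.nonneg g

lemma f_nonneg (y : Fin 3) (S : Finset (Fin m)) : 0 ≤ G.f y S :=
  Finset.sum_nonneg fun g _ => (G.b y).nonneg g

lemma V_mono {S T : Finset (Fin m)} (h : S ⊆ T) : G.V S ≤ G.V T :=
  Finset.sum_le_sum_of_subset_of_nonneg h fun g _ _ => G.nonneg g

lemma f_mono (y : Fin 3) {S T : Finset (Fin m)} (h : S ⊆ T) : G.f y S ≤ G.f y T :=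
  Finset.sum_le_sum_of_subset_of_nonneg h fun g _ _ => (G.b y).nonneg g

lemma V_empty : G.V ∅ = 0 := by simp [V, value]

lemma f_empty (y : Fin 3) : G.f y ∅ = 0 := by simp [f, bval]

lemma V_insert {S : Finset (Fin m)} {g : Fin m} (h : g ∉ S) : G.V (insert g S) = G.V S + G.v g :=
  value_insert h

lemma f_insert (y : Fin 3) {S : Finset (Fin m)} {g : Fin m} (h : g ∉ S) :
    G.f y (insert g S) = G.f y S + (G.b y).val g :=
  bval_insert h

lemma V_erase {S : Finset (Fin m)} {g : Fin m} (h : g ∈ S) : G.V (S.erase g) = G.V S - G.v g :=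
  value_erase h

lemma f_erase (y : Fin 3) {S : Finset (Fin m)} {g : Fin m} (h : g ∈ S) :
    G.f y (S.erase g) = G.f y S - (G.b y).val g :=
  bval_erase h

lemma le_V {S : Finset (Fin m)} {g : Fin m} (h : g ∈ S) : G.v g ≤ G.V S :=
  Finset.single_le_sum (fun g _ => G.nonneg g) h

lemma Top.unique {G : Game m} {y : Fin 3} {R : Finset (Fin m)} {g h : Fin m}
    (hg : G.Top y R g) (hh : G.Top y R h) : g = h :=
  (G.b y).pref.injective (le_antisymm (hg.2 _ hh.1) (hh.2 _ hg.1))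

lemma exists_top (y : Fin 3) {R : Finset (Fin m)} (hR : R.Nonempty) : ∃ g, G.Top y R g :=
  R.exists_min_image _ hR

variable {G}

lemma not_mem_of_disjoint {S R : Finset (Fin m)} {g : Fin m} (h : Disjoint S R) (hg : g ∈ R) :
    g ∉ S := fun hs => Finset.disjoint_left.1 h hs hg

lemma disjoint_update {n : ℕ} {P : Fin n → Finset (Fin m)} {R : Finset (Fin m)} {g : Fin m}
    (h : ∀ y, Disjoint (P y) R) (y : Fin n) :
    ∀ z, Disjoint (Function.update P y (insert g (P y)) z) (R.erase g) := by
  intro z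
  by_cases hz : z = y
  · subst hz
    rw [Function.update_self, Finset.disjoint_insert_left]
    exact ⟨by simp, (h z).mono_right (Finset.erase_subset _ _)⟩
  · rw [Function.update_of_ne hz]
    exact (h z).mono_right (Finset.erase_subset _ _)

lemma NW.fin {P : Fin 3 → Finset (Fin m)} {ω : Fin 3 → ℝ} (h : G.NW P ∅ ω)
    (hs : ∃ y, IsSrc (G.Ed P ω) y) : G.V (P G.i) ≤ G.x :=
  not_lt.1 fun hx => h.2 (Win.fin rfl hs hx)

lemma NW.elim {P : Fin 3 → Finset (Fin m)} {R : Finset (Fin m)} {ω : Fin 3 → ℝ} (h : G.NW P R ω)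
    (hs : ¬ ∃ y, IsSrc (G.Ed P ω) y) {σ : Equiv.Perm (Fin 3)} (hσ : IsMinCyc (G.Ed P ω) σ) :
    G.NW (fun y => P (σ y)) R (fun y => ω (σ y)) :=
  ⟨fun y => h.1 (σ y), fun hw => h.2 (Win.elim σ hs hσ hw)⟩

lemma NW.pick {P : Fin 3 → Finset (Fin m)} {R : Finset (Fin m)} {ω : Fin 3 → ℝ} (h : G.NW P R ω)
    {y : Fin 3} (hy : IsPick (G.Ed P ω) y) {g : Fin m} (hg : g ∈ R)
    (hp : y ≠ G.i → ∀ k ∈ R, (G.b y).pref g ≤ (G.b y).pref k) {c : ℝ} (hc : ω y ≤ c) :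
    G.NW (Function.update P y (insert g (P y))) (R.erase g) (Function.update ω y c) :=
  ⟨disjoint_update h.1 y, fun hw => h.2 (Win.pick y g c hy hg hp hc hw)⟩

lemma ed_irrefl (P : Fin 3 → Finset (Fin m)) (ω : Fin 3 → ℝ) (y : Fin 3) : ¬ G.Ed P ω y y := by
  unfold Ed Env; split_ifs <;> simp

lemma exists_minCyc {P : Fin 3 → Finset (Fin m)} {ω : Fin 3 → ℝ}
    (hs : ¬ ∃ y, IsSrc (G.Ed P ω) y) : ∃ σ, IsMinCyc (G.Ed P ω) σ :=
  exists_isMinCyc (exists_isCyc (ed_irrefl P ω) hs)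

/-- The function with value `A` at `i`, `B` at `p` and `C` at the third agent. -/
def tri {α : Type*} (i p : Fin 3) (A B C : α) (y : Fin 3) : α :=
  if y = i then A else if y = p then B else C

lemma cover {i p q : Fin 3} (hpi : p ≠ i) (hqi : q ≠ i) (hpq : p ≠ q) (y : Fin 3) :
    y = i ∨ y = p ∨ y = q := by
  omega

/-- A state without winning strategy, in which `i`, `p` and `q` hold `A`, `B` and `C`, valued
`a`, `b` and `c` by the report of `i`, and whose size is at most `N`. -/
structure Lo (G : Game m) (N : ℕ) (p q : Fin 3) (A B C R : Finset (Fin m)) (a b c : ℝ) : Prop where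
  hpi : p ≠ G.i
  hqi : q ≠ G.i
  hpq : p ≠ q
  nw : G.NW (tri G.i p A B C) R (tri G.i p a b c)
  ms : 7 * R.card + edgeCount (G.Ed (tri G.i p A B C) (tri G.i p a b c)) ≤ N

section tri
variable {α : Type*} {i p q : Fin 3} {A B C : α}

@[simp] lemma tri_i : tri i p A B C i = A := by simp [tri]

lemma tri_p (h : p ≠ i) : tri i p A B C p = B := by simp [tri, h]

lemma tri_q (h : q ≠ i) (h' : p ≠ q) : tri i p A B C q = C := by simp [tri, h, h'.symm]

lemma eq_tri (hpi : p ≠ i) (hqi : q ≠ i) (hpq : p ≠ q) (P : Fin 3 → α) :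
    P = tri i p (P i) (P p) (P q) := by
  ext1 y
  rcases cover hpi hqi hpq y with rfl | rfl | rfl
  · simp
  · rw [tri_p hpi]
  · rw [tri_q hqi hpq]

lemma tri_symm (hpi : p ≠ i) (hqi : q ≠ i) (hpq : p ≠ q) :
    tri i p A B C = tri i q A C B := by
  rw [eq_tri hqi hpi hpq.symm (tri i p A B C), tri_i, tri_q hqi hpq, tri_p hpi]

end tri

lemma edgeCount_le_six {E : Fin 3 → Fin 3 → Prop} (h : ∀ y, ¬ E y y) : edgeCount E ≤ 6 := by
  unfold edgeCount
  calc _ ≤ ∑ y : Fin 3, 2 := by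
        refine Finset.sum_le_sum fun y _ => ?_
        have : (univ.filter fun z => E y z) ⊆ univ.erase y := by
          intro z hz
          refine mem_erase.2 ⟨?_, mem_univ _⟩
          rintro rfl
          exact h _ (mem_filter.1 hz).2
        simpa using Finset.card_le_card this
    _ = 6 := by simp

section Ed
variable {p q : Fin 3} {A B C R : Finset (Fin m)} {a b c : ℝ}

lemma isSrc_iff (hpi : p ≠ G.i) (hqi : q ≠ G.i) (hpq : p ≠ q) {E : Fin 3 → Fin 3 → Prop}
    (y : Fin 3) : IsSrc E y ↔ ¬ E G.i y ∧ ¬ E p y ∧ ¬ E q y :=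
  ⟨fun h => ⟨h _, h _, h _⟩, fun h z => by
    rcases cover hpi hqi hpq z with rfl | rfl | rfl
    exacts [h.1, h.2.1, h.2.2]⟩

lemma hasOut_iff (hpi : p ≠ G.i) (hqi : q ≠ G.i) (hpq : p ≠ q) {E : Fin 3 → Fin 3 → Prop}
    (y : Fin 3) : HasOut E y ↔ E y G.i ∨ E y p ∨ E y q := by
  constructor
  · rintro ⟨u, hu⟩
    rcases cover hpi hqi hpq u with rfl | rfl | rfl <;> simp [hu]
  · rintro (hu | hu | hu) <;> exact ⟨_, hu⟩

lemma exists_iff_cover (hpi : p ≠ G.i) (hqi : q ≠ G.i) (hpq : p ≠ q) {Q : Fin 3 → Prop} :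
    (∃ y, Q y) ↔ Q G.i ∨ Q p ∨ Q q := by
  constructor
  · rintro ⟨u, hu⟩
    rcases cover hpi hqi hpq u with rfl | rfl | rfl <;> simp [hu]
  · rintro (hu | hu | hu) <;> exact ⟨_, hu⟩

lemma ed_tri (hpi : p ≠ G.i) (hqi : q ≠ G.i) (hpq : p ≠ q) :
    (G.Ed (tri G.i p A B C) (tri G.i p a b c) G.i p ↔ a < b) ∧
    (G.Ed (tri G.i p A B C) (tri G.i p a b c) G.i q ↔ a < c) ∧
    (G.Ed (tri G.i p A B C) (tri G.i p a b c) p G.i ↔ G.f p B < G.f p A) ∧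
    (G.Ed (tri G.i p A B C) (tri G.i p a b c) p q ↔ G.f p B < G.f p C) ∧
    (G.Ed (tri G.i p A B C) (tri G.i p a b c) q G.i ↔ G.f q C < G.f q A) ∧
    (G.Ed (tri G.i p A B C) (tri G.i p a b c) q p ↔ G.f q C < G.f q B) ∧
    (G.Ed (tri G.i p A B C) (tri G.i p a b c) G.i G.i ↔ False) ∧
    (G.Ed (tri G.i p A B C) (tri G.i p a b c) p p ↔ False) ∧
    (G.Ed (tri G.i p A B C) (tri G.i p a b c) q q ↔ False) := by
  unfold Ed Env
  simp [tri_p hpi, tri_q hqi hpq, hpi, hqi, f]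

end Ed

section
variable {N : ℕ} {p q : Fin 3} {A B C R : Finset (Fin m)} {a b c : ℝ}

lemma Lo.symm (L : G.Lo N p q A B C R a b c) : G.Lo N q p A C B R a c b := by
  have h1 := tri_symm (A := A) (B := B) (C := C) L.hpi L.hqi L.hpq
  have h2 := tri_symm (A := a) (B := b) (C := c) L.hpi L.hqi L.hpq
  refine ⟨L.hqi, L.hpi, L.hpq.symm, ?_, ?_⟩
  · rw [← h1, ← h2]; exact L.nw
  · rw [← h1, ← h2]; exact L.ms

/-- No agent is a source. -/
def NoSrc (G : Game m) (p q : Fin 3) (A B C : Finset (Fin m)) (a b c : ℝ) : Prop :=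
  (G.f p B < G.f p A ∨ G.f q C < G.f q A) ∧ (a < b ∨ G.f q C < G.f q B) ∧
    (a < c ∨ G.f p B < G.f p C)

lemma exists_isSrc_iff (hpi : p ≠ G.i) (hqi : q ≠ G.i) (hpq : p ≠ q) :
    (∃ y, IsSrc (G.Ed (tri G.i p A B C) (tri G.i p a b c)) y) ↔ ¬ G.NoSrc p q A B C a b c := by
  obtain ⟨h1, h2, h3, h4, h5, h6, h7, h8, h9⟩ := ed_tri (G := G) (A := A) (B := B) (C := C)
    (a := a) (b := b) (c := c) hpi hqi hpq
  rw [exists_iff_cover hpi hqi hpq]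
  simp only [isSrc_iff hpi hqi hpq, h1, h2, h3, h4, h5, h6, h7, h8, h9, NoSrc]
  grind

lemma Lo.le_x (L : G.Lo N p q A B C ∅ a b c) (h : ¬ G.NoSrc p q A B C a b c) : G.V A ≤ G.x := by
  simpa using L.nw.fin ((exists_isSrc_iff L.hpi L.hqi L.hpq).2 h)

lemma Lo.of_nw {P : Fin 3 → Finset (Fin m)} {ω : Fin 3 → ℝ} (h : G.NW P R ω) (hpi : p ≠ G.i)
    (hqi : q ≠ G.i) (hpq : p ≠ q) (hN : 7 * R.card + edgeCount (G.Ed P ω) ≤ N) :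
    G.Lo N p q (P G.i) (P p) (P q) R (ω G.i) (ω p) (ω q) := by
  refine ⟨hpi, hqi, hpq, ?_, ?_⟩
  · rwa [← eq_tri hpi hqi hpq P, ← eq_tri hpi hqi hpq ω]
  · rwa [← eq_tri hpi hqi hpq P, ← eq_tri hpi hqi hpq ω]

lemma perm_cases (hpi : p ≠ G.i) (hqi : q ≠ G.i) (hpq : p ≠ q) {σ : Equiv.Perm (Fin 3)}
    (hσ : σ ≠ 1) : (σ G.i = p ∧ σ p = G.i ∧ σ q = q) ∨ (σ G.i = q ∧ σ p = p ∧ σ q = G.i) ∨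
    (σ G.i = G.i ∧ σ p = q ∧ σ q = p) ∨ (σ G.i = p ∧ σ p = q ∧ σ q = G.i) ∨
    (σ G.i = q ∧ σ p = G.i ∧ σ q = p) := by
  have inj1 : σ G.i ≠ σ p := fun h => hpi (σ.injective h).symm
  have inj2 : σ G.i ≠ σ q := fun h => hqi (σ.injective h).symm
  have inj3 : σ p ≠ σ q := fun h => hpq (σ.injective h)
  have hid : ¬ (σ G.i = G.i ∧ σ p = p ∧ σ q = q) := fun h => hσ (by
    ext1 y
    rcases cover hpi hqi hpq y with rfl | rfl | rfl
    exacts [h.1, h.2.1, h.2.2])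
  rcases cover hpi hqi hpq (σ G.i) with h1 | h1 | h1 <;>
  rcases cover hpi hqi hpq (σ p) with h2 | h2 | h2 <;>
  rcases cover hpi hqi hpq (σ q) with h3 | h3 | h3 <;>
  simp_all

/-- Outcomes of eliminating one envy cycle. -/
lemma Lo.elim (L : G.Lo N p q A B C R a b c) (h : G.NoSrc p q A B C a b c) : ∃ M < N,
    (a < b ∧ G.f p B < G.f p A ∧ G.Lo M p q B A C R b a c) ∨
    (a < c ∧ G.f q C < G.f q A ∧ G.Lo M p q C B A R c b a) ∨
    (G.f p B < G.f p C ∧ G.f q C < G.f q B ∧ G.Lo M p q A C B R a c b) ∨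
    (a < b ∧ G.f p B < G.f p C ∧ G.f q C < G.f q A ∧ G.Lo M p q B C A R b c a) ∨
    (a < c ∧ G.f q C < G.f q B ∧ G.f p B < G.f p A ∧ G.Lo M p q C A B R c a b) := by
  obtain ⟨hpi, hqi, hpq, nw, ms⟩ := L
  have hs : ¬ ∃ y, IsSrc (G.Ed (tri G.i p A B C) (tri G.i p a b c)) y := fun h' =>
    (exists_isSrc_iff hpi hqi hpq).1 h' h
  obtain ⟨σ, hσ⟩ := exists_minCyc hs
  have hnw := nw.elim hs hσ
  have hlt : edgeCount (G.Ed (fun y => tri G.i p A B C (σ y)) fun y => tri G.i p a b c (σ y)) <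
    edgeCount (G.Ed (tri G.i p A B C) (tri G.i p a b c)) := env_edgeCount_lt hσ.1
  refine ⟨N - 1, by omega, ?_⟩
  have L' := Lo.of_nw (N := N - 1) hnw hpi hqi hpq (by omega)
  have hE := hσ.1.2
  obtain ⟨e1, e2, e3, e4, e5, e6, e7, e8, e9⟩ := ed_tri (G := G) (A := A) (B := B) (C := C)
    (a := a) (b := b) (c := c) hpi hqi hpq
  have key := perm_cases hpi hqi hpq hσ.1.1.ne_one
  have hpi' := hpi.symm
  have hqi' := hqi.symm
  have hpq' := hpq.symm
  rcases key with ⟨h1, h2, h3⟩ | ⟨h1, h2, h3⟩ | ⟨h1, h2, h3⟩ | ⟨h1, h2, h3⟩ | ⟨h1, h2, h3⟩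
  · simp only [h1, h2, h3, tri_i, tri_p hpi, tri_q hqi hpq] at L'
    have hi := hE G.i; have hp := hE p
    rw [h1] at hi; rw [h2] at hp
    exact Or.inl ⟨e1.1 (hi hpi), e3.1 (hp hpi'), L'⟩
  · simp only [h1, h2, h3, tri_i, tri_p hpi, tri_q hqi hpq] at L'
    have hi := hE G.i; have hq := hE q
    rw [h1] at hi; rw [h3] at hq
    exact Or.inr (Or.inl ⟨e2.1 (hi hqi), e5.1 (hq hqi'), L'⟩)
  · simp only [h1, h2, h3, tri_i, tri_p hpi, tri_q hqi hpq] at L'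
    have hp := hE p; have hq := hE q
    rw [h2] at hp; rw [h3] at hq
    exact Or.inr (Or.inr (Or.inl ⟨e4.1 (hp hpq'), e6.1 (hq hpq), L'⟩))
  · simp only [h1, h2, h3, tri_i, tri_p hpi, tri_q hqi hpq] at L'
    have hi := hE G.i; have hp := hE p; have hq := hE q
    rw [h1] at hi; rw [h2] at hp; rw [h3] at hq
    exact Or.inr (Or.inr (Or.inr (Or.inl ⟨e1.1 (hi hpi), e4.1 (hp hpq'), e5.1 (hq hqi'), L'⟩)))
  · simp only [h1, h2, h3, tri_i, tri_p hpi, tri_q hqi hpq] at L'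
    have hi := hE G.i; have hp := hE p; have hq := hE q
    rw [h1] at hi; rw [h2] at hp; rw [h3] at hq
    exact Or.inr (Or.inr (Or.inr (Or.inr ⟨e2.1 (hi hqi), e6.1 (hq hpq), e3.1 (hp hpi'), L'⟩)))

/-- Effect of a pick on values. -/
lemma Lo.disj (L : G.Lo N p q A B C R a b c) : Disjoint A R ∧ Disjoint B R ∧ Disjoint C R := by
  obtain ⟨hpi, hqi, hpq, nw, ms⟩ := L
  refine ⟨by simpa using nw.1 G.i, ?_, ?_⟩
  · simpa [tri_p hpi] using nw.1 p
  · simpa [tri_q hqi hpq] using nw.1 q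

lemma Lo.V_A (L : G.Lo N p q A B C R a b c) {g : Fin m} (hg : g ∈ R) :
    G.V (insert g A) = G.V A + G.v g := G.V_insert (not_mem_of_disjoint L.disj.1 hg)
lemma Lo.V_B (L : G.Lo N p q A B C R a b c) {g : Fin m} (hg : g ∈ R) :
    G.V (insert g B) = G.V B + G.v g := G.V_insert (not_mem_of_disjoint L.disj.2.1 hg)
lemma Lo.V_C (L : G.Lo N p q A B C R a b c) {g : Fin m} (hg : g ∈ R) :
    G.V (insert g C) = G.V C + G.v g := G.V_insert (not_mem_of_disjoint L.disj.2.2 hg)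
lemma Lo.f_A (L : G.Lo N p q A B C R a b c) {g : Fin m} (hg : g ∈ R) (y : Fin 3) :
    G.f y (insert g A) = G.f y A + (G.b y).val g :=
  G.f_insert y (not_mem_of_disjoint L.disj.1 hg)
lemma Lo.f_B (L : G.Lo N p q A B C R a b c) {g : Fin m} (hg : g ∈ R) (y : Fin 3) :
    G.f y (insert g B) = G.f y B + (G.b y).val g :=
  G.f_insert y (not_mem_of_disjoint L.disj.2.1 hg)
lemma Lo.f_C (L : G.Lo N p q A B C R a b c) {g : Fin m} (hg : g ∈ R) (y : Fin 3) :
    G.f y (insert g C) = G.f y C + (G.b y).val g :=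
  G.f_insert y (not_mem_of_disjoint L.disj.2.2 hg)

lemma update_tri {α : Type*} {A B C D : α} (hpi : p ≠ G.i) (hqi : q ≠ G.i) (hpq : p ≠ q) :
    Function.update (tri G.i p A B C) G.i D = tri G.i p D B C ∧
    Function.update (tri G.i p A B C) p D = tri G.i p A D C ∧
    Function.update (tri G.i p A B C) q D = tri G.i p A B D := by
  refine ⟨?_, ?_, ?_⟩ <;> ext1 y <;> rcases cover hpi hqi hpq y with rfl | rfl | rfl <;>
  simp [tri_p, tri_q, hpi, hqi, hpq, hpq.symm, hpi.symm, hqi.symm]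

/-- Outcomes of a pick. -/
lemma Lo.pick (L : G.Lo N p q A B C R a b c) (hR : R.Nonempty)
    (h : ¬ G.NoSrc p q A B C a b c) : ∃ M < N,
    (¬ G.f p B < G.f p A ∧ ¬ G.f q C < G.f q A ∧
      (¬ a < b → ¬ G.f q C < G.f q B → (G.f p B < G.f p C → a < c) ∧
        ((a < c → G.f p B < G.f p C) → G.i < p)) ∧
      (¬ a < c → ¬ G.f p B < G.f p C → (G.f q C < G.f q B → a < b) ∧
        ((a < b → G.f q C < G.f q B) → G.i < q)) ∧
      ∀ g ∈ R, ∀ a' ≥ a, G.Lo M p q (insert g A) B C (R.erase g) a' b c) ∨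
    (¬ a < b ∧ ¬ G.f q C < G.f q B ∧
      (¬ G.f p B < G.f p A → ¬ G.f q C < G.f q A → (a < c → G.f p B < G.f p C) ∧
        ((G.f p B < G.f p C → a < c) → p < G.i)) ∧
      (¬ a < c → ¬ G.f p B < G.f p C → (G.f q C < G.f q A → G.f p B < G.f p A) ∧
        ((G.f p B < G.f p A → G.f q C < G.f q A) → p < q)) ∧
      ∃ g, G.Top p R g ∧ ∀ b' ≥ b, G.Lo M p q A (insert g B) C (R.erase g) a b' c) ∨
    (¬ a < c ∧ ¬ G.f p B < G.f p C ∧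
      (¬ G.f p B < G.f p A → ¬ G.f q C < G.f q A → (a < b → G.f q C < G.f q B) ∧
        ((G.f q C < G.f q B → a < b) → q < G.i)) ∧
      (¬ a < b → ¬ G.f q C < G.f q B → (G.f p B < G.f p A → G.f q C < G.f q A) ∧
        ((G.f q C < G.f q A → G.f p B < G.f p A) → q < p)) ∧
      ∃ g, G.Top q R g ∧ ∀ c' ≥ c, G.Lo M p q A B (insert g C) (R.erase g) a b c') := by
  obtain ⟨hpi, hqi, hpq, nw, ms⟩ := L
  obtain ⟨y, hy⟩ := exists_isPick ((exists_isSrc_iff hpi hqi hpq).2 h)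
  have hcard : ∀ g ∈ R, 7 * (R.erase g).card + 6 < N := fun g hg => by
    have := Finset.card_erase_add_one hg
    omega
  have hN : 1 ≤ N := by obtain ⟨g, hg⟩ := hR; have := hcard g hg; omega
  obtain ⟨e1, e2, e3, e4, e5, e6, e7, e8, e9⟩ := ed_tri (G := G) (A := A) (B := B) (C := C)
    (a := a) (b := b) (c := c) hpi hqi hpq
  obtain ⟨hy1, hy2⟩ := hy
  have hyi := hy2 G.i
  have hyp := hy2 p
  have hyq := hy2 q
  refine ⟨N - 1, by omega, ?_⟩
  have hms : ∀ g ∈ R, ∀ A B C a b c, 7 * (R.erase g).card +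
      edgeCount (G.Ed (tri G.i p A B C) (tri G.i p a b c)) ≤ N - 1 := fun g hg A B C a b c => by
    have := hcard g hg
    have := edgeCount_le_six (ed_irrefl (G := G) (tri G.i p A B C) (tri G.i p a b c))
    omega
  have hnw := fun g hg => nw.pick ⟨hy1, hy2⟩ (g := g) hg
  rcases cover hpi hqi hpq y with rfl | rfl | rfl
  · left
    simp only [isSrc_iff hpi hqi hpq, hasOut_iff hpi hqi hpq, e1, e2, e3, e4, e5, e6, e7, e8, e9]
      at hy1 hyi hyp hyq
    refine ⟨by grind, by grind, by grind, by grind, fun g hg a' ha' =>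
      ⟨hpi, hqi, hpq, ?_, hms g hg _ _ _ _ _ _⟩⟩
    have := hnw g hg (fun h => absurd rfl h) (c := a') (by simpa using ha')
    rwa [(update_tri hpi hqi hpq).1, (update_tri hpi hqi hpq).1, tri_i] at this
  · right; left
    simp only [isSrc_iff hpi hqi hpq, hasOut_iff hpi hqi hpq, e1, e2, e3, e4, e5, e6, e7, e8, e9]
      at hy1 hyi hyp hyq
    obtain ⟨g, hg⟩ := G.exists_top y hR
    refine ⟨by grind, by grind, by grind, by grind, g, hg, fun b' hb' =>
      ⟨hpi, hqi, hpq, ?_, hms g hg.1 _ _ _ _ _ _⟩⟩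
    have := hnw g hg.1 (fun _ => hg.2) (c := b') (by simpa [tri_p hpi] using hb')
    rwa [(update_tri hpi hqi hpq).2.1, (update_tri hpi hqi hpq).2.1, tri_p hpi] at this
  · right; right
    simp only [isSrc_iff hpi hqi hpq, hasOut_iff hpi hqi hpq, e1, e2, e3, e4, e5, e6, e7, e8, e9]
      at hy1 hyi hyp hyq
    obtain ⟨g, hg⟩ := G.exists_top y hR
    refine ⟨by grind, by grind, by grind, by grind, g, hg, fun c' hc' =>
      ⟨hpi, hqi, hpq, ?_, hms g hg.1 _ _ _ _ _ _⟩⟩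
    have := hnw g hg.1 (fun _ => hg.2) (c := c') (by simpa [tri_q hqi hpq] using hc')
    rwa [(update_tri hpi hqi hpq).2.2, (update_tri hpi hqi hpq).2.2, tri_q hqi hpq] at this

end

end Game

end ECE

namespace ECE

open scoped Classical
open Finset

namespace Game

variable {m : ℕ} {G : Game m} {N : ℕ} {p q : Fin 3} {A B C R : Finset (Fin m)} {a b c : ℝ}

lemma Lo.false_of_top (L : G.Lo N p q A B C R a b c) (hb : b ≤ a) (hc : c ≤ a)
    (hA : G.x < G.V A) : False := by
  induction N using Nat.strong_induction_on generalizing A B C R a b c with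
  | _ N ih =>
  by_cases ns : G.NoSrc p q A B C a b c
  · obtain ⟨M, hM, h | h | h | h | h⟩ := L.elim ns
    · exact not_lt.2 hb h.1
    · exact not_lt.2 hc h.1
    · exact ih M hM h.2.2 hc hb hA
    · exact not_lt.2 hb h.1
    · exact not_lt.2 hc h.1
  rcases R.eq_empty_or_nonempty with rfl | hR
  · exact not_lt.2 (L.le_x ns) hA
  obtain ⟨M, hM, h | h | h⟩ := L.pick hR ns
  · obtain ⟨g, hg⟩ := hR
    exact ih M hM (h.2.2.2.2 g hg a le_rfl) hb hc
      (hA.trans_le (G.V_mono (Finset.subset_insert _ _)))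
  · obtain ⟨-, -, -, -, g, -, h⟩ := h
    exact ih M hM (h b le_rfl) hb hc hA
  · obtain ⟨-, -, -, -, g, -, h⟩ := h
    exact ih M hM (h c le_rfl) hb hc hA

/-- `q`, holding `C`, does not envy `B`, or comes after `i` in the agent order. -/
def Late (G : Game m) (q : Fin 3) (B C : Finset (Fin m)) : Prop :=
  ¬ G.f q C < G.f q B ∨ G.i < q

lemma Lo.i_pick (L : G.Lo N p q A B C R a b c) (hR : R.Nonempty) (hab : a < b)
    (hp : ¬ G.f p B < G.f p A) (hq : ¬ G.f q C < G.f q A) (H : G.Late q B C) :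
    ∃ M < N, ∀ g ∈ R, ∀ a' ≥ a, G.Lo M p q (insert g A) B C (R.erase g) a' b c := by
  obtain ⟨M, hM, h | h | h⟩ := L.pick hR (fun ns => ns.1.elim hp hq)
  · exact ⟨M, hM, h.2.2.2.2⟩
  · exact absurd hab h.1
  · obtain ⟨h1, h2⟩ := h.2.2.1 hp hq
    rcases H with H | H
    · exact absurd (h1 hab) H
    · exact absurd (h2 fun _ => hab) (not_lt.2 H.le)

lemma Lo.q_pick (L : G.Lo N p q A B C R a b c) (hR : R.Nonempty) (hab : a < b)
    (hs : G.f p B < G.f p A ∨ G.f q C < G.f q A) (ns : ¬ G.NoSrc p q A B C a b c) :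
    ∃ M < N, ∃ h, G.Top q R h ∧ ∀ c' ≥ c, G.Lo M p q A B (insert h C) (R.erase h) a b c' := by
  obtain ⟨M, hM, h | h | h⟩ := L.pick hR ns
  · exact (hs.elim h.1 h.2.1).elim
  · exact absurd hab h.1
  · exact ⟨M, hM, h.2.2.2.2⟩

/-- A state in which `p` holds a bundle of value more than `x` that `i` reports to be the best. -/
structure DState (G : Game m) (N : ℕ) (p q : Fin 3) (A B C R : Finset (Fin m)) (a b c : ℝ) :
    Prop where
  lo : G.Lo N p q A B C R a b c
  ab : a < b
  cb : c < b
  big : G.x < G.V B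

/-- The outcomes of an elimination in which `i` does not obtain the best bundle. -/
lemma DState.elim (D : G.DState N p q A B C R a b c) (ns : G.NoSrc p q A B C a b c) : ∃ M < N,
    (a < c ∧ G.f q C < G.f q A ∧ G.DState M p q C B A R c b a) ∨
    (G.f p B < G.f p C ∧ G.f q C < G.f q B ∧ G.DState M q p A B C R a b c) ∨
    (a < c ∧ G.f q C < G.f q B ∧ G.f p B < G.f p A ∧ G.DState M q p C B A R c b a) := by
  obtain ⟨L, hab, hcb, hB⟩ := D
  obtain ⟨M, hM, h | h | h | h | h⟩ := L.elim ns
  · exact (h.2.2.false_of_top hab.le hcb.le hB).elim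
  · exact ⟨M, hM, Or.inl ⟨h.1, h.2.1, h.2.2, hcb, hab, hB⟩⟩
  · exact ⟨M, hM, Or.inr (Or.inl ⟨h.1, h.2.1, h.2.2.symm, hab, hcb, hB⟩)⟩
  · exact (h.2.2.2.false_of_top hcb.le hab.le hB).elim
  · exact ⟨M, hM, Or.inr (Or.inr ⟨h.1, h.2.1, h.2.2.1, h.2.2.2.symm, hcb, hab, hB⟩)⟩

lemma DState.i_pick (D : G.DState N p q A B C R a b c) (hR : R.Nonempty)
    (hp : ¬ G.f p B < G.f p A) (hq : ¬ G.f q C < G.f q A) (H : G.Late q B C) :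
    ∃ M < N, ∀ g ∈ R, ∀ a' ≥ a, a' < b → G.DState M p q (insert g A) B C (R.erase g) a' b c := by
  obtain ⟨M, hM, h⟩ := D.lo.i_pick hR D.ab hp hq H
  exact ⟨M, hM, fun g hg a' ha' hb' => ⟨h g hg a' ha', hb', D.cb, D.big⟩⟩

lemma DState.q_pick (D : G.DState N p q A B C R a b c) (hR : R.Nonempty)
    (hs : G.f p B < G.f p A ∨ G.f q C < G.f q A) (ns : ¬ G.NoSrc p q A B C a b c) :
    ∃ M < N, ∃ h, G.Top q R h ∧
      ∀ c' ≥ c, c' < b → G.DState M p q A B (insert h C) (R.erase h) a b c' := by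
  obtain ⟨M, hM, g, hg, h⟩ := D.lo.q_pick hR D.ab hs ns
  exact ⟨M, hM, g, hg, fun c' hc' hb' => ⟨h c' hc', D.ab, hb', D.big⟩⟩

lemma DState.false_of_holder_envies (D : G.DState N p q A B C R a b c) (sat : ¬ G.f q C < G.f q B)
    (hp : G.f p B < G.f p A) (hq : ¬ G.f q C < G.f q A) (hca : c ≤ a) (hR : R.Nonempty) :
    False := by
  by_cases ns : G.NoSrc p q A B C a b c
  · obtain ⟨M, hM, h | h | h⟩ := D.elim ns
    · exact not_lt.2 hca h.1
    · exact sat h.2.1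
    · exact sat h.2.1
  · obtain ⟨M, hM, h, hh, K⟩ := D.q_pick hR (Or.inl hp) ns
    have e1 := D.lo.f_C hh.1 q
    have e2 := (G.b q).nonneg h
    have hab := D.ab
    obtain ⟨c', h1, h2⟩ := exists_between hab
    have D' := K c' (by linarith) h2
    obtain ⟨M', hM', h | h | h⟩ := D'.elim ⟨Or.inl hp, Or.inl hab, Or.inl h1⟩
    · linarith [h.2.1]
    · linarith [h.2.1]
    · linarith [h.2.1]

/-! ### Alternating picks -/

/-- `alt` with a bound on the number of picks. -/
noncomputable def altFuel (G : Game m) : ℕ → Finset (Fin m) → ℝ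
  | 0, _ => 0
  | k + 1, R => if hR : R.Nonempty then R.sup' hR fun g => G.v g - altFuel G k (R.erase g) else 0

/-- Value advantage of the first picker when the goods are picked alternately. -/
noncomputable def alt (G : Game m) (R : Finset (Fin m)) : ℝ := altFuel G R.card R

lemma alt_empty : G.alt ∅ = 0 := rfl

lemma alt_eq {R : Finset (Fin m)} (hR : R.Nonempty) :
    G.alt R = R.sup' hR fun g => G.v g - G.alt (R.erase g) := by
  unfold alt
  obtain ⟨k, hk⟩ : ∃ k, R.card = k + 1 := ⟨R.card - 1, by have := hR.card_pos; omega⟩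
  rw [hk, altFuel, dif_pos hR]
  refine Finset.sup'_congr hR rfl fun g hg => ?_
  rw [Finset.card_erase_of_mem hg, hk]; rfl

lemma le_alt {R : Finset (Fin m)} {g : Fin m} (hg : g ∈ R) :
    G.v g - G.alt (R.erase g) ≤ G.alt R := by
  rw [alt_eq ⟨g, hg⟩]
  exact Finset.le_sup' (fun g => G.v g - G.alt (R.erase g)) hg

lemma exists_alt_eq {R : Finset (Fin m)} (hR : R.Nonempty) :
    ∃ g ∈ R, G.alt R = G.v g - G.alt (R.erase g) := by
  rw [alt_eq hR]
  exact Finset.exists_mem_eq_sup' hR _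

lemma alt_bounds (R : Finset (Fin m)) :
    0 ≤ G.alt R ∧ ∀ t, 0 ≤ t → (∀ g ∈ R, G.v g ≤ t) → G.alt R ≤ t := by
  induction hn : R.card generalizing R with
  | zero =>
    rw [Finset.card_eq_zero] at hn; subst hn
    exact ⟨le_of_eq alt_empty.symm, fun t ht _ => by rwa [alt_empty]⟩
  | succ n ih =>
    have hR : R.Nonempty := by rw [← Finset.card_pos]; omega
    have ih' : ∀ g ∈ R, _ := fun g hg => ih (R.erase g) (by rw [Finset.card_erase_of_mem hg, hn]; rfl)
    constructor
    · obtain ⟨k, hk, hmax⟩ := R.exists_max_image G.v hR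
      have h1 := le_alt (G := G) hk
      have h2 := (ih' k hk).2 (G.v k) (G.nonneg k) fun g hg => hmax g (mem_erase.1 hg).2
      linarith
    · intro t _ ht'
      obtain ⟨k, hk, he⟩ := G.exists_alt_eq hR
      have h1 := (ih' k hk).1
      have h2 := ht' k hk
      linarith

lemma alt_nonneg (R : Finset (Fin m)) : 0 ≤ G.alt R := (alt_bounds R).1

lemma alt_le_V (R : Finset (Fin m)) : G.alt R ≤ G.V R :=
  (alt_bounds R).2 _ (G.V_nonneg R) fun _ hg => G.le_V hg

lemma two_mul_le_alt {R : Finset (Fin m)} {g : Fin m} (hg : g ∈ R) :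
    2 * G.v g ≤ G.V R + G.alt R := by
  have h1 := le_alt (G := G) hg
  have h2 := alt_le_V (G := G) (R.erase g)
  have h3 := G.V_erase hg
  linarith

lemma alt_lt_V {R : Finset (Fin m)} (hR : R.Nonempty) (h : ∀ g ∈ R, G.v g < G.V R) :
    G.alt R < G.V R := by
  obtain ⟨k, hk, he⟩ := G.exists_alt_eq hR
  have h1 := alt_nonneg (G := G) (R.erase k)
  have h2 := h k hk
  linarith

/-! ### The duel -/

/-- No state with `i` envied, `c ≤ a` and a sufficient margin exists below size `N`. -/
def DuelEnvied (G : Game m) (N : ℕ) : Prop :=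
  ∀ {p q : Fin 3} {A B C R : Finset (Fin m)} {a b c : ℝ}, G.DState N p q A B C R a b c → c ≤ a →
    (G.f p B < G.f p A ∨ G.f q C < G.f q A) → G.Late q B C →
    2 * G.x < G.V A + G.V C + G.V R →
    2 * G.x < G.V A + G.V C + G.V R + G.V A - G.V C - G.alt R → False

/-- No state with `i` not envied and a sufficient margin exists below size `N`. -/
def DuelFree (G : Game m) (N : ℕ) : Prop :=
  ∀ {p q : Fin 3} {A B C R : Finset (Fin m)} {a b c : ℝ}, G.DState N p q A B C R a b c →
    ¬ G.f p B < G.f p A → ¬ G.f q C < G.f q A → G.Late q B C →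
    2 * G.x < G.V A + G.V C + G.V R →
    2 * G.x < G.V A + G.V C + G.V R + G.V A - G.V C + G.alt R → False

lemma both_core (d1 : ∀ M ≤ N, G.DuelEnvied M) (d2 : ∀ M ≤ N, G.DuelFree M) {a₁ b₁ c₁ : ℝ}
    (D1 : G.DState N p q A B C R a₁ b₁ c₁) (D2 : G.DState N p q A B C R a b c)
    (h1 : c₁ ≤ a₁) (h2 : a < c) (hs : G.f p B < G.f p A ∨ G.f q C < G.f q A)
    (H : G.Late q B C) (S : 2 * G.x < G.V A + G.V C + G.V R)
    (K : ¬ G.f q C < G.f q B ∨ ¬ G.f p B < G.f p C ∨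
      2 * G.x < G.V A + G.V C + G.V R + G.V A - G.V C + G.alt R) : False := by
  by_cases hm : 2 * G.x < G.V A + G.V C + G.V R + G.V A - G.V C - G.alt R
  · exact d1 N le_rfl D1 h1 hs H S hm
  have S' : 2 * G.x < G.V C + G.V A + G.V R := by linarith
  have hm' : 2 * G.x < G.V C + G.V A + G.V R + G.V C - G.V A + G.alt R := by linarith
  obtain ⟨M, hM, h | h | h⟩ := D2.elim ⟨hs, Or.inl D2.ab, Or.inl h2⟩
  · obtain ⟨-, h3, D'⟩ := h
    by_cases hpC : G.f p B < G.f p C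
    · obtain ⟨M1, hM1, k | k | k⟩ := D1.elim ⟨hs, Or.inl D1.ab, Or.inr hpC⟩
      · exact not_lt.2 h1 k.1
      · obtain ⟨-, k1, E⟩ := k
        by_cases hAC : G.f p C < G.f p A
        · obtain ⟨M2, hM2, k' | k' | k'⟩ := D'.elim
            ⟨Or.inl hpC, Or.inl D'.ab, Or.inr (hpC.trans hAC)⟩
          · exact not_lt.2 h2.le k'.1
          · exact d2 M2 (by omega) k'.2.2 (not_lt.2 (by linarith [k'.2.1])) (not_lt.2 hAC.le)
              (Or.inl (not_lt.2 (by linarith [k'.1]))) S' hm'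
          · exact not_lt.2 h2.le k'.1
        · have K' : 2 * G.x < G.V A + G.V C + G.V R + G.V A - G.V C + G.alt R := by
            rcases K with K | K | K
            · exact absurd k1 K
            · exact absurd hpC K
            · exact K
          by_cases hqA : G.f q B < G.f q A
          · rcases R.eq_empty_or_nonempty with rfl | hR
            · rw [alt_empty] at hm K'
              exact hm (by linarith)
            · exact E.false_of_holder_envies (not_lt.2 hpC.le) hqA hAC h1 hR
          · exact d2 M1 (by omega) E hqA hAC (Or.inl (not_lt.2 hpC.le)) S K'
      · exact not_lt.2 h1 k.1
    · refine d2 M hM.le D' hpC (not_lt.2 h3.le) ?_ S' hm'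
      rcases H with H | H
      · exact Or.inl fun h => H (h3.trans h)
      · exact Or.inr H
  · obtain ⟨hpC, h3, D'⟩ := h
    by_cases hAC : G.f p C < G.f p A
    · obtain ⟨M2, hM2, k' | k' | k'⟩ := D'.elim ⟨Or.inr hAC, Or.inl D'.ab, Or.inl h2⟩
      · exact d2 M2 (by omega) k'.2.2 (not_lt.2 h3.le) (not_lt.2 hAC.le)
          (Or.inl (not_lt.2 (hpC.trans hAC).le)) S' hm'
      · exact not_lt.2 hpC.le k'.2.1
      · exact not_lt.2 hpC.le k'.2.1
    · obtain ⟨M1, hM1, k | k | k⟩ := D1.elim ⟨hs, Or.inl D1.ab, Or.inr hpC⟩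
      · exact not_lt.2 h1 k.1
      · obtain ⟨-, k1, E⟩ := k
        have K' : 2 * G.x < G.V A + G.V C + G.V R + G.V A - G.V C + G.alt R := by
          rcases K with K | K | K
          · exact absurd k1 K
          · exact absurd hpC K
          · exact K
        by_cases hqA : G.f q B < G.f q A
        · rcases R.eq_empty_or_nonempty with rfl | hR
          · rw [alt_empty] at hm K'
            exact hm (by linarith)
          · exact E.false_of_holder_envies (not_lt.2 hpC.le) hqA hAC h1 hR
        · exact d2 M1 (by omega) E hqA hAC (Or.inl (not_lt.2 hpC.le)) S K'
      · exact not_lt.2 h1 k.1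
  · obtain ⟨-, h3, h4, D'⟩ := h
    by_cases hAC : G.f p A < G.f p C
    · have hpC := h4.trans hAC
      obtain ⟨M1, hM1, k | k | k⟩ := D1.elim ⟨hs, Or.inl D1.ab, Or.inr hpC⟩
      · exact not_lt.2 h1 k.1
      · obtain ⟨-, k1, E⟩ := k
        have K' : 2 * G.x < G.V A + G.V C + G.V R + G.V A - G.V C + G.alt R := by
          rcases K with K | K | K
          · exact absurd k1 K
          · exact absurd hpC K
          · exact K
        by_cases hqA : G.f q B < G.f q A
        · rcases R.eq_empty_or_nonempty with rfl | hR
          · rw [alt_empty] at hm K'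
            exact hm (by linarith)
          · exact E.false_of_holder_envies (not_lt.2 hpC.le) hqA (not_lt.2 hAC.le) h1 hR
        · exact d2 M1 (by omega) E hqA (not_lt.2 hAC.le) (Or.inl (not_lt.2 hpC.le)) S K'
      · exact not_lt.2 h1 k.1
    · exact d2 M hM.le D' (not_lt.2 h3.le) hAC (Or.inl (not_lt.2 h4.le)) S' hm'

lemma duel (N : ℕ) : G.DuelEnvied N ∧ G.DuelFree N := by
  induction N using Nat.strong_induction_on with
  | _ N ih =>
  have d1 : ∀ M < N, G.DuelEnvied M := fun M hM => (ih M hM).1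
  have d2 : ∀ M < N, G.DuelFree M := fun M hM => (ih M hM).2
  constructor
  · intro p q A B C R a b c D hca hs H S V
    by_cases ns : G.NoSrc p q A B C a b c
    · obtain ⟨M, hM, h | h | h⟩ := D.elim ns
      · exact not_lt.2 hca h.1
      · obtain ⟨h1, h2, D'⟩ := h
        by_cases hs' : G.f q B < G.f q A ∨ G.f p C < G.f p A
        · exact d1 M hM D' hca hs' (Or.inl (not_lt.2 h1.le)) S V
        · rw [not_or] at hs'
          exact d2 M hM D' hs'.1 hs'.2 (Or.inl (not_lt.2 h1.le)) S
            (by linarith [alt_nonneg (G := G) R])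
      · exact not_lt.2 hca h.1
    · rcases R.eq_empty_or_nonempty with rfl | hR
      · have := D.lo.le_x ns
        rw [alt_empty, V_empty] at V
        linarith
      · obtain ⟨M, hM, h, hh, K⟩ := D.q_pick hR hs ns
        have e1 := D.lo.V_C hh.1
        have e2 := G.V_erase hh.1
        have e3 := le_alt (G := G) hh.1
        have e4 := D.lo.f_C hh.1 q
        have e5 := (G.b q).nonneg h
        have H' : G.Late q B (insert h C) := by
          rcases H with H | H
          · exact Or.inl (not_lt.2 (by linarith [not_lt.1 H]))
          · exact Or.inr H
        have S' : 2 * G.x < G.V A + G.V (insert h C) + G.V (R.erase h) := by linarith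
        have V' : 2 * G.x < G.V A + G.V (insert h C) + G.V (R.erase h) + G.V A
          - G.V (insert h C) + G.alt (R.erase h) := by linarith
        by_cases hs' : G.f p B < G.f p A ∨ G.f q (insert h C) < G.f q A
        · obtain ⟨c', h1, h2⟩ := exists_between D.ab
          exact both_core (fun M' hM' => d1 M' (by omega)) (fun M' hM' => d2 M' (by omega))
            (K c le_rfl D.cb) (K c' (hca.trans h1.le) h2) hca h1 hs' H' S' (Or.inr (Or.inr V'))
        · rw [not_or] at hs'
          exact d2 M hM (K c le_rfl D.cb) hs'.1 hs'.2 H' S' V'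
  · intro p q A B C R a b c D hp hq H S V
    rcases R.eq_empty_or_nonempty with rfl | hR
    · have := D.lo.le_x (fun ns => ns.1.elim hp hq)
      rw [alt_empty, V_empty] at V
      linarith
    · obtain ⟨M, hM, K⟩ := D.i_pick hR hp hq H
      obtain ⟨k, hk, e⟩ := G.exists_alt_eq hR
      obtain ⟨a', h1, h2⟩ := exists_between (max_lt D.ab D.cb)
      rw [max_lt_iff] at h1
      have D' := K k hk a' h1.1.le h2
      have e1 := D.lo.V_A hk
      have e2 := G.V_erase hk
      by_cases hs' : G.f p B < G.f p (insert k A) ∨ G.f q C < G.f q (insert k A)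
      · exact d1 M hM D' h1.2.le hs' H (by linarith) (by linarith)
      · rw [not_or] at hs'
        exact d2 M hM D' hs'.1 hs'.2 H (by linarith)
          (by linarith [alt_nonneg (G := G) (R.erase k)])

lemma DState.duel_envied (D : G.DState N p q A B C R a b c) (hca : c ≤ a)
    (hs : G.f p B < G.f p A ∨ G.f q C < G.f q A) (H : G.Late q B C)
    (S : 2 * G.x < G.V A + G.V C + G.V R)
    (V : 2 * G.x < G.V A + G.V C + G.V R + G.V A - G.V C - G.alt R) : False :=
  (duel N).1 D hca hs H S V

lemma DState.duel_free (D : G.DState N p q A B C R a b c)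
    (hp : ¬ G.f p B < G.f p A) (hq : ¬ G.f q C < G.f q A) (H : G.Late q B C)
    (S : 2 * G.x < G.V A + G.V C + G.V R)
    (V : 2 * G.x < G.V A + G.V C + G.V R + G.V A - G.V C + G.alt R) : False :=
  (duel N).2 D hp hq H S V

end Game
end ECE

namespace ECE

open scoped Classical
open Finset

namespace Game

variable {m : ℕ} {G : Game m} {N : ℕ} {p q : Fin 3} {A B C R : Finset (Fin m)} {a b c : ℝ}

lemma DState.both_of_sat {a₁ b₁ c₁ : ℝ}
    (D1 : G.DState N p q A B C R a₁ b₁ c₁) (D2 : G.DState N p q A B C R a b c)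
    (h1 : c₁ ≤ a₁) (h2 : a < c) (hs : G.f p B < G.f p A ∨ G.f q C < G.f q A)
    (sat : ¬ G.f q C < G.f q B) (S : 2 * G.x < G.V A + G.V C + G.V R) : False :=
  both_core (fun M _ => (duel M).1) (fun M _ => (duel M).2) D1 D2 h1 h2 hs (Or.inl sat) S
    (Or.inl sat)

lemma DState.phase_of_sat (D : G.DState N p q A B C R a b c) (hac : a < c)
    (hp : ¬ G.f p B < G.f p A) (hq : ¬ G.f q C < G.f q A) (sat : ¬ G.f q C < G.f q B)
    (S : 2 * G.x < G.V A + G.V C + G.V R) :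
    G.V A + G.V R ≤ G.x ∧ G.f q A + G.f q R ≤ G.f q C ∧ G.f p A + G.f p R ≤ G.f p B := by
  induction N using Nat.strong_induction_on generalizing A R a b c with
  | _ N ih =>
  rcases R.eq_empty_or_nonempty with rfl | hR
  · have := D.lo.le_x (fun ns => ns.1.elim hp hq)
    rw [V_empty, f_empty, f_empty]
    exact ⟨by linarith, by linarith, by linarith⟩
  · obtain ⟨M, hM, K⟩ := D.i_pick hR hp hq (Or.inl sat)
    obtain ⟨g, hg⟩ := hR
    have D2 := K g hg a le_rfl D.ab
    have e1 := D.lo.V_A hg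
    have e2 := G.V_erase hg
    have e3 := D.lo.f_A hg p
    have e4 := D.lo.f_A hg q
    have e5 := G.f_erase p hg
    have e6 := G.f_erase q hg
    by_cases hs' : G.f p B < G.f p (insert g A) ∨ G.f q C < G.f q (insert g A)
    · exact (DState.both_of_sat (K g hg c hac.le D.cb) D2 le_rfl hac hs' sat
        (by linarith)).elim
    · rw [not_or] at hs'
      obtain ⟨k1, k2, k3⟩ := ih M hM D2 hac hs'.1 hs'.2 (by linarith)
      exact ⟨by linarith, by linarith, by linarith⟩

lemma DState.both {a₁ b₁ c₁ : ℝ}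
    (D1 : G.DState N p q A B C R a₁ b₁ c₁) (D2 : G.DState N p q A B C R a b c)
    (h1 : c₁ ≤ a₁) (h2 : a < c) (hs : G.f p B < G.f p A ∨ G.f q C < G.f q A)
    (H : G.Late q B C) (S : 2 * G.x < G.V A + G.V C + G.V R) (K : G.x < G.V A + G.V R) :
    False := by
  by_cases K' : ¬ G.f q C < G.f q B ∨ ¬ G.f p B < G.f p C ∨
      2 * G.x < G.V A + G.V C + G.V R + G.V A - G.V C + G.alt R
  · exact both_core (fun M _ => (duel M).1) (fun M _ => (duel M).2) D1 D2 h1 h2 hs H S K'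
  rw [not_or, not_or, not_not, not_not, not_lt] at K'
  obtain ⟨unsat, hpC, hm⟩ := K'
  have hiq := H.resolve_left (not_not.2 unsat)
  obtain ⟨M, hM, h | h | h⟩ := D2.elim ⟨hs, Or.inl D2.ab, Or.inl h2⟩
  · exact h.2.2.duel_envied h2.le (Or.inl hpC) (Or.inr hiq) (by linarith) (by linarith)
  · obtain ⟨-, -, D'⟩ := h
    by_cases hs' : G.f q B < G.f q A ∨ G.f p C < G.f p A
    · obtain ⟨M', hM', h | h | h⟩ := D'.elim ⟨hs', Or.inl D'.ab, Or.inl h2⟩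
      · exact h.2.2.duel_free (not_lt.2 unsat.le) (not_lt.2 h.2.1.le)
          (Or.inl (not_lt.2 (hpC.trans h.2.1).le)) (by linarith) (by linarith [alt_nonneg (G := G) R])
      · exact not_lt.2 unsat.le h.1
      · exact not_lt.2 hpC.le h.2.1
    · rw [not_or] at hs'
      have := (D'.phase_of_sat h2 hs'.1 hs'.2 (not_lt.2 hpC.le) S).1
      linarith
  · obtain ⟨-, -, h4, D'⟩ := h
    by_cases hAC : G.f p A < G.f p C
    · exact D'.duel_envied h2.le (Or.inr hAC) (Or.inl (not_lt.2 h4.le)) (by linarith) (by linarith)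
    · exact D'.duel_free (not_lt.2 unsat.le) hAC (Or.inl (not_lt.2 h4.le)) (by linarith)
        (by linarith [alt_nonneg (G := G) R])

lemma DState.phase (D : G.DState N p q A B C R a b c) (hac : a < c)
    (hp : ¬ G.f p B < G.f p A) (hq : ¬ G.f q C < G.f q A) (H : G.Late q B C)
    (S : 2 * G.x < G.V A + G.V C + G.V R) : G.V A + G.V R ≤ G.x := by
  by_contra! hx
  induction N using Nat.strong_induction_on generalizing A R a b c with
  | _ N ih =>
  rcases R.eq_empty_or_nonempty with rfl | hR
  · have := D.lo.le_x (fun ns => ns.1.elim hp hq)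
    rw [V_empty] at hx
    linarith
  · obtain ⟨M, hM, K⟩ := D.i_pick hR hp hq H
    obtain ⟨g, hg⟩ := hR
    have D2 := K g hg a le_rfl D.ab
    have e1 := D.lo.V_A hg
    have e2 := G.V_erase hg
    by_cases hs' : G.f p B < G.f p (insert g A) ∨ G.f q C < G.f q (insert g A)
    · exact DState.both (K g hg c hac.le D.cb) D2 le_rfl hac hs' H (by linarith) (by linarith)
    · rw [not_or] at hs'
      exact ih M hM D2 hac hs'.1 hs'.2 (by linarith) (by linarith)

lemma Late.insert {h : Fin m} (H : G.Late q B C) (hC : h ∉ C) : G.Late q B (insert h C) := by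
  have e1 := G.f_insert q hC
  have e2 := (G.b q).nonneg h
  rcases H with H | H
  · exact Or.inl (not_lt.2 (by linarith [not_lt.1 H]))
  · exact Or.inr H

/-- What remains after `q` has taken `h` is worth too little for `i` to outweigh. -/
lemma DState.after_top (D : G.DState N p q A B C R a b c) (hca : c ≤ a)
    (sat : ¬ G.f q C < G.f q B) (S : 2 * G.x < G.V A + G.V C + G.V R)
    (hx : G.x < G.V A + G.V R) {h : Fin m} (hh : G.Top q R h) :
    G.V A + G.V R - G.v h ≤ G.x ∧
    G.f q A + G.f q R ≤ G.f q C + 2 * (G.b q).val h ∧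
    G.f p A + G.f p R ≤ G.f p B + (G.b p).val h := by
  induction N using Nat.strong_induction_on generalizing A R a b c with
  | _ N ih =>
  have hR : R.Nonempty := ⟨h, hh.1⟩
  have nns : ¬ G.NoSrc p q A B C a b c := fun ns => by
    obtain ⟨M, hM, h | h | h⟩ := D.elim ns
    · exact not_lt.2 hca h.1
    · exact sat h.2.1
    · exact sat h.2.1
  by_cases hs : G.f p B < G.f p A ∨ G.f q C < G.f q A
  · obtain ⟨M, hM, h', hh', K⟩ := D.q_pick hR hs nns
    obtain rfl := hh.unique hh'
    have e1 := D.lo.V_C hh.1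
    have e2 := G.V_erase hh.1
    have e3 := D.lo.f_C hh.1 p
    have e4 := D.lo.f_C hh.1 q
    have e5 := G.f_erase p hh.1
    have e6 := G.f_erase q hh.1
    have e7 := (G.b q).nonneg h
    obtain ⟨c', h1, h2⟩ := exists_between D.ab
    have sat' : ¬ G.f q (insert h C) < G.f q B := not_lt.2 (by linarith [not_lt.1 sat])
    by_cases hs' : G.f p B < G.f p A ∨ G.f q (insert h C) < G.f q A
    · exact (DState.both_of_sat (K c le_rfl D.cb) (K c' (hca.trans h1.le) h2) hca h1 hs' sat'
        (by linarith)).elim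
    · rw [not_or] at hs'
      obtain ⟨k1, k2, k3⟩ := (K c' (hca.trans h1.le) h2).phase_of_sat h1 hs'.1 hs'.2 sat'
        (by linarith)
      exact ⟨by linarith, by linarith, by linarith⟩
  · rw [not_or] at hs
    obtain ⟨M, hM, K⟩ := D.i_pick hR hs.1 hs.2 (Or.inl sat)
    have K' : ∀ g ∈ R, G.DState M p q (insert g A) B C (R.erase g) a b c :=
      fun g hg => K g hg a le_rfl D.ab
    by_cases hne : (R.erase h).Nonempty
    · obtain ⟨g, hg⟩ := hne
      have hg' := mem_erase.1 hg
      have e1 := D.lo.V_A hg'.2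
      have e2 := G.V_erase hg'.2
      have e3 := D.lo.f_A hg'.2 p
      have e4 := D.lo.f_A hg'.2 q
      have e5 := G.f_erase p hg'.2
      have e6 := G.f_erase q hg'.2
      obtain ⟨k1, k2, k3⟩ := ih M hM (K' g hg'.2) hca (by linarith) (by linarith)
        ⟨mem_erase.2 ⟨hg'.1.symm, hh.1⟩, fun k hk => hh.2 k (mem_erase.1 hk).2⟩
      exact ⟨by linarith, by linarith, by linarith⟩
    · rw [Finset.not_nonempty_iff_eq_empty] at hne
      have D' := K' h hh.1
      have e1 := D.lo.V_A hh.1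
      have e2 := G.V_erase hh.1
      rw [hne] at D' e2
      rw [V_empty] at e2
      refine (not_lt.2 (D'.lo.le_x fun ns => ?_) (by linarith)).elim
      obtain ⟨M, hM, h | h | h⟩ := D'.elim ns
      · exact not_lt.2 hca h.1
      · exact sat h.2.1
      · exact sat h.2.1

lemma DState.false_of_late (D : G.DState N p q A B C R a b c) (hca : c ≤ a)
    (H : G.Late q B C) (hpC : ¬ G.f p B < G.f p C) (S : 2 * G.x < G.V A + G.V C + G.V R)
    {h : Fin m} (hh : G.Top q R h) (hx : G.x < G.V A + G.V R - G.v h) : False := by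
  induction N using Nat.strong_induction_on generalizing A R a b c with
  | _ N ih =>
  have hR : R.Nonempty := ⟨h, hh.1⟩
  have nns : ¬ G.NoSrc p q A B C a b c := fun ns => ns.2.2.elim (not_lt.2 hca) hpC
  by_cases hs : G.f p B < G.f p A ∨ G.f q C < G.f q A
  · obtain ⟨M, hM, h', hh', K⟩ := D.q_pick hR hs nns
    obtain rfl := hh.unique hh'
    have e1 := D.lo.V_C hh.1
    have e2 := G.V_erase hh.1
    obtain ⟨c', h1, h2⟩ := exists_between D.ab
    have H' : G.Late q B (insert h C) := H.insert (not_mem_of_disjoint D.lo.disj.2.2 hh.1)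
    by_cases hs' : G.f p B < G.f p A ∨ G.f q (insert h C) < G.f q A
    · exact DState.both (K c le_rfl D.cb) (K c' (hca.trans h1.le) h2) hca h1 hs' H'
        (by linarith) (by linarith)
    · rw [not_or] at hs'
      have := (K c' (hca.trans h1.le) h2).phase h1 hs'.1 hs'.2 H' (by linarith)
      linarith
  · rw [not_or] at hs
    obtain ⟨M, hM, K⟩ := D.i_pick hR hs.1 hs.2 H
    have K' : ∀ g ∈ R, G.DState M p q (insert g A) B C (R.erase g) a b c :=
      fun g hg => K g hg a le_rfl D.ab
    by_cases hne : (R.erase h).Nonempty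
    · obtain ⟨g, hg⟩ := hne
      have hg' := mem_erase.1 hg
      have e1 := D.lo.V_A hg'.2
      have e2 := G.V_erase hg'.2
      exact ih M hM (K' g hg'.2) hca (by linarith)
        ⟨mem_erase.2 ⟨hg'.1.symm, hh.1⟩, fun k hk => hh.2 k (mem_erase.1 hk).2⟩ (by linarith)
    · rw [Finset.not_nonempty_iff_eq_empty] at hne
      have D' := K' h hh.1
      have e1 := D.lo.V_A hh.1
      have e2 := G.V_erase hh.1
      rw [hne] at D' e2
      rw [V_empty] at e2
      have := D'.lo.le_x fun ns => ns.2.2.elim (not_lt.2 hca) hpC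
      linarith [G.nonneg h]

end Game
end ECE

namespace ECE

open scoped Classical
open Finset

variable {n m : ℕ}

lemma Reach.subset {b : Fin n → Bid m} {A P : Fin n → Finset (Fin m)} {R : Finset (Fin m)}
    {τ : Equiv.Perm (Fin n)} (h : Reach b A P R τ) (y : Fin n) :
    P y ⊆ A (τ y) ∧ A (τ y) ⊆ P y ∪ R := by
  induction h generalizing y with
  | done _ => simp
  | elim σ _ _ _ ih => simpa using ih (σ⁻¹ y)
  | @pick P R τ z g _ hg _ _ ih =>
    have := ih y
    by_cases hy : y = z
    · subst hy
      rw [Function.update_self] at this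
      refine ⟨(Finset.subset_insert _ _).trans this.1, fun k hk => ?_⟩
      have := this.2 hk
      grind
    · rw [Function.update_of_ne hy] at this
      exact ⟨this.1, this.2.trans (Finset.union_subset_union_right (Finset.erase_subset _ _))⟩

lemma bval_mono (b : Bid m) {S T : Finset (Fin m)} (h : S ⊆ T) : bval b S ≤ bval b T :=
  Finset.sum_le_sum_of_subset_of_nonneg h fun g _ _ => b.nonneg g

lemma bval_le_update (b : Bid m) (P : Fin n → Finset (Fin m)) (g : Fin m) (z y : Fin n) :
    bval b (P y) ≤ bval b (Function.update P z (insert g (P z)) y) := by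
  by_cases hy : y = z
  · subst hy
    rw [Function.update_self]
    exact bval_mono b (Finset.subset_insert _ _)
  · rw [Function.update_of_ne hy]

lemma Reach.own {b : Fin n → Bid m} {A P : Fin n → Finset (Fin m)} {R : Finset (Fin m)}
    {τ : Equiv.Perm (Fin n)} (h : Reach b A P R τ) (y : Fin n) :
    bval (b y) (P y) ≤ bval (b y) (A y) ∧ (τ y ≠ y → bval (b y) (P y) < bval (b y) (A y)) := by
  induction h with
  | done _ => simp
  | elim σ _ hσ _ ih =>
    by_cases hy : σ y = y
    · have h' : σ⁻¹ y = y := by rw [Equiv.Perm.inv_eq_iff_eq, hy]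
      simpa only [hy, h', Equiv.Perm.mul_apply] using ih
    · have := hσ.1.2 y hy
      unfold envies at this
      exact ⟨by linarith, fun _ => by linarith⟩
  | @pick P R τ z g _ hg _ _ ih =>
    have := bval_le_update (b y) P g z y
    exact ⟨by linarith, fun h => by linarith [ih.2 h]⟩

lemma Reach.eq_of_not_envied {b : Fin n → Bid m} {A P : Fin n → Finset (Fin m)}
    {R : Finset (Fin m)} {τ : Equiv.Perm (Fin n)} (h : Reach b A P R τ) {i : Fin n}
    (hi : ∀ y, y ≠ i → bval (b y) (A (τ i)) ≤ bval (b y) (P y)) : τ i = i := by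
  induction h with
  | done _ => rfl
  | elim σ hs hσ h ih =>
    refine (hs ⟨i, fun z hz => ?_⟩).elim
    have h1 := ((Reach.elim σ hs hσ h).subset i).1
    by_cases hzi : z = i
    · subst hzi; exact lt_irrefl _ hz
    · exact not_lt.2 ((bval_mono (b z) h1).trans (hi z hzi)) hz
  | @pick P R τ z g _ hg _ _ ih =>
    exact ih fun y hy => (hi y hy).trans (bval_le_update (b y) P g z y)

lemma Reach.pairwise_disjoint {b : Fin n → Bid m} {A P : Fin n → Finset (Fin m)}
    {R : Finset (Fin m)} {τ : Equiv.Perm (Fin n)} (h : Reach b A P R τ)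
    (hR : ∀ y, Disjoint (P y) R) (hP : ∀ y z, y ≠ z → Disjoint (P y) (P z)) (y z : Fin n)
    (hyz : y ≠ z) : Disjoint (A y) (A z) := by
  induction h with
  | done _ => exact hP y z hyz
  | elim σ _ _ _ ih => exact ih (fun y => hR _) fun y z h => hP _ _ (σ.injective.ne h)
  | @pick P R τ u g _ hg _ _ ih =>
    refine ih (Game.disjoint_update hR u) fun y z h => ?_
    have h1 := Finset.disjoint_left.1 (hR y).symm hg
    have h2 := Finset.disjoint_left.1 (hR z).symm hg
    by_cases hy : y = u
    · subst hy
      rw [Function.update_self, Function.update_of_ne h.symm, Finset.disjoint_insert_left]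
      exact ⟨h2, hP _ _ h⟩
    · rw [Function.update_of_ne hy]
      by_cases hz : z = u
      · subst hz
        rw [Function.update_self, Finset.disjoint_insert_right]
        exact ⟨h1, hP _ _ h⟩
      · rw [Function.update_of_ne hz]; exact hP _ _ h

lemma Reach.total {b : Fin n → Bid m} {A P : Fin n → Finset (Fin m)}
    {R : Finset (Fin m)} {τ : Equiv.Perm (Fin n)} (h : Reach b A P R τ) (v : Fin m → ℝ)
    (hR : ∀ y, Disjoint (P y) R) : ∑ y, value v (P y) + value v R = ∑ y, value v (A y) := by
  induction h with
  | done _ => simp [value]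
  | @elim P R τ σ _ _ _ ih =>
    rw [← ih fun y => hR _, Equiv.sum_comp σ fun y => value v (P y)]
  | @pick P R τ u g _ hg _ _ ih =>
    rw [← ih (Game.disjoint_update hR u), value_erase hg,
      ← Finset.add_sum_erase univ (fun y => value v (P y)) (mem_univ u),
      ← Finset.add_sum_erase univ _ (mem_univ u), Function.update_self,
      value_insert (Finset.disjoint_left.1 (hR u).symm hg)]
    have : ∑ y ∈ univ.erase u, value v (Function.update P u (insert g (P u)) y)
        = ∑ y ∈ univ.erase u, value v (P y) :=
      Finset.sum_congr rfl fun y hy => by rw [Function.update_of_ne (mem_erase.1 hy).1]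
    rw [this]; ring

namespace Game

variable {G : Game m} {A P : Fin 3 → Finset (Fin m)} {R : Finset (Fin m)} {τ : Equiv.Perm (Fin 3)}
  {p q j k : Fin 3}

/-- The reports of agent `i` along the actual run. -/
noncomputable def own (G : Game m) (P : Fin 3 → Finset (Fin m)) (y : Fin 3) : ℝ := G.f G.i (P y)

/-- A state of the actual run, which ends in the allocation `A`. -/
structure Run (G : Game m) (A P : Fin 3 → Finset (Fin m)) (R : Finset (Fin m))
    (τ : Equiv.Perm (Fin 3)) : Prop where
  reach : Reach G.b A P R τ
  nw : G.NW P R (G.own P)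

lemma ed_own (P : Fin 3 → Finset (Fin m)) : G.Ed P (G.own P) = envies G.b P := env_self

lemma own_update (P : Fin 3 → Finset (Fin m)) (y : Fin 3) (g : Fin m) :
    G.own (Function.update P y (insert g (P y))) =
      Function.update (G.own P) y (G.f G.i (insert g (P y))) := by
  ext z
  unfold own
  by_cases hz : z = y
  · subst hz; simp
  · simp [hz]

/-- The possible continuations of the actual run. -/
lemma Run.cases {motive : Prop} (r : G.Run A P R τ)
    (done : P = A → R = ∅ → τ = 1 → (∃ y, IsSrc (envies G.b P) y) → motive)
    (elim : ∀ σ τ', (¬ ∃ y, IsSrc (envies G.b P) y) → IsMinCyc (envies G.b P) σ →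
      (∀ y, τ' y = τ (σ y)) → G.Run A (fun y => P (σ y)) R τ' → motive)
    (pick : ∀ y g, IsPick (envies G.b P) y → G.Top y R g →
      G.Run A (Function.update P y (insert g (P y))) (R.erase g) τ → motive) : motive := by
  obtain ⟨h, nw⟩ := r
  cases h with
  | done hs => exact done rfl rfl rfl hs
  | elim σ hs hσ h =>
    rw [← ed_own] at hs hσ
    have := nw.elim hs hσ
    rw [ed_own] at hs hσ
    exact elim σ _ hs hσ (by simp) ⟨h, this⟩
  | pick y g hy hg hp h =>
    rw [← ed_own] at hy
    have := nw.pick hy hg (fun _ => hp) (c := G.f G.i (insert g (P y)))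
      (G.f_mono _ (Finset.subset_insert _ _))
    rw [ed_own] at hy
    rw [← own_update P y g] at this
    exact pick y g hy ⟨hg, hp⟩ ⟨h, this⟩

/-- Induction along the actual run. -/
lemma Run.induction {motive : (Fin 3 → Finset (Fin m)) → Finset (Fin m) → Equiv.Perm (Fin 3) → Prop}
    (r : G.Run A P R τ)
    (step : ∀ P R τ, G.Run A P R τ →
      (∀ σ τ', (¬ ∃ y, IsSrc (envies G.b P) y) → IsMinCyc (envies G.b P) σ →
        (∀ y, τ' y = τ (σ y)) → G.Run A (fun y => P (σ y)) R τ' → motive (fun y => P (σ y)) R τ') →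
      (∀ y g, IsPick (envies G.b P) y → G.Top y R g →
        G.Run A (Function.update P y (insert g (P y))) (R.erase g) τ →
        motive (Function.update P y (insert g (P y))) (R.erase g) τ) → motive P R τ) :
    motive P R τ := by
  have key : ∀ N P R τ, G.Run A P R τ → 7 * R.card + edgeCount (envies G.b P) ≤ N →
      motive P R τ := by
    intro N
    induction N with
    | zero =>
      intro P R τ r hN
      have h6 : ¬ ∃ σ, IsMinCyc (envies G.b P) σ := by
        rintro ⟨σ, hσ⟩
        rw [← ed_own] at hσ
        have := env_edgeCount_lt hσ.1
        change _ < edgeCount (G.Ed P (G.own P)) at this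
        rw [ed_own] at this
        omega
      refine step P R τ r (fun σ _ _ hσ => (h6 ⟨σ, hσ⟩).elim) fun y g _ hg => ?_
      have := Finset.card_pos.2 ⟨g, hg.1⟩
      omega
    | succ N ih =>
      intro P R τ r hN
      refine step P R τ r (fun σ τ' hs hσ _ r' => ih _ _ _ r' ?_) fun y g _ hg r' => ih _ _ _ r' ?_
      · rw [← ed_own] at hσ
        have := env_edgeCount_lt hσ.1
        change edgeCount (G.Ed (fun y => P (σ y)) (G.own fun y => P (σ y))) <
          edgeCount (G.Ed P (G.own P)) at this
        rw [ed_own, ed_own] at this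
        omega
      · have := Finset.card_erase_add_one hg.1
        have := edgeCount_le_six (E := envies G.b (Function.update P y (insert g (P y))))
          (fun y => by simp [envies])
        omega
  exact key _ P R τ r le_rfl

lemma sum_eq (hpi : p ≠ G.i) (hqi : q ≠ G.i) (hpq : p ≠ q) (F : Fin 3 → ℝ) :
    ∑ y, F y = F G.i + F p + F q := by
  have : (univ : Finset (Fin 3)) = {G.i, p, q} := by
    ext y
    simpa using cover hpi hqi hpq y
  rw [this, Finset.sum_insert (by simp [hpi.symm, hqi.symm]),
    Finset.sum_insert (by simpa using hpq), Finset.sum_singleton]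
  ring

/-- The final allocation `A` in which the bundle of `j` is too good for agent `i`. -/
structure Viol (G : Game m) (A : Fin 3 → Finset (Fin m)) (j k : Fin 3) : Prop where
  hji : j ≠ G.i
  hki : k ≠ G.i
  hjk : j ≠ k
  val : G.V (A G.i) = G.x
  big : ∀ g ∈ A j, 2 * G.x < G.V (A j) - G.v g
  disj : ∀ y z, y ≠ z → Disjoint (A y) (A z)

lemma Viol.x_nonneg (H : G.Viol A j k) : 0 ≤ G.x := H.val ▸ G.V_nonneg _

lemma Run.total (r : G.Run A P R τ) (H : G.Viol A j k) (hpi : p ≠ G.i) (hqi : q ≠ G.i)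
    (hpq : p ≠ q) : G.V (P G.i) + G.V (P p) + G.V (P q) + G.V R =
      G.x + G.V (A j) + G.V (A k) := by
  have := r.reach.total G.v r.nw.1
  rw [sum_eq hpi hqi hpq, sum_eq H.hji H.hki H.hjk] at this
  rw [← H.val]
  exact this

lemma Run.subset (r : G.Run A P R τ) (y : Fin 3) : P y ⊆ A (τ y) ∧ A (τ y) ⊆ P y ∪ R :=
  r.reach.subset y

lemma Run.own_le (r : G.Run A P R τ) (y : Fin 3) : G.f y (P y) ≤ G.f y (A y) :=
  (r.reach.own y).1

lemma Run.own_lt (r : G.Run A P R τ) {y : Fin 3} (h : τ y ≠ y) : G.f y (P y) < G.f y (A y) :=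
  (r.reach.own y).2 h

lemma Run.eq_of_not_envied (r : G.Run A P R τ)
    (h : ∀ y, y ≠ G.i → G.f y (A (τ G.i)) ≤ G.f y (P y)) : τ G.i = G.i :=
  r.reach.eq_of_not_envied h

lemma NW.lo {ω : Fin 3 → ℝ} (h : G.NW P R ω) (hpi : p ≠ G.i) (hqi : q ≠ G.i) (hpq : p ≠ q) :
    ∃ N, G.Lo N p q (P G.i) (P p) (P q) R (ω G.i) (ω p) (ω q) :=
  ⟨_, Lo.of_nw h hpi hqi hpq le_rfl⟩

lemma exists_others (i p : Fin 3) (h : p ≠ i) : ∃ q, q ≠ i ∧ p ≠ q := by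
  revert i p; decide

lemma NW.false_of_top {ω : Fin 3 → ℝ} (h : G.NW P R ω) (ht : ∀ y, ω y ≤ ω G.i)
    (hx : G.x < G.V (P G.i)) : False := by
  obtain ⟨p, hp⟩ := exists_ne G.i
  obtain ⟨q, hq, hpq⟩ := exists_others G.i p hp
  obtain ⟨N, L⟩ := h.lo hp hq hpq
  exact L.false_of_top (ht p) (ht q) hx

/-- The state obtained from `P` when `i` reports the value `K` for the bundle of `p`. -/
abbrev Raised (G : Game m) (P : Fin 3 → Finset (Fin m)) (R : Finset (Fin m)) (p : Fin 3) (K : ℝ) :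
    Prop := G.NW P R (Function.update (G.own P) p K)

lemma Raised.dstate {K : ℝ} (h : G.Raised P R p K) (hpi : p ≠ G.i) (hqi : q ≠ G.i) (hpq : p ≠ q)
    (hi : G.own P G.i < K) (hq : G.own P q < K) (hx : G.x < G.V (P p)) :
    ∃ N, G.DState N p q (P G.i) (P p) (P q) R (G.own P G.i) K (G.own P q) := by
  obtain ⟨N, L⟩ := NW.lo h hpi hqi hpq
  rw [Function.update_self, Function.update_of_ne hpi.symm, Function.update_of_ne hpq.symm] at L
  exact ⟨N, L, hi, hq, hx⟩

lemma ed_raised {K : ℝ} (hpi : p ≠ G.i) (hi : G.own P G.i < K) (y z : Fin 3) :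
    G.Ed P (Function.update (G.own P) p K) y z ↔ envies G.b P y z ∨ (y = G.i ∧ z = p) := by
  rw [← ed_own]
  unfold Ed Env
  by_cases hy : y = G.i
  · subst hy
    by_cases hz : z = p
    · subst hz; simp [hpi.symm, hi]
    · simp [hpi.symm, hz]
  · simp [hy]

end Game
end ECE

namespace ECE

open scoped Classical
open Finset

namespace Game

variable {m : ℕ} {G : Game m} {A P : Fin 3 → Finset (Fin m)} {R : Finset (Fin m)}
  {τ : Equiv.Perm (Fin 3)} {p q j k : Fin 3}

lemma update_same (P : Fin 3 → Finset (Fin m)) (y : Fin 3) (g : Fin m) :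
    Function.update P y (insert g (P y)) y = insert g (P y) := Function.update_self _ _ _

lemma Run.false_of_rotated (r : G.Run A P R τ) (hki : k ≠ G.i) (hpi : p ≠ G.i) (hqi : q ≠ G.i)
    (hpq : p ≠ q) (hτ : τ G.i = k) (h1 : G.f q (A k) ≤ G.f q (P p))
    (h2 : G.f p (A k) ≤ G.f p (P p)) (h3 : G.f G.i (P p) < G.f G.i (P G.i))
    (hx : G.x < G.V (P q)) : False := by
  revert hτ h1 h2 h3 hx
  refine r.induction (motive := fun P _ τ => τ G.i = k → G.f q (A k) ≤ G.f q (P p) →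
    G.f p (A k) ≤ G.f p (P p) → G.f G.i (P p) < G.f G.i (P G.i) → G.x < G.V (P q) → False) ?_
  intro P R τ r ihe ihp hτ h1 h2 h3 hx
  have e1 : G.f q (P q) < G.f q (P p) := by
    by_contra! h
    refine hki (hτ ▸ r.eq_of_not_envied fun y hy => ?_)
    rw [hτ]
    rcases cover hpi hqi hpq y with rfl | rfl | rfl
    exacts [(hy rfl).elim, h2, h1.trans h]
  have e2 : ¬ G.f p (P p) < G.f p (P G.i) := by
    have := G.f_mono p (r.subset G.i).1
    rw [hτ] at this
    linarith
  refine r.cases ?_ ?_ ?_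
  · rintro - - rfl -
    exact hki hτ.symm
  · intro σ τ' hs hσ hτ' r'
    have ih := ihe σ τ' hs hσ hτ' r'
    have E : ∀ y, σ y ≠ y → G.f y (P y) < G.f y (P (σ y)) := hσ.1.2
    rcases perm_cases hpi hqi hpq hσ.1.1.ne_one with ⟨s1, s2, s3⟩ | ⟨s1, s2, s3⟩ |
      ⟨s1, s2, s3⟩ | ⟨s1, s2, s3⟩ | ⟨s1, s2, s3⟩
    · have := E p (by rw [s2]; exact hpi.symm)
      rw [s2] at this
      exact e2 this
    · have := E G.i (by rw [s1]; exact hqi)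
      rw [s1] at this
      refine r'.nw.false_of_top (fun y => ?_) (by rwa [s1])
      unfold own
      beta_reduce
      rw [s1]
      rcases cover hpi hqi hpq y with rfl | rfl | rfl
      · rw [s1]
      · rw [s2]; linarith
      · rw [s3]; linarith
    · have := E p (by rw [s2]; exact hpq.symm)
      rw [s2] at this
      have hτi : τ' G.i = k := by rw [hτ', s1, hτ]
      refine hki (hτi ▸ r'.eq_of_not_envied fun y hy => ?_)
      rw [hτi]
      rcases cover hpi hqi hpq y with rfl | rfl | rfl
      · exact (hy rfl).elim
      · rw [s2]; linarith
      · rw [s3]; linarith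
    · have := E G.i (by rw [s1]; exact hpi)
      rw [s1] at this
      linarith
    · have := E p (by rw [s2]; exact hpi.symm)
      rw [s2] at this
      exact e2 this
  · intro y g hy hg r'
    have ih := ihp y g hy hg r'
    rcases cover hpi hqi hpq y with rfl | rfl | rfl
    · rw [update_same, Function.update_of_ne hpi, Function.update_of_ne hqi] at ih
      exact ih hτ h1 h2 (h3.trans_le (G.f_mono _ (Finset.subset_insert _ _))) hx
    · exact hy.1 q e1
    · rw [update_same, Function.update_of_ne hpq, Function.update_of_ne hqi.symm] at ih
      exact ih hτ h1 h2 h3 (hx.trans_le (G.V_mono (Finset.subset_insert _ _)))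

/-- Once `i` and `q` envy each other while `p` keeps the only bundle that can grow, the bundles
of `i` and `q` are final. -/
lemma Run.persist {K : ℝ} (r : G.Run A P R τ) (hki : k ≠ G.i) (hpi : p ≠ G.i) (hqi : q ≠ G.i)
    (hpq : p ≠ q) (hτi : τ G.i = G.i) (hτq : τ q = k) (D : G.Raised P R p K)
    (hK : ∀ y, G.f G.i (A y) < K) (h1 : G.f G.i (P G.i) < G.f G.i (P q))
    (h2 : G.f q (P q) < G.f q (P G.i)) (h3 : G.f q (A k) ≤ G.f q (P G.i))
    (h4 : G.f p (A k) ≤ G.f p (P p)) (hx : G.x < G.V (P p)) :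
    P G.i = A G.i ∧ P q = A k ∧ q = k ∧ G.f q (A p) ≤ G.f q (A q) := by
  revert hτi hτq D h1 h2 h3 h4 hx
  refine r.induction (motive := fun P R τ => τ G.i = G.i → τ q = k → G.Raised P R p K →
    G.f G.i (P G.i) < G.f G.i (P q) → G.f q (P q) < G.f q (P G.i) →
    G.f q (A k) ≤ G.f q (P G.i) → G.f p (A k) ≤ G.f p (P p) → G.x < G.V (P p) →
    P G.i = A G.i ∧ P q = A k ∧ q = k ∧ G.f q (A p) ≤ G.f q (A q)) ?_
  intro P R τ r ihe ihp hτi hτq D h1 h2 h3 h4 hx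
  have hqk := (r.subset q).1
  rw [hτq] at hqk
  have hpC : ¬ G.f p (P p) < G.f p (P q) := by
    have := G.f_mono p hqk
    linarith
  have hWi : G.f G.i (P G.i) < K := (r.own_le G.i).trans_lt (hK _)
  have hWq : G.f G.i (P q) < K := (G.f_mono _ hqk).trans_lt (hK _)
  refine r.cases ?_ ?_ ?_
  · rintro rfl rfl rfl ⟨y, hy⟩
    refine ⟨rfl, by rw [← hτq]; rfl, hτq, ?_⟩
    rcases cover hpi hqi hpq y with rfl | rfl | rfl
    · exact (hy q h2).elim
    · exact not_lt.1 (hy q)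
    · exact (hy G.i h1).elim
  · intro σ τ' hs hσ hτ' r'
    exfalso
    have E : ∀ y, σ y ≠ y → G.f y (P y) < G.f y (P (σ y)) := hσ.1.2
    have top : σ G.i ≠ p := by
      intro s
      have hE : G.f G.i (P G.i) < G.f G.i (P p) := by
        have := E G.i (by rw [s]; exact hpi)
        rwa [s] at this
      have hEd : G.Ed P (Function.update (G.own P) p K) = envies G.b P := by
        ext y z
        rw [ed_raised hpi hWi]
        exact ⟨fun h => h.elim id (by rintro ⟨rfl, rfl⟩; exact hE), Or.inl⟩
      rw [← hEd] at hs hσ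
      refine (D.elim hs hσ).false_of_top (fun y => ?_) (by rwa [s])
      simp only [s, Function.update_self]
      by_cases hy : σ y = p
      · rw [hy, Function.update_self]
      · rw [Function.update_of_ne hy]
        rcases cover hpi hqi hpq (σ y) with h | h | h
        · rw [h]; exact hWi.le
        · exact (hy h).elim
        · rw [h]; exact hWq.le
    rcases perm_cases hpi hqi hpq hσ.1.1.ne_one with ⟨s1, s2, s3⟩ | ⟨s1, s2, s3⟩ |
      ⟨s1, s2, s3⟩ | ⟨s1, s2, s3⟩ | ⟨s1, s2, s3⟩
    · exact top s1
    · have hτi' : τ' G.i = k := by rw [hτ', s1, hτq]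
      refine hki (hτi' ▸ r'.eq_of_not_envied fun y hy => ?_)
      rw [hτi']
      rcases cover hpi hqi hpq y with rfl | rfl | rfl
      · exact (hy rfl).elim
      · rw [s2]; exact h4
      · rw [s3]; exact h3
    · have := E p (by rw [s2]; exact hpq.symm)
      rw [s2] at this
      exact hpC this
    · exact top s1
    · have hτi' : τ' G.i = k := by rw [hτ', s1, hτq]
      have e1 := E p (by rw [s2]; exact hpi.symm)
      rw [s2] at e1
      refine r'.false_of_rotated hki hpi hqi hpq hτi' ?_ ?_ ?_ ?_
      · rw [s2]; exact h3
      · rw [s2]; linarith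
      · rw [s1, s2]; exact h1
      · rwa [s3]
  · intro y g hy hg r'
    have ih := ihp y g hy hg r'
    rcases cover hpi hqi hpq y with rfl | rfl | rfl
    · exact (hy.1 q h2).elim
    · rw [update_same, Function.update_of_ne hpi.symm, Function.update_of_ne hpq.symm] at ih
      refine ih hτi hτq ?_ h1 h2 h3 (h4.trans (G.f_mono _ (Finset.subset_insert _ _)))
        (hx.trans_le (G.V_mono (Finset.subset_insert _ _)))
      rw [← ed_own] at hy
      have hWp : G.own P y ≤ K := ((G.f_mono _ (r.subset y).1).trans_lt (hK _)).le
      have := r.nw.pick hy hg.1 (fun _ => hg.2) (c := K) hWp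
      unfold Raised
      rwa [own_update, Function.update_idem]
    · exact (hy.1 G.i h1).elim

end Game
end ECE

namespace ECE

open scoped Classical
open Finset

namespace Game

variable {m N : ℕ} {G : Game m} {A P : Fin 3 → Finset (Fin m)} {R : Finset (Fin m)}
  {τ : Equiv.Perm (Fin 3)} {p q j k : Fin 3} {a b c : ℝ}

lemma f_le_of_subset_union {S T U : Finset (Fin m)} (y : Fin 3) (h : U ⊆ S ∪ T) :
    G.f y U ≤ G.f y S + G.f y T := by
  have h1 := G.f_mono y h
  have h2 := G.f_nonneg y (S ∩ T)
  have h3 : G.f y (S ∪ T) + G.f y (S ∩ T) = G.f y S + G.f y T := Finset.sum_union_inter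
  linarith

lemma V_le_of_subset_union {S T U : Finset (Fin m)} (h : U ⊆ S ∪ T) :
    G.V U ≤ G.V S + G.V T := by
  have h1 := G.V_mono h
  have h2 := G.V_nonneg (S ∩ T)
  have h3 : G.V (S ∪ T) + G.V (S ∩ T) = G.V S + G.V T := Finset.sum_union_inter
  linarith

/-- If neither of two consecutive first choices of `q` belongs to the bundle `Γ`, then `p` and
`q` do not envy `Γ`. -/
lemma DState.le_of_tops {A B C R Γ : Finset (Fin m)} (D : G.DState N p q A B C R a b c)
    (hca : c ≤ a) (sat : ¬ G.f q C < G.f q B) (hp : ¬ G.f p B < G.f p A)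
    (hq : ¬ G.f q C < G.f q A) (S : 2 * G.x < G.V A + G.V C + G.V R)
    (hx : G.x < G.V A + G.V R) (hΓ : Γ ⊆ A ∪ R)
    (hL : ∀ h ∈ R, G.V A + G.V R - G.v h ≤ G.x → h ∉ Γ) :
    G.f q Γ ≤ G.f q C ∧ G.f p Γ ≤ G.f p B := by
  have hR : R.Nonempty := by
    by_contra hR
    rw [Finset.not_nonempty_iff_eq_empty] at hR
    subst hR
    have := D.lo.le_x (fun ns => ns.1.elim hp hq)
    rw [V_empty] at hx
    linarith
  obtain ⟨g, hg⟩ := G.exists_top q hR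
  obtain ⟨e1, e2, e3⟩ := D.after_top hca sat S hx hg
  obtain ⟨M, hM, K⟩ := D.i_pick hR hp hq (Or.inl sat)
  have D' := K g hg.1 a le_rfl D.ab
  have hVA := D.lo.V_A hg.1
  have hfA := D.lo.f_A hg.1
  have hVR := G.V_erase hg.1
  have hfR := fun y => G.f_erase y hg.1
  have hR' : (R.erase g).Nonempty := by
    by_contra hR'
    rw [Finset.not_nonempty_iff_eq_empty] at hR'
    rw [hR', V_empty] at hVR
    by_cases ns : G.NoSrc p q (insert g A) B C a b c
    · obtain ⟨M, hM, h | h | h⟩ := D'.elim ns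
      · exact not_lt.2 hca h.1
      · exact sat h.2.1
      · exact sat h.2.1
    · rw [hR'] at D'
      have := D'.lo.le_x ns
      linarith
  obtain ⟨h, hh⟩ := G.exists_top q hR'
  obtain ⟨e4, e5, e6⟩ := D'.after_top hca sat (by linarith) (by linarith) hh
  have hhR := Finset.mem_erase.1 hh.1
  have n1 := hL g hg.1 e1
  have n2 := hL h hhR.2 (by linarith)
  have key : ∀ y, G.f y Γ + (G.b y).val g + (G.b y).val h ≤ G.f y A + G.f y R := by
    intro y
    rw [← G.f_insert y n1, ← G.f_insert y (g := h) (by simp [hhR.1, n2])]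
    refine f_le_of_subset_union y fun u hu => ?_
    rcases Finset.mem_insert.1 hu with rfl | hu
    · exact Finset.mem_union_right _ hhR.2
    · rcases Finset.mem_insert.1 hu with rfl | hu
      · exact Finset.mem_union_right _ hg.1
      · exact hΓ hu
  have k1 := key p
  have k2 := key q
  rw [hfA, hfR] at e5 e6
  have g1 := (G.b p).nonneg h
  have g2 := (G.b p).nonneg g
  constructor <;> linarith

/-- The reports that follow if the bundle of `j` grows too good for agent `i`. -/
structure QInfo (G : Game m) (A : Fin 3 → Finset (Fin m)) (j k : Fin 3) : Prop where
  own : G.f G.i (A G.i) < G.f G.i (A k)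
  free : G.f k (A k) < G.f k (A G.i)
  sat : G.f k (A j) ≤ G.f k (A k)

/-- Only the bundle of `j` can still change. -/
def Final (A P : Fin 3 → Finset (Fin m)) (τ : Equiv.Perm (Fin 3)) (j : Fin 3) : Prop :=
  ∀ y, τ y ≠ j → P y = A (τ y)

/-- No state in which `i` and `k` hold their final bundles and `i` does not envy `k`. -/
lemma Viol.false_of_tie {B : Finset (Fin m)} (H : G.Viol A j k) (I : G.QInfo A j k)
    (D : G.DState N p q (A G.i) B (A k) R a b c) (hca : c ≤ a) (hB : B ⊆ A j)
    (hR : R.Nonempty) (hp : p = k → G.f k B < G.f k (A k))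
    (small : ∀ g ∈ R, G.V (A k) + G.v g ≤ G.x) (large : G.x < G.V (A k) + G.V R) : False := by
  have h1 := H.val
  have hal : G.alt R < G.V R := alt_lt_V hR fun g hg => by linarith [small g hg]
  have hBk : ¬ G.f k (A k) < G.f k B := not_lt.2 ((G.f_mono k hB).trans I.sat)
  have hcov := cover H.hji H.hki H.hjk
  have hpi := D.lo.hpi
  have hqi := D.lo.hqi
  have hpq := D.lo.hpq
  by_cases hpk : p = k
  · subst hpk
    have hp := hp rfl
    have hpA := hp.trans I.free
    by_cases ns : G.NoSrc p q (A G.i) B (A p) a b c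
    · obtain ⟨M, hM, h | h | h⟩ := D.elim ns
      · exact not_lt.2 hca h.1
      · exact h.2.2.duel_envied hca (Or.inr I.free) (Or.inl hBk) (by linarith) (by linarith)
      · exact not_lt.2 hca h.1
    · exact ns ⟨Or.inl hpA, Or.inl D.ab, Or.inr hp⟩
  · have hqk : q = k := by
      rcases hcov p with h | h | h
      · exact (hpi h).elim
      · rcases hcov q with h' | h' | h'
        · exact (hqi h').elim
        · exact (hpq (h.trans h'.symm)).elim
        · exact h'
      · exact (hpk h).elim
    subst hqk
    exact D.duel_envied hca (Or.inr I.free) (Or.inl hBk) (by linarith) (by linarith)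

end Game
end ECE

namespace ECE

open scoped Classical
open Finset

namespace Game

variable {m N : ℕ} {G : Game m} {A P : Fin 3 → Finset (Fin m)} {R : Finset (Fin m)}
  {τ : Equiv.Perm (Fin 3)} {p q j k : Fin 3} {a b c K : ℝ}

/-- A state of the actual run in which `p` holds a part of the bundle of `j`, already worth more
than `x`, and raising the report of `i` for it does not lead to a win. -/
structure Fol (G : Game m) (A P : Fin 3 → Finset (Fin m)) (R : Finset (Fin m))
    (τ : Equiv.Perm (Fin 3)) (j p q : Fin 3) (K : ℝ) : Prop where
  run : G.Run A P R τ
  hpi : p ≠ G.i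
  hqi : q ≠ G.i
  hpq : p ≠ q
  label : τ p = j
  big : G.x < G.V (P p)
  far : G.x < G.V (A j) - G.V (P p)
  raised : G.Raised P R p K
  top : ∀ y, G.f G.i (A y) < K

/-- What is known as soon as the bundle of `j` is worth more than `x`. -/
structure Crossed (G : Game m) (A P : Fin 3 → Finset (Fin m)) (R : Finset (Fin m))
    (τ : Equiv.Perm (Fin 3)) (j k : Fin 3) : Prop where
  info : G.QInfo A j k
  final : Final A P τ j
  small : ∀ g ∈ R, G.V (A k) + G.v g ≤ G.x
  large : G.x < G.V (A k) + G.V R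

namespace Fol

lemma labels (F : G.Fol A P R τ j p q K) (H : G.Viol A j k) :
    (τ G.i = G.i ∧ τ q = k) ∨ (τ G.i = k ∧ τ q = G.i) := by
  have h1 := cover H.hji H.hki H.hjk (τ G.i)
  have h2 := cover H.hji H.hki H.hjk (τ q)
  have i1 : τ G.i ≠ τ q := fun h => F.hqi (τ.injective h).symm
  have i2 : τ p ≠ τ q := fun h => F.hpq (τ.injective h)
  have i3 : τ p ≠ τ G.i := fun h => F.hpi (τ.injective h)
  have h3 := F.label
  grind

lemma total (F : G.Fol A P R τ j p q K) (H : G.Viol A j k) :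
    G.V (P G.i) + G.V (P q) + G.V R = G.x + G.V (A k) + (G.V (A j) - G.V (P p)) := by
  have := F.run.total H F.hpi F.hqi F.hpq
  linarith

lemma two_lt (F : G.Fol A P R τ j p q K) (H : G.Viol A j k) :
    2 * G.x < G.V (P G.i) + G.V (P q) + G.V R := by
  have := F.total H
  have := F.far
  have := G.V_nonneg (A k)
  linarith

lemma own_lt (F : G.Fol A P R τ j p q K) (y : Fin 3) : G.own P y < K :=
  (G.f_mono _ (F.run.subset y).1).trans_lt (F.top _)

lemma dstate (F : G.Fol A P R τ j p q K) :
    ∃ N, G.DState N p q (P G.i) (P p) (P q) R (G.own P G.i) K (G.own P q) :=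
  F.raised.dstate F.hpi F.hqi F.hpq (F.own_lt _) (F.own_lt _) F.big

lemma V_rest (F : G.Fol A P R τ j p q K) : G.x < G.V R := by
  have h := (F.run.subset p).2
  rw [F.label] at h
  have := V_le_of_subset_union (G := G) h
  have := F.far
  linarith

lemma V_rest_sub (F : G.Fol A P R τ j p q K) {h : Fin m} (hR : h ∈ R) (hj : h ∉ A j) :
    G.x < G.V R - G.v h := by
  have hs := (F.run.subset p).2
  rw [F.label] at hs
  have : A j ⊆ P p ∪ R.erase h := fun u hu => by
    rcases Finset.mem_union.1 (hs hu) with h1 | h1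
    · exact Finset.mem_union_left _ h1
    · exact Finset.mem_union_right _ (Finset.mem_erase.2 ⟨fun e => hj (e ▸ hu), h1⟩)
  have := V_le_of_subset_union (G := G) this
  have := F.far
  have := G.V_erase hR
  linarith

lemma nonempty (F : G.Fol A P R τ j p q K) (H : G.Viol A j k) : R.Nonempty := by
  by_contra hR
  rw [Finset.not_nonempty_iff_eq_empty] at hR
  have := F.V_rest
  rw [hR, V_empty] at this
  exact absurd H.x_nonneg (not_le.2 this)

lemma V_label (F : G.Fol A P R τ j p q K) (y : Fin 3) : G.V (P y) ≤ G.V (A (τ y)) :=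
  G.V_mono (F.run.subset y).1

lemma le_of_tops (F : G.Fol A P R τ j p q K) {B C Γ X : Finset (Fin m)}
    (D : G.DState N p q X B C R a b c) (hca : c ≤ a) (sat : ¬ G.f q C < G.f q B)
    (hp : ¬ G.f p B < G.f p X) (hq : ¬ G.f q C < G.f q X)
    (S : 2 * G.x < G.V X + G.V C + G.V R) (hΓ : Γ ⊆ X ∪ R) (hj : Disjoint Γ (A j)) :
    G.f q Γ ≤ G.f q C ∧ G.f p Γ ≤ G.f p B := by
  have h0 := G.V_nonneg X
  refine D.le_of_tops hca sat hp hq S (by linarith [F.V_rest]) hΓ fun h hR hx hh => ?_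
  have := F.V_rest_sub hR (Finset.disjoint_left.1 hj hh)
  linarith

/-- The case in which `q` is satisfied and nobody is a source after raising. -/
lemma crossed_of_noSrc (F : G.Fol A P R τ j p q K) (H : G.Viol A j k)
    (D : G.DState N p q (P G.i) (P p) (P q) R (G.own P G.i) K (G.own P q))
    (sat : ¬ G.f q (P q) < G.f q (P p))
    (ns : G.NoSrc p q (P G.i) (P p) (P q) (G.own P G.i) K (G.own P q)) :
    G.Crossed A P R τ j k := by
  have hS := F.two_lt H
  have hT := F.total H
  have hx := H.x_nonneg
  have hf := F.far
  obtain ⟨M, hM, h | h | h⟩ := D.elim ns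
  swap; · exact (sat h.2.1).elim
  swap; · exact (sat h.2.1).elim
  obtain ⟨hac, hqA, D'⟩ := h
  have sat' : ¬ G.f q (P G.i) < G.f q (P p) := fun h => sat (hqA.trans h)
  have hqC : ¬ G.f q (P G.i) < G.f q (P q) := hqA.le.not_gt
  by_cases hp : G.f p (P p) < G.f p (P q)
  · exact (D'.false_of_holder_envies sat' hp hqC hac.le (F.nonempty H)).elim
  have hfree := D'.duel_free hp hqC (Or.inl sat') (by linarith)
  rw [imp_false, not_lt] at hfree
  have halt := G.alt_nonneg R
  rcases F.labels H with ⟨l1, l2⟩ | ⟨l1, l2⟩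
  · have hk := (F.run.subset q).2
    rw [l2] at hk
    have hkj := H.disj k j H.hjk.symm
    obtain ⟨g1, g2⟩ := F.le_of_tops D' hac.le sat' hp hqC (by linarith) hk hkj
    obtain ⟨e1, e2, e3, e4⟩ := F.run.persist H.hki F.hpi F.hqi F.hpq l1 l2 F.raised F.top hac hqA
      g1 g2 F.big
    subst e3
    refine ⟨⟨?_, ?_, ?_⟩, ?_, fun g hg => ?_, ?_⟩
    · rw [← e1, ← e2]; exact hac
    · rw [← e1, ← e2]; exact hqA
    · have : p = j := by
        rcases cover H.hji H.hki H.hjk p with h | h | h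
        exacts [(F.hpi h).elim, h, (F.hpq h).elim]
      rw [← this]; exact e4
    · intro y hy
      rcases cover F.hpi F.hqi F.hpq y with rfl | rfl | rfl
      · rw [l1]; exact e1
      · exact (hy F.label).elim
      · rw [l2]; exact e2
    · have := G.two_mul_le_alt hg
      rw [← e2]
      linarith
    · have := F.V_rest
      have := G.V_nonneg (A q)
      linarith
  · exfalso
    have h1 := F.V_label G.i
    rw [l1] at h1
    linarith [G.V_nonneg (P q)]

lemma false_of_free (F : G.Fol A P R τ j p q K) (H : G.Viol A j k)
    (D : G.DState N p q (P G.i) (P p) (P q) R (G.own P G.i) K (G.own P q))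
    (sat : ¬ G.f q (P q) < G.f q (P p)) (hp : ¬ G.f p (P p) < G.f p (P G.i))
    (hq : ¬ G.f q (P q) < G.f q (P G.i)) : False := by
  have hS := F.two_lt H
  have hT := F.total H
  have hf := F.far
  have h1 := F.V_label q
  have h0 := G.V_nonneg (P G.i)
  rcases F.labels H with ⟨l1, l2⟩ | ⟨l1, l2⟩
  · rw [l2] at h1
    have := G.alt_nonneg R
    exact D.duel_free hp hq (Or.inl sat) hS (by linarith)
  · rw [l2, H.val] at h1
    have hk := G.V_nonneg (A k)
    rcases lt_or_ge (G.own P G.i) (G.own P q) with hac | hac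
    · have := (D.phase_of_sat hac hp hq sat hS).1
      linarith
    · have hk := (F.run.subset G.i).2
      rw [l1] at hk
      obtain ⟨g1, g2⟩ := F.le_of_tops D hac sat hp hq hS hk (H.disj k j H.hjk.symm)
      refine H.hki (l1 ▸ F.run.eq_of_not_envied fun y hy => ?_)
      rw [l1]
      rcases cover F.hpi F.hqi F.hpq y with rfl | rfl | rfl
      exacts [(hy rfl).elim, g2, g1]

lemma false_of_envied (F : G.Fol A P R τ j p q K) (H : G.Viol A j k)
    (D : G.DState N p q (P G.i) (P p) (P q) R (G.own P G.i) K (G.own P q))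
    (sat : ¬ G.f q (P q) < G.f q (P p))
    (hs : G.f p (P p) < G.f p (P G.i) ∨ G.f q (P q) < G.f q (P G.i))
    (ns : ¬ G.NoSrc p q (P G.i) (P p) (P q) (G.own P G.i) K (G.own P q)) : False := by
  have hS := F.two_lt H
  have hT := F.total H
  have hf := F.far
  have hx := H.x_nonneg
  have hR := F.nonempty H
  have hca : G.own P q ≤ G.own P G.i := not_lt.1 fun h => ns ⟨hs, Or.inl D.ab, Or.inl h⟩
  have hpC : ¬ G.f p (P p) < G.f p (P q) := fun h => ns ⟨hs, Or.inl D.ab, Or.inr h⟩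
  by_cases hq : G.f q (P q) < G.f q (P G.i)
  swap
  · exact D.false_of_holder_envies sat (hs.resolve_right hq) hq hca hR
  obtain ⟨M, hM, h, hh, L⟩ := D.q_pick hR hs ns
  have D1 := L _ le_rfl D.cb
  have hab := D.ab
  obtain ⟨c', hc1, hc2⟩ := exists_between hab
  have D2 := L c' (hca.trans hc1.le) hc2
  have e1 := D.lo.V_C hh.1
  have e2 := G.V_erase hh.1
  have sat' : ¬ G.f q (insert h (P q)) < G.f q (P p) := fun h' =>
    sat ((G.f_mono q (Finset.subset_insert _ _)).trans_lt h')
  have S' : 2 * G.x < G.V (P G.i) + G.V (insert h (P q)) + G.V (R.erase h) := by linarith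
  by_cases hs' : G.f p (P p) < G.f p (P G.i) ∨ G.f q (insert h (P q)) < G.f q (P G.i)
  · exact D1.both_of_sat D2 hca hc1 hs' sat' S'
  rw [not_or] at hs'
  have src : IsSrc (envies G.b P) q := by
    rw [isSrc_iff F.hpi F.hqi F.hpq]
    exact ⟨not_lt.2 hca, hpC, lt_irrefl _⟩
  refine F.run.cases ?_ ?_ ?_
  · rintro - rfl - -
    exact Finset.not_nonempty_empty hR
  · intro σ τ' hns
    exact (hns ⟨q, src⟩).elim
  · intro y g hy hg r'
    have hyq : y = q := by
      rcases cover F.hpi F.hqi F.hpq y with rfl | rfl | rfl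
      · exact (hy.1 q hq).elim
      · have := (hasOut_iff F.hpi F.hqi F.hpq _).1 ((hy.2 q src).1 ⟨G.i, hq⟩)
        rcases this with h | h | h
        · exact (hs'.1 h).elim
        · exact (lt_irrefl _ h).elim
        · exact (hpC h).elim
      · rfl
    subst hyq
    have := hg.unique hh
    subst this
    have h1 := G.V_mono (r'.subset y).1
    rw [Function.update_self] at h1
    have h0 := G.V_nonneg (P G.i)
    have hk := G.V_nonneg (A k)
    have ha := G.alt_nonneg (R.erase g)
    rcases F.labels H with ⟨l1, l2⟩ | ⟨l1, l2⟩
    · rw [l2] at h1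
      exact D1.duel_free hs'.1 hs'.2 (Or.inl sat') S' (by linarith)
    · rw [l2, H.val] at h1
      have := (D2.phase_of_sat hc1 hs'.1 hs'.2 sat' S').1
      linarith

end Fol

end Game
end ECE

namespace ECE

open scoped Classical
open Finset

namespace Game

variable {m N : ℕ} {G : Game m} {A P : Fin 3 → Finset (Fin m)} {R : Finset (Fin m)}
  {τ : Equiv.Perm (Fin 3)} {p q j k : Fin 3} {a b c K : ℝ}

namespace Fol

lemma crossed_of_elim (F : G.Fol A P R τ j p q K)
    (hq : G.f q (P q) < G.f q (P p))
    (ns : ¬ ∃ y, IsSrc (G.Ed P (Function.update (G.own P) p K)) y)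
    (ih : ∀ σ τ' : Equiv.Perm (Fin 3), (¬ ∃ y, IsSrc (envies G.b P) y) →
      IsMinCyc (envies G.b P) σ → (∀ y, τ' y = τ (σ y)) → G.Run A (fun y => P (σ y)) R τ' →
      ∀ p' q', G.Fol A (fun y => P (σ y)) R τ' j p' q' K → G.Crossed A (fun y => P (σ y)) R τ' j k) :
    G.Crossed A P R τ j k := by
  obtain ⟨σ, hσ⟩ := exists_minCyc ns
  have hnw := F.raised.elim ns hσ
  have hEd := ed_raised (P := P) (K := K) F.hpi (F.own_lt _)
  by_cases top : σ G.i = p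
  · refine (hnw.false_of_top (fun y => ?_) ?_).elim
    · rw [top, Function.update_self]
      by_cases hy : σ y = p
      · rw [hy, Function.update_self]
      · rw [Function.update_of_ne hy]; exact (F.own_lt _).le
    · rw [top]; exact F.big
  have nsA : ¬ ∃ y, IsSrc (envies G.b P) y := by
    rintro ⟨y, hy⟩
    refine ns ⟨y, fun z hz => ?_⟩
    rcases (hEd z y).1 hz with h | ⟨-, rfl⟩
    · exact hy z h
    · exact hy q hq
  have hσA : IsMinCyc (envies G.b P) σ := by
    refine hσ.mono (fun y z h => (hEd y z).2 (Or.inl h)) fun y hy => ?_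
    rcases (hEd y (σ y)).1 (hσ.1.2 y hy) with h | ⟨rfl, h⟩
    · exact h
    · exact (top h).elim
  refine F.run.cases ?_ ?_ ?_
  · rintro - - - h
    exact (nsA h).elim
  · intro σ' τ' _ hσ' hτ' r'
    have := hσA.unique hσ'
    subst this
    have hp' : σ (σ.symm p) = p := σ.apply_symm_apply p
    have hpi' : σ.symm p ≠ G.i := fun h => top (by rw [← h]; exact hp')
    obtain ⟨q', hqi', hpq'⟩ := exists_others G.i (σ.symm p) hpi'
    have hF : G.Fol A (fun y => P (σ y)) R τ' j (σ.symm p) q' K := by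
      refine ⟨r', hpi', hqi', hpq', ?_, ?_, ?_, ?_, F.top⟩
      · rw [hτ', hp', F.label]
      · rw [hp']; exact F.big
      · rw [hp']; exact F.far
      · have : Function.update (G.own fun y => P (σ y)) (σ.symm p) K =
            fun y => Function.update (G.own P) p K (σ y) := by
          ext y
          by_cases hy : y = σ.symm p
          · subst hy; rw [hp']; simp
          · rw [Function.update_of_ne hy,
              Function.update_of_ne (fun h => hy (by rw [← h, σ.symm_apply_apply]))]
            rfl
        unfold Raised
        rw [this]; exact hnw
    have C := ih σ τ' nsA hσA hτ' r' _ _ hF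
    refine ⟨C.info, fun y hy => ?_, C.small, C.large⟩
    have := C.final (σ.symm y)
    rw [hτ', σ.apply_symm_apply] at this
    simpa using this hy
  · intro y _ hy
    exact (nsA ⟨y, hy.1⟩).elim

lemma false_of_same_pick (F : G.Fol A P R τ j p q K) (H : G.Viol A j k) {y : Fin 3} {g : Fin m}
    (hyp : y ≠ p) (hy : IsPick (G.Ed P (Function.update (G.own P) p K)) y) (hg : G.Top y R g)
    (r' : G.Run A (Function.update P y (insert g (P y))) (R.erase g) τ)
    (ih : G.Fol A (Function.update P y (insert g (P y))) (R.erase g) τ j p q K →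
      G.Crossed A (Function.update P y (insert g (P y))) (R.erase g) τ j k) : False := by
  have hnw : ∀ c ≥ G.own P y, G.NW (Function.update P y (insert g (P y))) (R.erase g)
      (Function.update (Function.update (G.own P) p K) y c) := fun c hc =>
    F.raised.pick hy hg.1 (fun _ => hg.2) (by rwa [Function.update_of_ne hyp])
  have F' : G.Fol A (Function.update P y (insert g (P y))) (R.erase g) τ j p q K := by
    refine ⟨r', F.hpi, F.hqi, F.hpq, F.label, ?_, ?_, ?_, F.top⟩
    · rw [Function.update_of_ne hyp.symm]; exact F.big
    · rw [Function.update_of_ne hyp.symm]; exact F.far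
    · unfold Raised
      rw [own_update, Function.update_comm hyp]
      exact hnw _ (G.f_mono _ (Finset.subset_insert _ _))
  have C := ih F'
  have hR' := F'.nonempty H
  have eB : Function.update P y (insert g (P y)) p = P p := Function.update_of_ne hyp.symm _ _
  have hsub := (F.run.subset p).1
  rw [F.label] at hsub
  have hp : p = k → G.f k (P p) < G.f k (A k) := by
    rintro rfl
    exact F.run.own_lt (by rw [F.label]; exact H.hjk)
  rcases F.labels H with ⟨l1, l2⟩ | ⟨l1, l2⟩
  · have ei := C.final G.i (by rw [l1]; exact H.hji.symm)
    have eq := C.final q (by rw [l2]; exact H.hjk.symm)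
    rw [l1] at ei
    rw [l2] at eq
    rcases cover F.hpi F.hqi F.hpq y with rfl | rfl | rfl
    · have hk : P q = A k := by rw [← eq, Function.update_of_ne F.hqi]
      have h1 : G.own P G.i ≤ G.f G.i (A k) := (F.run.own_le _).trans C.info.own.le
      obtain ⟨N, L⟩ := (hnw (G.f G.i (A k)) h1).lo F.hpi F.hqi F.hpq
      rw [ei, eq, eB, Function.update_self, Function.update_of_ne F.hpi,
        Function.update_of_ne F.hqi, Function.update_self, Function.update_of_ne F.hpq.symm] at L
      have D : G.DState N p q _ _ _ _ _ _ _ := ⟨L, F.top k, F.own_lt q, F.big⟩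
      exact H.false_of_tie C.info D (by unfold own; rw [hk]) hsub hR' hp C.small C.large
    · exact hyp rfl
    · have hca : G.own P y ≤ G.own P G.i := by
        have := hy.1 G.i
        rw [ed_raised F.hpi (F.own_lt _)] at this
        exact not_lt.1 fun h => this (Or.inl h)
      obtain ⟨N, L⟩ := (hnw _ le_rfl).lo F.hpi F.hqi F.hpq
      rw [ei, eq, eB, Function.update_self, Function.update_of_ne F.hpq,
        Function.update_of_ne F.hqi.symm, Function.update_self,
        Function.update_of_ne F.hpi.symm] at L
      have D : G.DState N p y _ _ _ _ _ _ _ := ⟨L, F.own_lt _, F.own_lt y, F.big⟩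
      exact H.false_of_tie C.info D hca hsub hR' hp C.small C.large
  · have ei := C.final G.i (by rw [l1]; exact H.hjk.symm)
    have := r'.own_lt (y := G.i) (by rw [l1]; exact H.hki)
    rw [ei, l1] at this
    exact lt_asymm this C.info.own

lemma false_of_other_pick (F : G.Fol A P R τ j p q K) (H : G.Viol A j k) {y z : Fin 3}
    {g : Fin m} (hq : G.f q (P q) < G.f q (P p))
    (hz : IsPick (G.Ed P (Function.update (G.own P) p K)) z) (hyz : y ≠ z)
    (hy : IsPick (envies G.b P) y) (hg : G.Top y R g)
    (r' : G.Run A (Function.update P y (insert g (P y))) (R.erase g) τ) : False := by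
  have hEd := ed_raised (P := P) (K := K) F.hpi (F.own_lt _)
  have sz : IsSrc (envies G.b P) z := fun u hu => hz.1 u ((hEd u z).2 (Or.inl hu))
  have sy : IsSrc (G.Ed P (Function.update (G.own P) p K)) y := fun u hu => by
    rcases (hEd u y).1 hu with h | ⟨-, rfl⟩
    · exact hy.1 u h
    · exact hy.1 q hq
  have oq : HasOut (envies G.b P) q := ⟨p, hq⟩
  have oq' : HasOut (G.Ed P (Function.update (G.own P) p K)) q := ⟨p, (hEd q p).2 (Or.inl hq)⟩
  have oi' : HasOut (G.Ed P (Function.update (G.own P) p K)) G.i :=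
    ⟨p, (hEd _ _).2 (Or.inr ⟨rfl, rfl⟩)⟩
  have np : ∀ u, IsSrc (envies G.b P) u → u ≠ p := by
    rintro u hu rfl
    exact hu q hq
  have key : y = q ∧ z = G.i ∧ G.i < q := by
    have h1 := (hy.2 z sz)
    have h2 := (hz.2 y sy)
    rcases cover F.hpi F.hqi F.hpq y with rfl | rfl | rfl
    · rcases cover F.hpi F.hqi F.hpq z with rfl | rfl | rfl
      · exact (hyz rfl).elim
      · exact (np _ sz rfl).elim
      · exact absurd (le_antisymm (h1.2 fun _ => oq) (h2.2 fun _ => oi')) hyz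
    · exact (np _ hy.1 rfl).elim
    · rcases cover F.hpi F.hqi F.hpq z with rfl | rfl | rfl
      · exact ⟨rfl, rfl, lt_of_le_of_ne (h2.2 fun _ => oq') F.hqi.symm⟩
      · exact (np _ sz rfl).elim
      · exact (hyz rfl).elim
  obtain ⟨rfl, rfl, hlt⟩ := key
  obtain ⟨N, D⟩ := F.dstate
  have hca : G.own P y ≤ G.own P G.i := not_lt.1 fun h => hy.1 G.i h
  have hpC : ¬ G.f p (P p) < G.f p (P y) := hy.1 p
  have hpA : ¬ G.f p (P p) < G.f p (P G.i) := sz p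
  have hqA : ¬ G.f y (P y) < G.f y (P G.i) := sz y
  have hS := F.two_lt H
  have hT := F.total H
  have hf := F.far
  have e1 := D.lo.V_C hg.1
  have e2 := G.V_erase hg.1
  have h0 := G.V_nonneg (P G.i)
  have hk := G.V_nonneg (A k)
  rcases F.labels H with ⟨l1, l2⟩ | ⟨l1, l2⟩
  · have h1 := F.V_label y
    rw [l2] at h1
    have := G.alt_nonneg R
    exact D.duel_free hpA hqA (Or.inr hlt) hS (by linarith)
  · have h1 := G.V_mono (r'.subset y).1
    rw [Function.update_self, l2, H.val] at h1
    exact D.false_of_late hca (Or.inr hlt) hpC hS hg (by linarith)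

lemma crossed (F : G.Fol A P R τ j p q K) (H : G.Viol A j k) : G.Crossed A P R τ j k := by
  have main := F.run.induction (motive := fun P R τ => ∀ p q, G.Fol A P R τ j p q K →
    G.Crossed A P R τ j k) ?_
  · exact main p q F
  clear F
  intro P R τ r ihe ihp p q F
  by_cases hq : G.f q (P q) < G.f q (P p)
  · by_cases ns : ∃ y, IsSrc (G.Ed P (Function.update (G.own P) p K)) y
    · exfalso
      obtain ⟨z, hz⟩ := exists_isPick ns
      have hsrc : ∃ y, IsSrc (envies G.b P) y :=
        ⟨z, fun u hu => hz.1 u ((ed_raised F.hpi (F.own_lt _) u z).2 (Or.inl hu))⟩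
      refine r.cases ?_ ?_ ?_
      · rintro - rfl - -
        exact Finset.not_nonempty_empty (F.nonempty H)
      · intro σ τ' hns
        exact (hns hsrc).elim
      · intro y g hy hg r'
        by_cases hyz : y = z
        · subst hyz
          refine F.false_of_same_pick H ?_ hz hg r' (ihp y g hy hg r' p q)
          rintro rfl
          exact hy.1 q hq
        · exact F.false_of_other_pick H hq hz hyz hy hg r'
    · exact F.crossed_of_elim hq ns ihe
  · obtain ⟨N, D⟩ := F.dstate
    by_cases ns : G.NoSrc p q (P G.i) (P p) (P q) (G.own P G.i) K (G.own P q)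
    · exact F.crossed_of_noSrc H D hq ns
    · exfalso
      by_cases hs : G.f p (P p) < G.f p (P G.i) ∨ G.f q (P q) < G.f q (P G.i)
      · exact F.false_of_envied H D hq hs ns
      · rw [not_or] at hs
        exact F.false_of_free H D hq hs.1 hs.2

end Fol

end Game
end ECE

namespace ECE

open scoped Classical
open Finset

namespace Game

variable {m : ℕ} {G : Game m} {N : ℕ} {p q : Fin 3} {A B C R : Finset (Fin m)} {a b c : ℝ}

lemma exists_pos_of_V_pos (h : 0 < G.V R) : ∃ g ∈ R, 0 < G.v g := by
  by_contra! h'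
  exact not_lt.2 (Finset.sum_nonpos h') h

lemma Top.pref_le {n : Fin m} {g : Fin m} (hg : G.Top p R g) (hB : G.V B ≤ G.x)
    (h : G.x < G.V B + G.V {u ∈ R | (G.b p).pref u ≤ n}) : (G.b p).pref g ≤ n := by
  obtain ⟨w, hw, -⟩ := exists_pos_of_V_pos (G := G)
    (R := {u ∈ R | (G.b p).pref u ≤ n}) (by linarith)
  have hw' := mem_filter.1 hw
  exact (hg.2 w hw'.1).trans hw'.2

lemma filter_lt_erase {n : Fin m} {g : Fin m} (hgn : (G.b p).pref g ≤ n) :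
    ({u ∈ R.erase g | n < (G.b p).pref u} : Finset (Fin m)) = {u ∈ R | n < (G.b p).pref u} := by
  ext u
  simp only [mem_filter, mem_erase]
  refine ⟨fun h => ⟨h.1.2, h.2⟩, fun h => ⟨⟨?_, h.1⟩, h.2⟩⟩
  rintro rfl
  exact not_lt.2 hgn h.2

lemma Lo.sat_pick (L : G.Lo N p q A B C R a b c) (sat : G.f q B + G.f q R ≤ G.f q C) {g : Fin m}
    (hg : g ∈ R) : G.f q (insert g B) + G.f q (R.erase g) ≤ G.f q C := by
  rw [L.f_B hg, G.f_erase q hg]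
  linarith

lemma not_lt_of_sat (sat : G.f q B + G.f q R ≤ G.f q C) : ¬ G.f q C < G.f q B := by
  linarith [G.f_nonneg q R]

/-- A rival who envies nobody but is envied by `i` cannot be followed by a run of picks of `p`
that leaves too much. -/
lemma Lo.false_of_free_rival (L : G.Lo N p q A B C R a b c) (hA : G.V A = G.x)
    (hB : G.V B ≤ G.x) (hac : a < c) (hba : b ≤ a) (hq : ¬ G.f q C < G.f q A)
    (sat : G.f q B + G.f q R ≤ G.f q C) {t : ℝ} {h n : Fin m} {S : Finset (Fin m)}
    (ht : t ≤ G.x) (tot : 2 * G.x < G.V B + t + G.V R) (small : ∀ u ∈ S, t + G.v u ≤ G.x)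
    (large : G.x < t + G.V S) (rk : ∀ w ∈ S, n < (G.b p).pref w)
    (rk' : ∀ u ∈ R, u ∉ S → (G.b p).pref u ≤ n)
    (inv : ∀ w ∈ S, w = h ∨ w ∈ R ∨ ∀ u ∈ R, (G.b p).pref w ≤ (G.b p).pref u) : False := by
  induction N using Nat.strong_induction_on generalizing B R b with
  | _ N ih =>
  have hqp := not_lt_of_sat sat
  obtain ⟨g₀, hg₀, hv₀⟩ := exists_pos_of_V_pos (G := G) (R := R) (by linarith)
  obtain ⟨M, hM, K | K | K⟩ := L.pick ⟨g₀, hg₀⟩ (fun ns => ns.2.1.elim (not_lt.2 hba) hqp)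
  · have e := L.V_A hg₀
    exact (K.2.2.2.2 g₀ hg₀ c hac.le).false_of_top (hba.trans hac.le) le_rfl (by linarith)
  · obtain ⟨-, -, -, -, g, hg, K⟩ := K
    have e1 := L.V_B hg.1
    have e2 := G.V_erase hg.1
    have sat' := L.sat_pick sat hg.1
    by_cases hB' : G.V (insert g B) ≤ G.x
    · refine ih M hM (K b le_rfl) hB' hba sat' (by linarith)
        (fun u hu => rk' u (mem_of_mem_erase hu)) fun w hw => ?_
      rcases inv w hw with h1 | h1 | h1
      · exact Or.inl h1
      · by_cases hwg : w = g
        · exact Or.inr (Or.inr fun u hu => hwg ▸ hg.2 u (mem_of_mem_erase hu))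
        · exact Or.inr (Or.inl (mem_erase.2 ⟨hwg, h1⟩))
      · exact Or.inr (Or.inr fun u hu => h1 u (mem_of_mem_erase hu))
    · have L' := K c (hba.trans hac.le)
      have hqp' := not_lt_of_sat sat'
      by_cases hp : G.f p (insert g B) < G.f p A
      · obtain ⟨M', -, k | k | k | k | k⟩ := L'.elim ⟨Or.inl hp, Or.inl hac, Or.inl hac⟩
        · exact k.2.2.false_of_top hac.le le_rfl (not_le.1 hB')
        · exact hq k.2.1
        · exact hqp' k.2.1
        · exact hq k.2.2.1
        · exact hqp' k.2.1
      · rcases (G.V_nonneg (R.erase g)).eq_or_lt with h0 | h0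
        · have hgS : g ∉ S := fun hgS => by linarith [small g hgS]
          have hn := rk' g hg.1 hgS
          have hS : ∀ w ∈ S, w = h ∨ w ∈ R.erase g := fun w hw => by
            rcases inv w hw with h1 | h1 | h1
            · exact Or.inl h1
            · exact Or.inr (mem_erase.2 ⟨fun e => hgS (e ▸ hw), h1⟩)
            · exact absurd (rk w hw) (not_lt.2 ((h1 g hg.1).trans hn))
          by_cases hh : h ∈ S
          · have e3 : G.V (S.erase h) ≤ G.V (R.erase g) := G.V_mono fun w hw =>
              (hS w (mem_of_mem_erase hw)).resolve_left (mem_erase.1 hw).1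
            linarith [G.V_erase hh, small h hh]
          · have e3 : G.V S ≤ G.V (R.erase g) := G.V_mono fun w hw =>
              (hS w hw).resolve_left fun e => hh (e ▸ hw)
            linarith
        · obtain ⟨u, hu, hvu⟩ := exists_pos_of_V_pos h0
          have e := L'.V_A hu
          obtain ⟨M', -, k | k | k⟩ := L'.pick ⟨u, hu⟩ (fun ns => ns.1.elim hp hq)
          · exact (k.2.2.2.2 u hu c hac.le).false_of_top le_rfl le_rfl (by linarith)
          · exact k.1 hac
          · exact k.1 hac
  · exact K.1 hac

lemma Lo.false_of_big_rival (L : G.Lo N p q A B C R a b c) (hB : G.V B ≤ G.x) (hC : G.x < G.V C)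
    (hac : a < c) (hba : b ≤ a) (hq : G.f q C < G.f q A) (sat : G.f q B + G.f q R ≤ G.f q C)
    (tot : G.x < G.V B + G.V R) : False := by
  induction N using Nat.strong_induction_on generalizing B R b with
  | _ N ih =>
  have hqp := not_lt_of_sat sat
  obtain ⟨g₀, hg₀, hv₀⟩ := exists_pos_of_V_pos (G := G) (R := R) (by linarith)
  obtain ⟨M, hM, K | K | K⟩ := L.pick ⟨g₀, hg₀⟩ (fun ns => ns.2.1.elim (not_lt.2 hba) hqp)
  · exact K.2.1 hq
  · obtain ⟨-, -, -, -, g, hg, K⟩ := K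
    have e1 := L.V_B hg.1
    have e2 := G.V_erase hg.1
    have sat' := L.sat_pick sat hg.1
    by_cases hB' : G.V (insert g B) ≤ G.x
    · exact ih M hM (K b le_rfl) hB' hba sat' (by linarith)
    · have hqp' := not_lt_of_sat sat'
      obtain ⟨M', -, k | k | k | k | k⟩ :=
        (K c (hba.trans hac.le)).elim ⟨Or.inr hq, Or.inl hac, Or.inl hac⟩
      · exact k.2.2.false_of_top hac.le le_rfl (not_le.1 hB')
      · exact k.2.2.false_of_top le_rfl hac.le hC
      · exact hqp' k.2.1
      · exact k.2.2.2.false_of_top le_rfl hac.le (not_le.1 hB')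
      · exact hqp' k.2.1
  · exact K.1 hac

/-- The list of `p` splits `R` at some good into a part that makes `B` valuable and a part that
makes `C` valuable, no good of the latter sufficing on its own. -/
def Split (G : Game m) (p : Fin 3) (B C R : Finset (Fin m)) : Prop :=
  ∃ n, G.x < G.V B + G.V {u ∈ R | (G.b p).pref u ≤ n} ∧
    G.x < G.V C + G.V {u ∈ R | n < (G.b p).pref u} ∧
    ∀ u ∈ R, n < (G.b p).pref u → G.V C + G.v u ≤ G.x

lemma V_filter_add (p : Fin 3) (R : Finset (Fin m)) (n : Fin m) :
    G.V {u ∈ R | (G.b p).pref u ≤ n} + G.V {u ∈ R | n < (G.b p).pref u} = G.V R := by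
  have := Finset.sum_filter_add_sum_filter_not R (fun u => (G.b p).pref u ≤ n) G.v
  simp only [not_le] at this
  exact this

lemma Lo.split (L : G.Lo N p q A B C R a b c) (hA : G.V A = G.x) (hB : G.V B ≤ G.x)
    (hC : G.V C ≤ G.x) (hac : a < c) (hba : b ≤ a) (hq : G.f q C < G.f q A)
    (sat : G.f q B + G.f q R ≤ G.f q C) (tot : 2 * G.x < G.V B + G.V C + G.V R)
    (big : ∀ g ∈ R, 2 * G.x + G.v g < G.V B + G.V C + G.V R) : G.Split p B C R := by
  induction N using Nat.strong_induction_on generalizing B R b with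
  | _ N ih =>
  have hqp := not_lt_of_sat sat
  obtain ⟨g₀, hg₀, hv₀⟩ := exists_pos_of_V_pos (G := G) (R := R) (by linarith)
  obtain ⟨M, hM, K | K | K⟩ := L.pick ⟨g₀, hg₀⟩ (fun ns => ns.2.1.elim (not_lt.2 hba) hqp)
  · exact absurd hq K.2.1
  · obtain ⟨-, -, -, -, g, hg, K⟩ := K
    have e1 := L.V_B hg.1
    have e2 := G.V_erase hg.1
    have sat' := L.sat_pick sat hg.1
    by_cases hB' : G.V (insert g B) ≤ G.x
    · obtain ⟨n, h1, h2, h3⟩ := ih M hM (K b le_rfl) hB' hba sat' (by linarith)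
        fun u hu => by linarith [big u (mem_of_mem_erase hu)]
      obtain ⟨w, hw, -⟩ := exists_pos_of_V_pos (G := G)
        (R := {u ∈ R.erase g | (G.b p).pref u ≤ n}) (by linarith)
      have hw' := mem_filter.1 hw
      have hgn := (hg.2 w (mem_of_mem_erase hw'.1)).trans hw'.2
      have f1 := V_filter_add (G := G) p R n
      have f2 := V_filter_add (G := G) p (R.erase g) n
      rw [filter_lt_erase hgn] at h2 f2
      refine ⟨n, by linarith, h2, fun u hu hun => h3 u (mem_erase.2 ⟨?_, hu⟩) hun⟩
      rintro rfl
      exact not_lt.2 hgn hun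
    · have hbig := big g hg.1
      have hqp' := not_lt_of_sat sat'
      have hcc : c < c + 1 := by linarith
      have L' := K (c + 1) (by linarith)
      have D : G.DState M p q A (insert g B) C (R.erase g) a (c + 1) c :=
        ⟨L', hac.trans hcc, hcc, not_le.1 hB'⟩
      obtain ⟨M', -, k | k | k⟩ := D.elim ⟨Or.inr hq, Or.inl D.ab, Or.inl hac⟩
      · have D' := k.2.2
        have hR' : (R.erase g).Nonempty := by
          obtain ⟨u, hu, -⟩ := exists_pos_of_V_pos (G := G) (R := R.erase g) (by linarith)
          exact ⟨u, hu⟩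
        have hqA : ¬ G.f q A < G.f q C := hq.le.not_gt
        have hqB : ¬ G.f q A < G.f q (insert g B) := by linarith
        have hpC : ¬ G.f p (insert g B) < G.f p C := fun h =>
          D'.false_of_holder_envies hqB h hqA hac.le hR'
        have hv : 2 * G.V C + G.V (R.erase g) + G.alt (R.erase g) ≤ 2 * G.x := by
          by_contra! hv
          exact D'.duel_free hpC hqA (Or.inl hqB) (by linarith) (by linarith)
        have f3 : ∀ u ∈ R, (G.b p).pref u ≤ (G.b p).pref g → u = g := fun u hu hug =>
          (G.b p).pref.injective (hug.antisymm (hg.2 u hu))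
        refine ⟨(G.b p).pref g, ?_, ?_, fun u hu hun => ?_⟩
        · have : G.v g ≤ G.V {u ∈ R | (G.b p).pref u ≤ (G.b p).pref g} :=
            G.le_V (mem_filter.2 ⟨hg.1, le_rfl⟩)
          linarith
        · have : G.V (R.erase g) ≤ G.V {u ∈ R | (G.b p).pref g < (G.b p).pref u} :=
            G.V_mono fun u hu => mem_filter.2 ⟨mem_of_mem_erase hu,
              not_le.1 fun h => (mem_erase.1 hu).1 (f3 u (mem_of_mem_erase hu) h)⟩
          linarith
        · have := two_mul_le_alt (G := G) (mem_erase.2 ⟨fun e => hun.ne (e ▸ rfl), hu⟩ :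
            u ∈ R.erase g)
          linarith
      · exact absurd k.2.1 hqp'
      · exact absurd k.2.1 hqp'
  · exact absurd hac K.1

end Game
end ECE

namespace ECE

open scoped Classical
open Finset

namespace Game

variable {m : ℕ} {G : Game m} {N : ℕ} {p q : Fin 3} {A B C R : Finset (Fin m)} {a b c : ℝ}

lemma Lo.false_of_split (L : G.Lo N p q A B C R a b c) (hA : G.V A = G.x) (hB : G.V B ≤ G.x)
    (hC : G.V C ≤ G.x) (hba : b ≤ a) (hca : c ≤ a)
    (sat : G.f q B + G.f q R ≤ G.f q C) (tot : 2 * G.x < G.V B + G.V C + G.V R)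
    (big : ∀ g ∈ R, 2 * G.x + G.v g < G.V B + G.V C + G.V R) (sp : G.Split p B C R) : False := by
  induction N using Nat.strong_induction_on generalizing B C R b c with
  | _ N ih =>
  have hqp := not_lt_of_sat sat
  obtain ⟨n, s1, s2, s3⟩ := sp
  obtain ⟨g₀, hg₀, hv₀⟩ := exists_pos_of_V_pos (G := G) (R := R) (by linarith)
  obtain ⟨M, hM, K | K | K⟩ := L.pick ⟨g₀, hg₀⟩ (fun ns => ns.2.1.elim (not_lt.2 hba) hqp)
  · have e := L.V_A hg₀
    exact (K.2.2.2.2 g₀ hg₀ a le_rfl).false_of_top hba hca (by linarith)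
  · obtain ⟨-, -, -, -, g, hg, K⟩ := K
    have e1 := L.V_B hg.1
    have e2 := G.V_erase hg.1
    have sat' := L.sat_pick sat hg.1
    have hqp' := not_lt_of_sat sat'
    have hgn := Top.pref_le hg hB s1
    have f1 := V_filter_add (G := G) p R n
    have f2 := V_filter_add (G := G) p (R.erase g) n
    rw [← filter_lt_erase hgn] at s2 f1
    by_cases hB' : G.V (insert g B) ≤ G.x
    · exact ih M hM (K b le_rfl) hB' hC hba hca sat' (by linarith)
        (fun u hu => by linarith [big u (mem_of_mem_erase hu)])
        ⟨n, by linarith, s2, fun u hu => s3 u (mem_of_mem_erase hu)⟩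
    · have hR' : ∀ u ∈ R.erase g, G.v u < G.V (R.erase g) := fun u hu => by
        by_cases hun : n < (G.b p).pref u
        · have := s3 u (mem_of_mem_erase hu) hun
          have := G.V_nonneg {u ∈ R.erase g | (G.b p).pref u ≤ n}
          linarith
        · have : G.v u ≤ G.V {u ∈ R.erase g | (G.b p).pref u ≤ n} :=
            G.le_V (mem_filter.2 ⟨hu, not_lt.1 hun⟩)
          linarith
      have h0 := G.V_nonneg {u ∈ R.erase g | (G.b p).pref u ≤ n}
      obtain ⟨u, hu, -⟩ := exists_pos_of_V_pos (G := G) (R := R.erase g) (by linarith)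
      have halt := alt_lt_V (G := G) ⟨u, hu⟩ hR'
      have haa : a < a + 1 := by linarith
      have D : G.DState M p q A (insert g B) C (R.erase g) a (a + 1) c :=
        ⟨K (a + 1) (by linarith), haa, hca.trans_lt haa, not_le.1 hB'⟩
      by_cases hs : G.f p (insert g B) < G.f p A ∨ G.f q C < G.f q A
      · exact D.duel_envied hca hs (Or.inl hqp') (by linarith) (by linarith)
      · rw [not_or] at hs
        exact D.duel_free hs.1 hs.2 (Or.inl hqp') (by linarith)
          (by linarith [alt_nonneg (G := G) (R.erase g)])
  · obtain ⟨-, -, -, -, g, hg, K⟩ := K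
    have e1 := L.V_C hg.1
    have e2 := G.V_erase hg.1
    have e3 := L.f_C hg.1 q
    have e4 := G.f_erase q hg.1
    have e5 := (G.b q).nonneg g
    have sat' : G.f q B + G.f q (R.erase g) ≤ G.f q (insert g C) := by linarith
    have hbig := big g hg.1
    have haa : a < a + 1 := by linarith
    have L' := K (a + 1) (by linarith)
    by_cases hq : G.f q (insert g C) < G.f q A
    · by_cases hC' : G.V (insert g C) ≤ G.x
      · have tot' : 2 * G.x < G.V B + G.V (insert g C) + G.V (R.erase g) := by linarith
        have big' : ∀ u ∈ R.erase g,
            2 * G.x + G.v u < G.V B + G.V (insert g C) + G.V (R.erase g) :=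
          fun u hu => by linarith [big u (mem_of_mem_erase hu)]
        exact ih M hM (K c le_rfl) hB hC' hba hca sat' tot' big'
          (L'.split hA hB hC' haa hba hq sat' tot' big')
      · exact L'.false_of_big_rival hB (not_le.1 hC') haa hba hq sat' (by linarith)
    · refine L'.false_of_free_rival hA hB haa hba hq sat' (t := G.V C) (h := g) (n := n)
        (S := {u ∈ R | n < (G.b p).pref u}) hC (by linarith)
        (fun u hu => s3 u (mem_filter.1 hu).1 (mem_filter.1 hu).2) s2
        (fun w hw => (mem_filter.1 hw).2) (fun u hu huS => ?_) fun w hw => ?_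
      · by_contra! h
        exact huS (mem_filter.2 ⟨mem_of_mem_erase hu, h⟩)
      · by_cases hwg : w = g
        · exact Or.inl hwg
        · exact Or.inr (Or.inl (mem_erase.2 ⟨hwg, (mem_filter.1 hw).1⟩))

end Game
end ECE

namespace ECE

open scoped Classical
open Finset

namespace Game

variable {m : ℕ} {G : Game m} {A P : Fin 3 → Finset (Fin m)} {R : Finset (Fin m)}
  {τ : Equiv.Perm (Fin 3)} {p q j k : Fin 3} {w : ℝ} {g : Fin m}

lemma ed_of_ne {ω : Fin 3 → ℝ} {y z : Fin 3} (hy : y ≠ G.i) :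
    G.Ed P ω y z ↔ envies G.b P y z := by
  simp only [Ed, Env, hy, if_false]
  exact Iff.rfl

lemma ed_i {ω : Fin 3 → ℝ} {z : Fin 3} : G.Ed P ω G.i z ↔ ω G.i < ω z := by
  simp [Ed, Env]

lemma exists_bound (A : Fin 3 → Finset (Fin m)) (w : ℝ) : ∃ K, w < K ∧ ∀ y, G.f G.i (A y) < K := by
  refine ⟨|w| + ∑ y, G.f G.i (A y) + 1, ?_, fun y => ?_⟩
  · have := Finset.sum_nonneg fun y (_ : y ∈ univ) => G.f_nonneg G.i (A y)
    linarith [le_abs_self w]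
  · have := Finset.single_le_sum (fun y _ => G.f_nonneg G.i (A y)) (mem_univ y)
    linarith [abs_nonneg w]

/-- The pick that makes the bundle of `j` too good for `i`. -/
lemma Run.crossed_of_pick (r : G.Run A P R τ)
    (r' : G.Run A (Function.update P p (insert g (P p))) (R.erase g) τ) (H : G.Viol A j k)
    (hp : IsPick (envies G.b P) p) (hg : G.Top p R g) (hpi : p ≠ G.i) (label : τ p = j)
    (hx : G.V (P p) ≤ G.x) (hx' : G.x < G.V (insert g (P p))) :
    G.Crossed A (Function.update P p (insert g (P p))) (R.erase g) τ j k ∧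
      (R.erase g).Nonempty := by
  obtain ⟨q, hqi, hpq⟩ := exists_others G.i p hpi
  obtain ⟨K, -, hK⟩ := exists_bound (G := G) A 0
  have hgj := (r'.subset p).1
  rw [Function.update_self, label] at hgj
  have e := G.V_insert (not_mem_of_disjoint (r.nw.1 p) hg.1)
  have F : G.Fol A (Function.update P p (insert g (P p))) (R.erase g) τ j p q K := by
    refine ⟨r', hpi, hqi, hpq, label, ?_, ?_, ?_, hK⟩
    · rwa [Function.update_self]
    · rw [Function.update_self]
      linarith [H.big g (hgj (mem_insert_self _ _))]
    · rw [← ed_own] at hp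
      have := r.nw.pick hp hg.1 (fun _ => hg.2) (c := K)
        ((G.f_mono _ (r.subset p).1).trans_lt (hK _)).le
      unfold Raised
      rwa [own_update, Function.update_idem]
  exact ⟨F.crossed H, F.nonempty H⟩

lemma Final.eq_of_pick (h : Final A P τ j) (r : G.Run A P R τ) {y : Fin 3} (hg : g ∈ R)
    (r' : G.Run A (Function.update P y (insert g (P y))) (R.erase g) τ) : τ y = j := by
  by_contra hy
  have := (r'.subset y).1
  rw [Function.update_self, ← h y hy] at this
  exact not_mem_of_disjoint (r.nw.1 y) hg (this (mem_insert_self _ _))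

lemma Final.elim (h : Final A P τ j) {σ τ' : Equiv.Perm (Fin 3)} (hτ' : ∀ y, τ' y = τ (σ y)) :
    Final A (fun y => P (σ y)) τ' j := fun y hy => by
  rw [hτ'] at hy ⊢
  exact h _ hy

lemma Final.pick (h : Final A P τ j) {y : Fin 3} (hy : τ y = j) :
    Final A (Function.update P y (insert g (P y))) τ j := fun z hz => by
  rw [Function.update_of_ne (by rintro rfl; exact hz hy)]
  exact h z hz

/-- The labels that can occur once only the bundle of `j` changes. -/
lemma Final.labels (h : Final A P τ j) (r : G.Run A P R τ) (H : G.Viol A j k) (I : G.QInfo A j k) :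
    (τ G.i = G.i ∧ τ j = j ∧ τ k = k) ∨ (τ G.i = G.i ∧ τ j = k ∧ τ k = j) ∨
      (τ G.i = j ∧ τ j = G.i ∧ τ k = k) := by
  have h1 : τ k ≠ G.i := fun e => by
    have := r.own_lt (y := k) (by rw [e]; exact H.hki.symm)
    rw [h k (by rw [e]; exact H.hji.symm), e] at this
    exact this.not_gt I.free
  have h2 : τ G.i ≠ k := fun e => by
    have := r.own_lt (y := G.i) (by rw [e]; exact H.hki)
    rw [h G.i (by rw [e]; exact H.hjk.symm), e] at this
    exact this.not_gt I.own
  have c1 := cover H.hji H.hki H.hjk (τ G.i)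
  have c2 := cover H.hji H.hki H.hjk (τ j)
  have c3 := cover H.hji H.hki H.hjk (τ k)
  have i1 : τ G.i ≠ τ j := fun e => H.hji (τ.injective e).symm
  have i2 : τ G.i ≠ τ k := fun e => H.hki (τ.injective e).symm
  have i3 : τ j ≠ τ k := fun e => H.hjk (τ.injective e)
  grind

lemma Final.le_own (h : Final A P τ j) (r : G.Run A P R τ) (H : G.Viol A j k) (I : G.QInfo A j k)
    (hR : R.Nonempty) (hp : τ p = j) : G.own P p ≤ G.f G.i (A G.i) := by
  have := r.induction (motive := fun P R τ => Final A P τ j → R.Nonempty → ∀ p, τ p = j →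
    G.own P p ≤ G.f G.i (A G.i)) ?_
  · exact this h hR p hp
  clear h r hR hp
  intro P R τ r ihe ihp h hR p hp
  refine r.cases ?_ ?_ ?_
  · rintro - rfl
    exact absurd hR Finset.not_nonempty_empty
  · intro σ τ' hs hσ hτ' r'
    have := ihe σ τ' hs hσ hτ' r' (h.elim hτ') hR (σ.symm p) (by rw [hτ', σ.apply_symm_apply, hp])
    simpa only [own, σ.apply_symm_apply] using this
  · intro y g hy hg r'
    have hyj := h.eq_of_pick r hg.1 r'
    obtain rfl : y = p := τ.injective (hyj.trans hp.symm)
    by_cases hyi : y = G.i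
    · subst hyi
      exact r.own_le _
    · have hτi : τ G.i = G.i := by
        rcases h.labels r H I with l | l | l
        · exact l.1
        · exact l.1
        · exact absurd (τ.injective (l.1.trans hp.symm)).symm hyi
      have := hy.1 G.i
      have hPi := h G.i (by rw [hτi]; exact H.hji.symm)
      rw [hτi] at hPi
      rw [← hPi]
      exact not_lt.1 this

end Game
end ECE

namespace ECE

open scoped Classical
open Finset

namespace Game

variable {m : ℕ} {G : Game m} {A P : Fin 3 → Finset (Fin m)} {R : Finset (Fin m)}
  {τ : Equiv.Perm (Fin 3)} {p q j k : Fin 3} {w : ℝ} {g : Fin m}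

lemma Viol.two_lt (H : G.Viol A j k) (hne : (A j).Nonempty) : 2 * G.x < G.V (A j) := by
  obtain ⟨g, hg⟩ := hne
  linarith [H.big g hg, G.nonneg g]

/-- No state in which everything is in place, while `i` reports her own bundle and the bundle
of `k` to be equally good. -/
lemma Final.false_of_id (h : Final A P τ j) (r : G.Run A P R τ) (H : G.Viol A j k)
    (I : G.QInfo A j k) (hne : (A j).Nonempty) (hτi : τ G.i = G.i) (hτj : τ j = j) (hτk : τ k = k)
    (hk : G.V (A k) ≤ G.x) (hj : G.V (P j) ≤ G.x) (hW : G.own P j ≤ G.f G.i (A G.i))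
    {ω : Fin 3 → ℝ} (hM : G.NW P R ω) (hωj : ω j ≤ ω G.i) (hωk : ω k ≤ ω G.i) : False := by
  have ei : P G.i = A G.i := by
    have := h G.i (by rw [hτi]; exact H.hji.symm)
    rwa [hτi] at this
  have ek : P k = A k := by
    have := h k (by rw [hτk]; exact H.hjk.symm)
    rwa [hτk] at this
  have hsub := (r.subset j).2
  rw [hτj] at hsub
  have tot := r.total H H.hji H.hki H.hjk
  have fot := r.reach.total (G.b k).val r.nw.1
  rw [sum_eq H.hji H.hki H.hjk, sum_eq H.hji H.hki H.hjk] at fot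
  change G.f k (P G.i) + G.f k (P j) + G.f k (P k) + G.f k R =
    G.f k (A G.i) + G.f k (A j) + G.f k (A k) at fot
  rw [ei, ek] at tot fot
  have hval := H.val
  have sat : G.f k (P j) + G.f k R ≤ G.f k (A k) := by linarith [I.sat]
  have h2 := H.two_lt hne
  have hk0 := G.V_nonneg (A k)
  have big : ∀ g ∈ R, 2 * G.x + G.v g < G.V (P j) + G.V (A k) + G.V R := fun g hg => by
    by_cases hgj : g ∈ A j
    · linarith [H.big g hgj]
    · have : G.V (A j) ≤ G.V (P j) + G.V (R.erase g) := V_le_of_subset_union fun u hu => by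
        have := mem_union.1 (hsub hu)
        exact mem_union.2 (this.imp_right fun hR => mem_erase.2 ⟨by rintro rfl; exact hgj hu, hR⟩)
      linarith [G.V_erase hg]
  obtain ⟨N, L⟩ := r.nw.lo H.hji H.hki H.hjk
  obtain ⟨N', L'⟩ := hM.lo H.hji H.hki H.hjk
  rw [own, ei, ek] at L
  rw [ei, ek] at L'
  have sp := L.split hval hj hk (by rw [own, ek]; exact I.own) hW I.free sat (by linarith) big
  exact L'.false_of_split hval hj hk hωj hωk sat (by linarith) big sp

lemma Run.rest_nonempty (r : G.Run A P R τ) (H : G.Viol A j k) (hne : (A j).Nonempty)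
    (hp : τ p = j) (hx : G.V (P p) ≤ G.x) : R.Nonempty := by
  by_contra hR
  rw [Finset.not_nonempty_iff_eq_empty] at hR
  have := (r.subset p).2
  rw [hR, union_empty, hp] at this
  linarith [G.V_mono this, H.two_lt hne, H.x_nonneg]

lemma Final.false_of_tie (h : Final A P τ j) (r : G.Run A P R τ) (H : G.Viol A j k)
    (I : G.QInfo A j k) (hne : (A j).Nonempty) (hk : G.V (A k) ≤ G.x) (hp : τ p = j)
    (hx : G.V (P p) ≤ G.x) (hw : G.f G.i (A G.i) ≤ w) {ω : Fin 3 → ℝ} (hM : G.NW P R ω)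
    (hωp : ω p = G.own P p) (hω : ∀ y, y ≠ p → ω y = w) : False := by
  have := r.induction (motive := fun P R τ => Final A P τ j → ∀ p ω, τ p = j →
    G.V (P p) ≤ G.x → G.NW P R ω → ω p = G.own P p → (∀ y, y ≠ p → ω y = w) → False) ?_
  · exact this h p ω hp hx hM hωp hω
  clear h r hp hx hM hωp hω
  intro P R τ r ihe ihp h p ω hp hx hM hωp hω
  have hR := r.rest_nonempty H hne hp hx
  have hWp := h.le_own r H I hR hp
  rcases h.labels r H I with ⟨l1, l2, l3⟩ | ⟨l1, l2, l3⟩ | ⟨l1, l2, l3⟩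
  · obtain rfl : p = j := τ.injective (hp.trans l2.symm)
    refine h.false_of_id r H I hne l1 l2 l3 hk hx hWp hM ?_ ?_
    · rw [hωp, hω G.i H.hji.symm]; exact hWp.trans hw
    · rw [hω k H.hjk.symm, hω G.i H.hji.symm]
  · obtain rfl : p = k := τ.injective (hp.trans l3.symm)
    have hpi := H.hki
    have hjp := H.hjk
    have ei : P G.i = A G.i := by
      have := h G.i (by rw [l1]; exact H.hji.symm)
      rwa [l1] at this
    have ej : P j = A p := by
      have := h j (by rw [l2]; exact hjp.symm)
      rwa [l2] at this
    have own_p := r.own_lt (y := p) (by rw [l3]; exact hjp)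
    have e1 : envies G.b P p j := by
      change G.f p (P p) < G.f p (P j)
      rwa [ej]
    have e2 : envies G.b P p G.i := by
      change G.f p (P p) < G.f p (P G.i)
      rw [ei]; exact own_p.trans I.free
    have e3 : ¬ envies G.b P G.i p := by
      change ¬ G.f G.i (P G.i) < G.f G.i (P p)
      rw [ei]; exact not_lt.2 hWp
    have hωi := hω G.i hpi.symm
    have m1 : ∀ z, ¬ G.Ed P ω G.i z := fun z => by
      rw [ed_i, hωi, not_lt]
      by_cases hz : z = p
      · rw [hz, hωp]; exact hWp.trans hw
      · exact (hω z hz).le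
    have src : ∀ z, IsSrc (G.Ed P ω) z → z = p := fun z hz => by
      rcases cover H.hji H.hki H.hjk z with rfl | rfl | rfl
      · exact absurd ((ed_of_ne hpi).2 e2) (hz p)
      · exact absurd ((ed_of_ne hpi).2 e1) (hz p)
      · rfl
    refine r.cases ?_ ?_ ?_
    · rintro - rfl
      exact absurd hR Finset.not_nonempty_empty
    · intro σ τ' hs hσ hτ' r'
      have hσi : σ G.i = G.i := by
        have : τ' G.i = G.i ∨ τ' G.i = j := by
          rcases (h.elim hτ').labels r' H I with l | l | l
          exacts [Or.inl l.1, Or.inl l.1, Or.inr l.1]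
        rw [hτ'] at this
        rcases this with e | e
        · exact τ.injective (e.trans l1.symm)
        · have e' : σ G.i = p := τ.injective (e.trans l3.symm)
          have := hσ.1.2 G.i (by rw [e']; exact hpi)
          rw [e'] at this
          exact absurd this e3
      have hMs : ¬ ∃ y, IsSrc (G.Ed P ω) y := by
        rintro ⟨y, hy⟩
        obtain rfl := src y hy
        refine hs ⟨y, fun z hz => ?_⟩
        by_cases hzi : z = G.i
        · subst hzi; exact e3 hz
        · exact hy z ((ed_of_ne hzi).2 hz)
      have hσM : IsMinCyc (G.Ed P ω) σ := by
        refine hσ.mono (fun y z hE => ?_) fun y hy => ?_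
        · by_cases hyi : y = G.i
          · subst hyi; exact absurd hE (m1 z)
          · exact (ed_of_ne hyi).1 hE
        · exact (ed_of_ne (by rintro rfl; exact hy hσi)).2 (hσ.1.2 y hy)
      refine ihe σ τ' hs hσ hτ' r' (h.elim hτ') (σ.symm p) (fun y => ω (σ y))
        (by rw [hτ', σ.apply_symm_apply, hp]) (by simpa using hx) (hM.elim hMs hσM)
        (by simpa [own] using hωp) fun y hy => hω _ fun e => hy ?_
      rw [← e, σ.symm_apply_apply]
    · intro y g hy hg r'
      obtain rfl : y = p := τ.injective ((h.eq_of_pick r hg.1 r').trans hp.symm)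
      have hyM : IsPick (G.Ed P ω) y := by
        refine ⟨fun z hz => ?_, fun z hz => ?_⟩
        · by_cases hzi : z = G.i
          · subst hzi; exact m1 _ hz
          · exact hy.1 z ((ed_of_ne hzi).1 hz)
        · obtain rfl := src z hz
          exact ⟨id, fun _ => le_rfl⟩
      by_cases hx' : G.V (insert g (P y)) ≤ G.x
      · refine ihp y g hy hg r' (h.pick hp) y _ hp (by rwa [Function.update_self])
          (hM.pick hyM hg.1 (fun _ => hg.2) (c := G.f G.i (insert g (P y))) ?_)
          (by rw [own, Function.update_self, Function.update_self]) fun z hz => ?_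
        · rw [hωp]; exact G.f_mono _ (subset_insert _ _)
        · rw [Function.update_of_ne hz]; exact hω z hz
      · obtain ⟨C, hR'⟩ := r.crossed_of_pick r' H hy hg hpi hp hx (not_le.1 hx')
        have hM' := hM.pick hyM hg.1 (fun _ => hg.2) (c := w + 1)
          (by rw [hωp]; linarith)
        obtain ⟨N, L⟩ := hM'.lo hpi H.hji hjp.symm
        rw [Function.update_self, Function.update_self, Function.update_of_ne hpi.symm,
          Function.update_of_ne hpi.symm, Function.update_of_ne hjp, Function.update_of_ne hjp,
          hωi, hω j hjp, ei, ej] at L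
        have hsub := (r'.subset y).1
        have own' := r'.own_lt (y := y) (by rw [hp]; exact hjp)
        rw [Function.update_self, hp] at hsub
        rw [Function.update_self] at own'
        have hww : w < w + 1 := by linarith
        exact H.false_of_tie I ⟨L, hww, hww, not_le.1 hx'⟩ le_rfl hsub hR' (fun _ => own')
          C.small C.large
  · obtain rfl : p = G.i := τ.injective (hp.trans l1.symm)
    have ej : P j = A G.i := by
      have := h j (by rw [l2]; exact H.hji.symm)
      rwa [l2] at this
    have ek : P k = A k := by
      have := h k (by rw [l3]; exact H.hjk.symm)
      rwa [l3] at this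
    have own_i := r.own_lt (y := G.i) (by rw [l1]; exact H.hji)
    have hEd : G.Ed P ω = envies G.b P := by
      ext y z
      by_cases hy : y = G.i
      · subst hy
        rw [ed_i, hωp]
        change _ ↔ G.f G.i (P G.i) < G.f G.i (P z)
        rcases cover H.hji H.hki H.hjk z with rfl | rfl | rfl
        · simp [hωp]
        · rw [hω z H.hji, ej]
          exact ⟨fun _ => own_i, fun h => lt_of_lt_of_le h hw⟩
        · rw [hω z H.hki, ek]
          exact ⟨fun _ => own_i.trans I.own, fun _ => own_i.trans_le hw⟩
      · exact ed_of_ne hy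
    refine r.cases ?_ ?_ ?_
    · rintro - rfl
      exact absurd hR Finset.not_nonempty_empty
    · intro σ τ' hs hσ hτ' r'
      refine ihe σ τ' hs hσ hτ' r' (h.elim hτ') (σ.symm G.i) (fun y => ω (σ y))
        (by rw [hτ', σ.apply_symm_apply, hp]) (by simpa using hx)
        (hM.elim (by rwa [hEd]) (by rwa [hEd]))
        (by simpa [own] using hωp) fun y hy => hω _ fun e => hy ?_
      rw [← e, σ.symm_apply_apply]
    · intro y g hy hg r'
      obtain rfl : y = G.i := τ.injective ((h.eq_of_pick r hg.1 r').trans hp.symm)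
      have hyM : IsPick (G.Ed P ω) G.i := by rwa [hEd]
      by_cases hx' : G.V (insert g (P G.i)) ≤ G.x
      · refine ihp _ g hy hg r' (h.pick hp) G.i _ hp (by rwa [Function.update_self])
          (hM.pick hyM hg.1 (fun _ => hg.2) (c := G.f G.i (insert g (P G.i))) ?_)
          (by rw [own, Function.update_self, Function.update_self]) fun z hz => ?_
        · rw [hωp]; exact G.f_mono _ (subset_insert _ _)
        · rw [Function.update_of_ne hz]; exact hω z hz
      · refine (hM.pick hyM hg.1 (fun _ => hg.2) (c := w) ?_).false_of_top (fun z => ?_) ?_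
        · rw [hωp]; exact hWp.trans hw
        · rw [Function.update_self]
          by_cases hz : z = G.i
          · rw [hz, Function.update_self]
          · rw [Function.update_of_ne hz]; exact (hω z hz).le
        · rw [Function.update_self]; exact not_le.1 hx'

end Game
end ECE

namespace ECE

open scoped Classical
open Finset

namespace Game

variable {m : ℕ} {G : Game m} {A P : Fin 3 → Finset (Fin m)} {R : Finset (Fin m)}
  {τ : Equiv.Perm (Fin 3)} {p q j k : Fin 3} {w : ℝ} {g : Fin m}

lemma Run.ne_of_pick (r : G.Run A P R τ) (hp : IsPick (envies G.b P) p) (hg : G.Top p R g)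
    (hx' : G.x < G.V (insert g (P p))) : p ≠ G.i := by
  rintro rfl
  obtain ⟨K, -, hK⟩ := exists_bound (G := G) A 0
  have hWK : ∀ y, G.own P y ≤ K := fun y => ((G.f_mono _ (r.subset y).1).trans_lt (hK _)).le
  rw [← ed_own] at hp
  refine (r.nw.pick hp hg.1 (fun _ => hg.2) (hWK _)).false_of_top (fun z => ?_) ?_
  · rw [Function.update_self]
    by_cases hz : z = G.i
    · rw [hz, Function.update_self]
    · rw [Function.update_of_ne hz]; exact hWK z
  · rwa [Function.update_self]

lemma Run.qInfo (r : G.Run A P R τ) (H : G.Viol A j k) (hne : (A j).Nonempty) (hp : τ p = j)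
    (hx : G.V (P p) ≤ G.x) : G.QInfo A j k ∧ G.V (A k) ≤ G.x := by
  have := r.induction (motive := fun P R τ => ∀ p, τ p = j → G.V (P p) ≤ G.x →
    G.QInfo A j k ∧ G.V (A k) ≤ G.x) ?_
  · exact this p hp hx
  clear r hp hx
  intro P R τ r ihe ihp p hp hx
  refine r.cases ?_ ?_ ?_
  · rintro - rfl
    exact absurd (r.rest_nonempty H hne hp hx) Finset.not_nonempty_empty
  · intro σ τ' hs hσ hτ' r'
    exact ihe σ τ' hs hσ hτ' r' (σ.symm p) (by rw [hτ', σ.apply_symm_apply, hp]) (by simpa using hx)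
  · intro y g hy hg r'
    by_cases hyp : y = p
    · subst hyp
      by_cases hx' : G.V (insert g (P y)) ≤ G.x
      · exact ihp y g hy hg r' y hp (by rwa [Function.update_self])
      · obtain ⟨C, u, hu⟩ := r.crossed_of_pick r' H hy hg (r.ne_of_pick hy hg (not_le.1 hx')) hp hx
          (not_le.1 hx')
        exact ⟨C.info, by linarith [C.small u hu, G.nonneg u]⟩
    · exact ihp y g hy hg r' p hp (by rwa [Function.update_of_ne (Ne.symm hyp)])

lemma Run.false_of_tie_pick (r : G.Run A P R τ) {y z : Fin 3}
    (r' : G.Run A (Function.update P y (insert g (P y))) (R.erase g) τ)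
    (h : Final A (Function.update P y (insert g (P y))) τ j) (H : G.Viol A j k)
    (I : G.QInfo A j k) (hne : (A j).Nonempty) (hk : G.V (A k) ≤ G.x) (hp : τ p = j)
    (hx : G.V (P p) ≤ G.x) (hy : IsPick (envies G.b P) y) (hg : G.Top y R g)
    (hyp : y ≠ p) (hzp : z ≠ p) (hzy : z ≠ y) (hw : G.f G.i (A G.i) ≤ G.own P z)
    (hc : G.own P y ≤ G.own P z) : False := by
  rw [← ed_own] at hy
  refine h.false_of_tie r' H I hne hk hp (by rwa [Function.update_of_ne hyp.symm]) hw
    (r.nw.pick hy hg.1 (fun _ => hg.2) hc) ?_ fun u hu => ?_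
  · rw [Function.update_of_ne hyp.symm, own, own, Function.update_of_ne hyp.symm]
  · by_cases huy : u = y
    · rw [huy, Function.update_self]
    · rw [Function.update_of_ne huy]
      have : u = z := by omega
      rw [this]

lemma Run.false_of_not_final (r : G.Run A P R τ) (H : G.Viol A j k) (I : G.QInfo A j k)
    (hne : (A j).Nonempty) (hk : G.V (A k) ≤ G.x) (hp : τ p = j) (hx : G.V (P p) ≤ G.x)
    (hF : ¬ Final A P τ j) : False := by
  have := r.induction (motive := fun P R τ => ∀ p, τ p = j → G.V (P p) ≤ G.x →
    ¬ Final A P τ j → False) ?_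
  · exact this p hp hx hF
  clear r hp hx hF
  intro P R τ r ihe ihp p hp hx hF
  refine r.cases ?_ ?_ ?_
  · rintro - rfl
    exact absurd (r.rest_nonempty H hne hp hx) Finset.not_nonempty_empty
  · intro σ τ' hs hσ hτ' r'
    refine ihe σ τ' hs hσ hτ' r' (σ.symm p) (by rw [hτ', σ.apply_symm_apply, hp])
      (by simpa using hx) fun hfin => hF fun y hy => ?_
    have := hfin (σ.symm y)
    rw [hτ', σ.apply_symm_apply] at this
    simpa using this hy
  · intro y g hy hg r'
    by_cases hyp : y = p
    · subst hyp
      have back : ¬ Final A (Function.update P y (insert g (P y))) τ j := fun hfin =>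
        hF fun z hz => by
          have := hfin z hz
          rwa [Function.update_of_ne (by rintro rfl; exact hz hp)] at this
      by_cases hx' : G.V (insert g (P y)) ≤ G.x
      · exact ihp y g hy hg r' y hp (by rwa [Function.update_self]) back
      · exact back (r.crossed_of_pick r' H hy hg (r.ne_of_pick hy hg (not_le.1 hx')) hp hx
          (not_le.1 hx')).1.final
    · by_cases hfin : Final A (Function.update P y (insert g (P y))) τ j
      · have rest : ∀ z, z ≠ y → τ z ≠ j → P z = A (τ z) := fun z hzy hz => by
          have := hfin z hz
          rwa [Function.update_of_ne hzy] at this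
        have hyj : τ y ≠ j := fun e => hyp (τ.injective (e.trans hp.symm))
        rcases (cover H.hji H.hki H.hjk (τ y) : _ ∨ _ ∨ _) with e | e | e
        · have hz : τ (τ.symm k) = k := τ.apply_symm_apply k
          have hzy : τ.symm k ≠ y := fun h => H.hki (by rw [← hz, h, e])
          have hzp : τ.symm k ≠ p := fun h => H.hjk (by rw [← hz, h, hp])
          have hPz := rest _ hzy (by rw [hz]; exact H.hjk.symm)
          rw [hz] at hPz
          have hPy := G.f_mono G.i (r.subset y).1
          rw [e] at hPy
          refine r.false_of_tie_pick r' hfin H I hne hk hp hx hy hg hyp hzp hzy ?_ ?_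
          · rw [own, hPz]; exact I.own.le
          · rw [own, own, hPz]; exact hPy.trans I.own.le
        · exact hyj e
        · have hz : τ (τ.symm G.i) = G.i := τ.apply_symm_apply G.i
          have hzy : τ.symm G.i ≠ y := fun h => H.hki (by rw [← e, ← h, hz])
          have hzp : τ.symm G.i ≠ p := fun h => H.hji (by rw [← hp, ← h, hz])
          have hPz := rest _ hzy (by rw [hz]; exact H.hji.symm)
          rw [hz] at hPz
          refine r.false_of_tie_pick r' hfin H I hne hk hp hx hy hg hyp hzp hzy ?_ ?_
          · rw [own, hPz]
          · rw [own, own, hPz]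
            exact (not_lt.1 (hy.1 G.i)).trans (r.own_le G.i)
      · exact ihp y g hy hg r' p hp (by rwa [Function.update_of_ne (Ne.symm hyp)]) hfin

/-- The bundle of `j` cannot be too good for `i`. -/
lemma Run.false_of_viol (r : G.Run A (fun _ => ∅) R τ) (H : G.Viol A j k)
    (hne : (A j).Nonempty) : False := by
  have hp : τ (τ.symm j) = j := τ.apply_symm_apply j
  have hx : G.V ((fun _ => ∅ : Fin 3 → Finset (Fin m)) (τ.symm j)) ≤ G.x := by
    rw [V_empty]; exact H.x_nonneg
  obtain ⟨I, hk⟩ := r.qInfo H hne hp hx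
  refine r.false_of_not_final H I hne hk hp hx fun hF => ?_
  have := hF (τ.symm k) (by rw [τ.apply_symm_apply]; exact H.hjk.symm)
  rw [τ.apply_symm_apply] at this
  have h := I.own
  rw [← this, f_empty] at h
  exact not_lt.2 (G.f_nonneg _ _) h

end Game
end ECE

namespace ECE

open scoped Classical
open Finset

/-- A best response in a three-agent game leaves the agent with at least half of every other
bundle, up to one good. -/
lemma BestResponse.half_EF1 {m : ℕ} {v : Fin m → ℝ} (hv : ∀ g, 0 ≤ v g) {b : Fin 3 → Bid m}
    {i : Fin 3} (hbr : BestResponse PreferredItemECE v b i) :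
    EF1From (1 / 2) v (PreferredItemECE b) i := by
  intro j hne
  by_contra! h
  have hji : j ≠ i := by
    rintro rfl
    obtain ⟨g, hg⟩ := hne
    have h1 := h g hg
    have h2 : value v ((PreferredItemECE b j).erase g) ≤ value v (PreferredItemECE b j) :=
      Finset.sum_le_sum_of_subset_of_nonneg (Finset.erase_subset _ _) fun g _ _ => hv g
    have h3 : 0 ≤ value v (PreferredItemECE b j) := Finset.sum_nonneg fun g _ => hv g
    linarith
  obtain ⟨k, hki, hjk⟩ := Game.exists_others i j hji
  obtain ⟨τ, hτ⟩ := exists_reach_init b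
  let G : Game m := ⟨b, i, v, value v (PreferredItemECE b i), hv⟩
  have hown : G.own (fun _ => ∅) = fun _ => 0 := funext fun _ => G.f_empty _
  have r : G.Run (PreferredItemECE b) (fun _ => ∅) univ τ :=
    ⟨hτ, fun _ => Finset.disjoint_empty_left _, hown ▸ not_win_init hbr⟩
  refine r.false_of_viol (j := j) (k := k) ⟨hji, hki, hjk, rfl, fun g hg => ?_, fun y z =>
    hτ.pairwise_disjoint (fun _ => Finset.disjoint_empty_left _)
      (fun _ _ _ => Finset.disjoint_empty_left _) y z⟩ hne
  have h1 := h g hg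
  have h2 : value v ((PreferredItemECE b j).erase g) = _ := G.V_erase hg
  rw [h2] at h1
  change 2 * value v (PreferredItemECE b i) < _
  linarith

end ECE

/-- For any instance with exactly 3 agents whose true valuations are
additive, and any bid profile in which agent `i`'s bid is a best response to the other
agents' bids, the allocation produced by Preferred-Item-E-C-E is `(1/2)`-EF1 from
agent `i`'s perspective with respect to agent `i`'s true valuation. -/
theorem preferredItem_three_best_response_half_EF1 {m : ℕ} (v : Fin 3 → Fin m → ℝ)
    (hv : ∀ i g, 0 ≤ v i g) (b : Fin 3 → Bid m) (i : Fin 3)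
    (hbr : BestResponse PreferredItemECE (v i) b i) :
    EF1From (1 / 2) (v i) (PreferredItemECE b) i :=
  hbr.half_EF1 (hv i)
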